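/- arXiv:1308.0611 — 8 statements merged into one kernel-verified Lean document; each statement's English description precedes it below -/
import Mathlib

section
/- For every hypergraph H in which every edge has size at least 2 and at most r (where r ≥ 2), and in which no edge consists of twins, there exists an edge weighting ω : E(H) → {1, 2, ..., 5r−5} such that the induced vertex weights properly color V(H), i.e., every edge of H contains at least two vertices with different induced weights. -/
namespace HypergraphWeighting

/-! ### Pairing the integers -/

/-- The smaller element of the pair `{w, w + r}`, with `w / r` even, that contains `x`. -/
def lo (r x : ℤ) : ℤ := x - r * (x / r % 2)

lemma lo_add_of_even {r x : ℤ} (hr : 0 < r) (h : x / r % 2 = 0) : lo r (x + r) = x := by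
  have h1 : (x + r) / r = x / r + 1 := Int.add_ediv_of_dvd_right (dvd_refl r) |>.trans (by
    rw [Int.ediv_self hr.ne'])
  have h2 : (x / r + 1) % 2 = 1 := by omega
  simp [lo, h1, h2]

lemma lo_of_even {r x : ℤ} (h : x / r % 2 = 0) : lo r x = x := by simp [lo, h]

lemma lo_ediv_even {r : ℤ} (hr : 0 < r) (x : ℤ) : lo r x / r % 2 = 0 := by
  have h1 : lo r x / r = x / r - x / r % 2 := by
    rw [lo, Int.sub_mul_ediv_left _ _ hr.ne']
  omega

lemma eq_lo_or (r x : ℤ) : x = lo r x ∨ x = lo r x + r := by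
  unfold lo
  rcases Int.emod_two_eq_zero_or_one (x / r) with h | h <;> simp [h]

lemma lo_lo {r : ℤ} (hr : 0 < r) (x : ℤ) : lo r (lo r x) = lo r x :=
  lo_of_even (lo_ediv_even hr x)

lemma lo_lo_add {r : ℤ} (hr : 0 < r) (x : ℤ) : lo r (lo r x + r) = lo r x :=
  lo_add_of_even hr (lo_ediv_even hr x)

lemma dvd_lo_sub (r x : ℤ) : r ∣ lo r x - x := ⟨-(x / r % 2), by unfold lo; ring⟩

lemma lo_ne_add {r : ℤ} (hr : 0 < r) (x y : ℤ) : lo r x ≠ lo r y + r := fun h => by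
  have h1 := lo_lo_add hr y
  rw [← h, lo_lo hr] at h1
  omega

/-- Among the vertex weights reachable by flipping pairs and choosing one further edge weight `y`
outside the forbidden residues, one lies in none of the `d` blocked pairs. -/
lemma exists_unblocked (r : ℕ) (hr : 2 ≤ r) (B L : Finset ℤ) (hB : B.card ≤ r - 2) (d : ℕ)
    (hL : L.card ≤ d) (c : ℤ) :
    ∃ t ≤ d, ∃ y : ℤ, y % r ∉ B ∧ lo r (c + y + r * t) ∉ L ∧
      ((r + 1 ≤ y ∧ y ≤ 2 * r - 1) ∨ (y = r ∧ c + y + r * t = lo r (c + y + r * t)) ∨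
        (y = 2 * r ∧ c + y + r * t = lo r (c + y + r * t) + r)) := by
  have hr0 : (0 : ℤ) < r := by omega
  obtain ⟨a, b, ha, hb, hab, ha0⟩ : ∃ a b : ℤ, a ∈ Finset.Ico (0 : ℤ) r \ B ∧
      b ∈ Finset.Ico (0 : ℤ) r \ B ∧ a ≠ b ∧ a ≠ 0 := by
    have hcard : 1 < (Finset.Ico (0 : ℤ) r \ B).card := by
      have h1 := Finset.le_card_sdiff B (Finset.Ico (0 : ℤ) r)
      simp only [Int.card_Ico, sub_zero, Int.toNat_natCast] at h1
      omega
    obtain ⟨a, ha, b, hb, hab⟩ := Finset.one_lt_card.1 hcard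
    by_cases h : a = 0
    · exact ⟨b, a, hb, ha, hab.symm, fun h' => hab (h.trans h'.symm)⟩
    · exact ⟨a, b, ha, hb, hab, h⟩
  simp only [Finset.mem_sdiff, Finset.mem_Ico] at ha hb
  have hmod : ∀ z : ℤ, 0 ≤ z → z < r → ((r : ℤ) + z) % r = z := fun z h0 h1 => by
    rw [Int.add_emod_left, Int.emod_eq_of_lt h0 h1]
  let Y₁ := (Finset.range (d + 1)).image fun t : ℕ => c + (r + a) + (r : ℤ) * t
  let Y₂ := (Finset.range d).image fun t : ℕ => c + (r + b) + (r : ℤ) * (t + 1)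
  have h₁ : Y₁.card = d + 1 := by
    rw [Finset.card_image_of_injective, Finset.card_range]
    intro s t h
    have := mul_left_cancel₀ hr0.ne' (add_left_cancel h)
    exact_mod_cast this
  have h₂ : Y₂.card = d := by
    rw [Finset.card_image_of_injective, Finset.card_range]
    intro s t h
    have := mul_left_cancel₀ hr0.ne' (add_left_cancel h)
    exact_mod_cast add_right_cancel this
  have hdis : Disjoint Y₁ Y₂ := by
    rw [Finset.disjoint_left]
    intro x hx hx'
    simp only [Y₁, Y₂, Finset.mem_image] at hx hx'
    obtain ⟨s, -, rfl⟩ := hx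
    obtain ⟨t, -, ht⟩ := hx'
    have h3 : (r + a) + (r : ℤ) * s = (r + b) + (r : ℤ) * (t + 1) := by linarith
    have h4 := congrArg (· % (r : ℤ)) h3
    simp only [Int.add_mul_emod_self_left, hmod a ha.1.1 ha.1.2, hmod b hb.1.1 hb.1.2] at h4
    exact hab h4
  obtain ⟨x, hx, hxL⟩ : ∃ x ∈ Y₁ ∪ Y₂, lo r x ∉ L := by
    by_contra! h
    have h3 := Finset.card_le_mul_card_image_of_maps_to (f := lo r) (s := Y₁ ∪ Y₂) (t := L) h 2
      (fun l _ => by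
        refine (Finset.card_le_card (t := {l, l + r}) ?_).trans Finset.card_le_two
        intro x hx
        obtain ⟨-, rfl⟩ := Finset.mem_filter.1 hx
        simpa using eq_lo_or r x)
    rw [Finset.card_union_of_disjoint hdis] at h3
    omega
  rcases Finset.mem_union.1 hx with hx | hx
  · obtain ⟨t, ht, rfl⟩ := Finset.mem_image.1 hx
    rw [Finset.mem_range] at ht
    refine ⟨t, by omega, r + a, by rw [hmod a ha.1.1 ha.1.2]; exact ha.2, hxL, Or.inl ?_⟩
    omega
  · obtain ⟨t, ht, rfl⟩ := Finset.mem_image.1 hx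
    rw [Finset.mem_range] at ht
    have hb' : ((r : ℤ) + b) % r ∉ B := by rw [hmod b hb.1.1 hb.1.2]; exact hb.2
    by_cases hb0 : b = 0
    · subst hb0
      have e1 : c + (r + 0) + (r : ℤ) * (t + 1) = c + r + r * (t + 1 : ℕ) := by push_cast; ring
      have e2 : c + (r + 0) + (r : ℤ) * (t + 1) = c + 2 * r + r * t := by ring
      rcases eq_lo_or r (c + (r + 0) + (r : ℤ) * (t + 1)) with h | h
      · rw [e1] at hxL h
        exact ⟨t + 1, ht, r, by simpa using hb', hxL, Or.inr (Or.inl ⟨rfl, h⟩)⟩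
      · rw [e2] at hxL h
        exact ⟨t, ht.le, 2 * r, by simpa using hb', hxL, Or.inr (Or.inr ⟨rfl, h⟩)⟩
    · refine ⟨t + 1, ht, r + b, hb', by push_cast; exact hxL, Or.inl ?_⟩
      omega

/-- With at least two pairs, some choice of upper and lower elements avoids a common value that
grows by `r` with every upper element chosen. -/
lemma exists_avoiding {V : Type*} [DecidableEq V] {r : ℤ} (hr : 0 < r) (T : Finset V)
    (hT : 1 < T.card) (f : V → ℤ) (c : ℤ) :
    ∃ R ⊆ T, ∀ a ∈ T, lo r (f a) + (if a ∈ R then r else 0) ≠ c + r * R.card := by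
  by_cases h0 : ∀ a ∈ T, lo r (f a) ≠ c
  · exact ⟨∅, Finset.empty_subset _, by simpa using h0⟩
  push Not at h0
  obtain ⟨a₀, ha₀, h0⟩ := h0
  by_cases h1 : ∃ b ∈ T, lo r (f b) ≠ c
  · obtain ⟨b, hb, hbc⟩ := h1
    refine ⟨{b}, by simpa using hb, fun a _ => ?_⟩
    by_cases hab : a = b
    · subst hab; simpa using hbc
    · simpa [hab, ← h0] using lo_ne_add hr (f a) (f a₀)
  · push Not at h1
    obtain ⟨b, hb, hab⟩ := Finset.exists_mem_ne hT a₀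
    refine ⟨{a₀, b}, by simp [Finset.insert_subset_iff, ha₀, hb], fun a ha => ?_⟩
    rw [h1 a ha, Finset.card_pair hab.symm]
    split_ifs <;> push_cast <;> intro h <;> linarith

variable {V ι : Type*}

/-! ### Ordering the vertices -/

/-- An ordering of the vertices by `rank`, together with the first two vertices of every edge. -/
structure VertexOrder (E : ι → Finset V) where
  rank : V → ℕ
  fst : ι → V
  snd : ι → V
  fst_mem : ∀ i, fst i ∈ E i
  snd_mem : ∀ i, snd i ∈ E i
  fst_lt_snd : ∀ i, rank (fst i) < rank (snd i)
  eq_fst_or_snd_le : ∀ i, ∀ x ∈ E i, x = fst i ∨ rank (snd i) ≤ rank x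
  rank_injective : Function.Injective rank

namespace VertexOrder

variable {E : ι → Finset V} (O : VertexOrder E)

lemma rank_fst_le {i : ι} {x : V} (h : x ∈ E i) : O.rank (O.fst i) ≤ O.rank x := by
  rcases O.eq_fst_or_snd_le i x h with rfl | h
  · exact le_rfl
  · exact (O.fst_lt_snd i).le.trans h

/-- No edge has exactly one vertex among those up to `v`. -/
def Closed (v : V) : Prop := ∀ i, O.rank (O.fst i) ≤ O.rank v → O.rank (O.snd i) ≤ O.rank v

/-- The vertex `v` is second only in edges starting at `u`, and weight differences between `u` and
`v` come only from edges in which neither is among the first two vertices. -/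
structure IsPair (u v : V) : Prop where
  closed : O.Closed v
  fst_eq : ∀ i, O.snd i = v → O.fst i = u
  exists_snd : ∃ i, O.snd i = v
  ne_of_separates : ∀ i, ¬(u ∈ E i ↔ v ∈ E i) → ∀ x, x = u ∨ x = v → x ≠ O.fst i ∧ x ≠ O.snd i

variable {O} in
lemma IsPair.left_ne {u v u' v' : V} (h : O.IsPair u v) (h' : O.IsPair u' v') : u ≠ v' := by
  rintro rfl
  obtain ⟨i, hi⟩ := h.exists_snd
  have h1 := h.fst_eq i hi
  have h2 := h'.closed i (by rw [h1])
  have h3 := O.fst_lt_snd i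
  rw [h1] at h3
  omega

variable {O} in
lemma IsPair.right_unique {u v v' : V} (h : O.IsPair u v) (h' : O.IsPair u v') : v = v' := by
  obtain ⟨i, rfl⟩ := h.exists_snd
  obtain ⟨j, rfl⟩ := h'.exists_snd
  have hi := h.fst_eq i rfl
  have hj := h'.fst_eq j rfl
  have h1 := O.fst_lt_snd i
  have h2 := O.fst_lt_snd j
  have h3 := h.closed j (by rw [hj, ← hi]; exact h1.le)
  have h4 := h'.closed i (by rw [hi, ← hj]; exact h2.le)
  exact O.rank_injective (le_antisymm h4 h3)

variable {O} in
lemma IsPair.left_unique {u u' v : V} (h : O.IsPair u v) (h' : O.IsPair u' v) : u = u' := by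
  obtain ⟨i, hi⟩ := h.exists_snd
  rw [← h.fst_eq i hi, ← h'.fst_eq i hi]

/-- The order can be processed vertex by vertex. -/
def Good : Prop := ∀ v, (∃ i, O.fst i = v) ∨ (O.Closed v ∧
  ((∀ i, O.snd i ≠ v) ∨ (∃ i j, O.snd i = v ∧ O.snd j = v ∧ O.fst i ≠ O.fst j) ∨
    ∃ u, O.IsPair u v))

end VertexOrder

variable [DecidableEq V]

/-- `v` may be put last among the vertices of `W`. -/
def CanBeLast (E : ι → Finset V) (W : Finset V) (v : V) : Prop :=
  (∃ i, E i ∩ W = {v}) ∨ ((∀ i, (E i ∩ W).card ≠ 1) ∧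
    ((∀ i, v ∈ E i → (E i ∩ W).card ≠ 2) ∨
      (∃ i j a b, a ≠ b ∧ a ≠ v ∧ b ≠ v ∧ E i ∩ W = {a, v} ∧ E j ∩ W = {b, v}) ∨
      ∃ u, u ≠ v ∧ (∃ i, E i ∩ W = {u, v}) ∧
        ∀ i, (E i ∩ W).card = 2 → (u ∈ E i ↔ v ∈ E i)))

lemma exists_pair_of_card {A W : Finset V} {v : V} (hv : v ∈ A) (hW : v ∈ W)
    (h : (A ∩ W).card = 2) : ∃ u, u ≠ v ∧ A ∩ W = {u, v} := by
  obtain ⟨a, b, hab, h⟩ := Finset.card_eq_two.1 h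
  have : v ∈ A ∩ W := Finset.mem_inter.2 ⟨hv, hW⟩
  rw [h, Finset.mem_insert, Finset.mem_singleton] at this
  rcases this with rfl | rfl
  · exact ⟨b, hab.symm, by rw [h, Finset.pair_comm]⟩
  · exact ⟨a, hab, h⟩

lemma exists_canBeLast (E : ι → Finset V) {W : Finset V} (hW : W.Nonempty) :
    ∃ v ∈ W, CanBeLast E W v := by
  by_cases h1 : ∃ i, (E i ∩ W).card = 1
  · obtain ⟨i, hi⟩ := h1
    obtain ⟨v, hv⟩ := Finset.card_eq_one.1 hi
    have : v ∈ E i ∩ W := by simp [hv]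
    exact ⟨v, (Finset.mem_inter.1 this).2, Or.inl ⟨i, hv⟩⟩
  push Not at h1
  by_cases h2 : ∃ v ∈ W, ∃ i j a b, a ≠ b ∧ a ≠ v ∧ b ≠ v ∧ E i ∩ W = {a, v} ∧ E j ∩ W = {b, v}
  · obtain ⟨v, hv, h⟩ := h2
    exact ⟨v, hv, Or.inr ⟨h1, Or.inr (Or.inl h)⟩⟩
  push Not at h2
  obtain ⟨v, hv⟩ := hW
  refine ⟨v, hv, Or.inr ⟨h1, ?_⟩⟩
  by_cases h0 : ∀ i, v ∈ E i → (E i ∩ W).card ≠ 2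
  · exact Or.inl h0
  push Not at h0
  obtain ⟨i, hvi, hi⟩ := h0
  obtain ⟨u, huv, hu⟩ := exists_pair_of_card hvi hv hi
  have huW : u ∈ W := (Finset.mem_inter.1 (by rw [hu]; simp : u ∈ E i ∩ W)).2
  refine Or.inr (Or.inr ⟨u, huv, ⟨i, hu⟩, fun j hj => ⟨fun huj => ?_, fun hvj => ?_⟩⟩)
  · obtain ⟨w, hwu, hw⟩ := exists_pair_of_card huj huW hj
    by_cases hwv : w = v
    · subst hwv
      exact (Finset.mem_inter.1 (by rw [hw]; simp : w ∈ E j ∩ W)).1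
    · exact absurd (by rw [hu, Finset.pair_comm])
        (h2 u huW j i w v hwv hwu huv.symm hw)
  · obtain ⟨w, hwv, hw⟩ := exists_pair_of_card hvj hv hj
    by_cases hwu : w = u
    · subst hwu
      exact (Finset.mem_inter.1 (by rw [hw]; simp : w ∈ E j ∩ W)).1
    · exact absurd hu (h2 v hv j i w u hwu hwv huv hw)

lemma exists_rank (E : ι → Finset V) (W : Finset V) :
    ∃ ρ : V → ℕ, Set.InjOn ρ W ∧ (∀ v ∈ W, ρ v < W.card) ∧
      ∀ v ∈ W, CanBeLast E (W.filter fun x => ρ x ≤ ρ v) v := by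
  induction h : W.card generalizing W with
  | zero =>
    rw [Finset.card_eq_zero] at h
    subst h
    exact ⟨fun _ => 0, by simp⟩
  | succ n ih =>
    obtain ⟨v, hv, hlast⟩ := exists_canBeLast E (W := W) (Finset.card_pos.1 (by omega))
    obtain ⟨ρ, hinj, hlt, hρ⟩ := ih (W.erase v) (by rw [Finset.card_erase_of_mem hv]; omega)
    have hne : ∀ x ∈ W, x ≠ v → ρ x < n := fun x hx hxv => hlt x (Finset.mem_erase.2 ⟨hxv, hx⟩)
    have hself : Function.update ρ v n v = n := Function.update_self ..
    have hof : ∀ x, x ≠ v → Function.update ρ v n x = ρ x := fun x hx =>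
      Function.update_of_ne hx ..
    refine ⟨Function.update ρ v n, fun x hx y hy hxy => ?_, fun x hx => ?_, fun x hx => ?_⟩
    · by_cases hxv : x = v <;> by_cases hyv : y = v
      · rw [hxv, hyv]
      · rw [hxv, hself, hof y hyv] at hxy
        have := hne y hy hyv
        omega
      · rw [hyv, hself, hof x hxv] at hxy
        have := hne x hx hxv
        omega
      · rw [hof x hxv, hof y hyv] at hxy
        exact hinj (by simp_all) (by simp_all) hxy
    · by_cases hxv : x = v
      · rw [hxv, hself]; omega
      · rw [hof x hxv]
        exact (hne x hx hxv).trans (Nat.lt_succ_self n)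
    · by_cases hxv : x = v
      · subst hxv
        convert hlast
        rw [Finset.filter_eq_self]
        intro y hy
        rw [hself]
        by_cases hyx : y = x
        · rw [hyx, hself]
        · rw [hof y hyx]
          exact (hne y hy hyx).le
      · convert hρ x (Finset.mem_erase.2 ⟨hxv, hx⟩) using 1
        ext y
        have hx' := hne x hx hxv
        by_cases hyv : y = v
        · subst hyv
          simp only [Finset.mem_filter, hself, hof x hxv, Finset.mem_erase]
          constructor
          · intro h; omega
          · intro h; exact absurd rfl h.1.1
        · simp [hof x hxv, hyv]

lemma exists_good_vertexOrder [Fintype V] (E : ι → Finset V) (hE : ∀ i, 2 ≤ (E i).card) :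
    ∃ O : VertexOrder E, O.Good := by
  obtain ⟨ρ, hinj, -, hρ⟩ := exists_rank E Finset.univ
  have hinj : Function.Injective ρ := by simpa [Set.injOn_univ] using hinj
  have hfst : ∀ i, ∃ a ∈ E i, ∀ x ∈ E i, ρ a ≤ ρ x := fun i =>
    Finset.exists_min_image _ _ (Finset.card_pos.1 (by have := hE i; omega))
  choose α hα hmin using hfst
  have hsnd : ∀ i, ∃ b ∈ (E i).erase (α i), ∀ x ∈ (E i).erase (α i), ρ b ≤ ρ x := fun i =>
    Finset.exists_min_image _ _ (Finset.card_pos.1 (by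
      rw [Finset.card_erase_of_mem (hα i)]; have := hE i; omega))
  choose β hβ hmin' using hsnd
  let O : VertexOrder E :=
    { rank := ρ
      fst := α
      snd := β
      fst_mem := hα
      snd_mem := fun i => Finset.mem_of_mem_erase (hβ i)
      fst_lt_snd := fun i => lt_of_le_of_ne (hmin i _ (Finset.mem_of_mem_erase (hβ i)))
        fun h => Finset.ne_of_mem_erase (hβ i) (hinj h).symm
      eq_fst_or_snd_le := fun i x hx => or_iff_not_imp_left.2 fun h =>
        hmin' i x (Finset.mem_erase.2 ⟨h, hx⟩)
      rank_injective := hinj }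
  refine ⟨O, fun v => ?_⟩
  let W := Finset.univ.filter fun x => ρ x ≤ ρ v
  have hW : ∀ x, x ∈ W ↔ ρ x ≤ ρ v := by simp [W]
  have hvW : v ∈ W := (hW v).2 le_rfl
  have pair_spec : ∀ i a, a ≠ v → E i ∩ W = {a, v} → α i = a ∧ β i = v := by
    intro i a hav h
    have ha : a ∈ E i ∩ W := by simp [h]
    have hv : v ∈ E i ∩ W := by simp [h]
    rw [Finset.mem_inter, hW] at ha hv
    have h1 : α i ∈ E i ∩ W := Finset.mem_inter.2 ⟨hα i, (hW _).2 (hmin i v hv.1)⟩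
    rw [h, Finset.mem_insert, Finset.mem_singleton] at h1
    have h2 : α i = a := by
      refine h1.resolve_right fun h2 => hav (hinj (le_antisymm ha.2 ?_))
      rw [← h2]
      exact hmin i a ha.1
    refine ⟨h2, ?_⟩
    have h3 : β i ∈ E i ∩ W := Finset.mem_inter.2 ⟨O.snd_mem i, (hW _).2
      (hmin' i v (Finset.mem_erase.2 ⟨fun h4 => hav (h2.symm.trans h4.symm), hv.1⟩))⟩
    rw [h, Finset.mem_insert, Finset.mem_singleton] at h3
    exact h3.resolve_left fun h4 => Finset.ne_of_mem_erase (hβ i) (h4.trans h2.symm)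
  have snd_spec : ∀ i, ρ (β i) = ρ v → E i ∩ W = {α i, v} := by
    intro i h
    ext x
    rw [Finset.mem_inter, hW, Finset.mem_insert, Finset.mem_singleton]
    constructor
    · rintro ⟨hx, hxv⟩
      exact (O.eq_fst_or_snd_le i x hx).imp_right fun h' => hinj (le_antisymm hxv (h ▸ h'))
    · rintro (rfl | rfl)
      · exact ⟨hα i, h ▸ (O.fst_lt_snd i).le⟩
      · exact ⟨hinj h ▸ O.snd_mem i, le_rfl⟩
  have ne_of_snd : ∀ i, β i = v → α i ≠ v := fun i hi h =>
    (O.fst_lt_snd i).ne (congrArg ρ (h.trans hi.symm))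
  have closed : (∀ i, (E i ∩ W).card ≠ 1) → O.Closed v := by
    intro h i hi
    by_contra hlt
    apply h i
    rw [Finset.card_eq_one]
    refine ⟨α i, Finset.eq_singleton_iff_unique_mem.2
      ⟨Finset.mem_inter.2 ⟨hα i, (hW _).2 hi⟩, fun x hx => ?_⟩⟩
    rw [Finset.mem_inter, hW] at hx
    exact (O.eq_fst_or_snd_le i x hx.1).resolve_right fun h' => hlt (h'.trans hx.2)
  rcases hρ v (Finset.mem_univ v) with ⟨i, hi⟩ | ⟨h1, h⟩
  · left
    have hv : v ∈ E i ∩ W := by rw [hi]; simp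
    rw [Finset.mem_inter] at hv
    refine ⟨i, ?_⟩
    have : α i ∈ E i ∩ W := Finset.mem_inter.2 ⟨hα i, (hW _).2 (hmin i v hv.1)⟩
    rw [hi] at this
    exact Finset.mem_singleton.1 this
  refine Or.inr ⟨closed h1, ?_⟩
  rcases h with h | ⟨i, j, a, b, hab, hav, hbv, hi, hj⟩ | ⟨u, huv, ⟨i, hi⟩, h⟩
  · left
    intro i hi
    refine h i (hi ▸ O.snd_mem i) ?_
    have := snd_spec i (congrArg ρ hi)
    rw [this, Finset.card_pair (ne_of_snd i hi)]
  · right; left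
    obtain ⟨hi1, hi2⟩ := pair_spec i a hav hi
    obtain ⟨hj1, hj2⟩ := pair_spec j b hbv hj
    exact ⟨i, j, hi2, hj2, by rw [show O.fst i = a from hi1, show O.fst j = b from hj1]; exact hab⟩
  · right; right
    obtain ⟨hi1, hi2⟩ := pair_spec i u huv hi
    have huW : u ∈ W := (Finset.mem_inter.1 (by rw [hi]; simp : u ∈ E i ∩ W)).2
    have hpred : ∀ y, ρ u ≤ ρ y → ρ y ≤ ρ v → y = u ∨ y = v := by
      obtain ⟨w, hw, hmax⟩ := Finset.exists_max_image (W.erase v) ρ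
        ⟨u, Finset.mem_erase.2 ⟨huv, huW⟩⟩
      have hwv := (hW w).1 (Finset.mem_of_mem_erase hw)
      have hW' : (Finset.univ.filter fun x => ρ x ≤ ρ w) = W.erase v := by
        ext x
        rw [Finset.mem_filter, Finset.mem_erase, hW]
        refine ⟨fun hx => ⟨fun h' => ?_, hx.2.trans hwv⟩, fun hx =>
          ⟨Finset.mem_univ x, hmax x (Finset.mem_erase.2 ⟨hx.1, (hW x).2 hx.2⟩)⟩⟩
        subst h'
        exact Finset.ne_of_mem_erase hw (hinj (le_antisymm hwv hx.2))
      have hwu : w = u := by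
        have hlast := hρ w (Finset.mem_univ w)
        rw [hW'] at hlast
        rcases hlast with ⟨j, hj⟩ | ⟨hj, -⟩
        · rw [Finset.inter_erase] at hj
          by_cases hvj : v ∈ E j ∩ W
          · have h2 : E j ∩ W = {w, v} := by
              rw [← Finset.insert_erase hvj, hj, Finset.pair_comm]
            have hc : (E j ∩ W).card = 2 := by
              rw [h2, Finset.card_pair (Finset.ne_of_mem_erase hw)]
            have h3 : u ∈ E j ∩ W :=
              Finset.mem_inter.2 ⟨(h j hc).2 (Finset.mem_inter.1 hvj).1, huW⟩
            rw [h2, Finset.mem_insert, Finset.mem_singleton] at h3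
            exact (h3.resolve_right huv).symm
          · rw [Finset.erase_eq_of_notMem hvj] at hj
            exact absurd (by rw [hj, Finset.card_singleton]) (h1 j)
        · exact absurd (by rw [Finset.inter_erase, hi, Finset.card_erase_of_mem (by simp),
            Finset.card_pair huv]) (hj i)
      subst hwu
      intro y hy hyv
      refine or_iff_not_imp_right.2 fun hne => hinj (le_antisymm ?_ hy)
      exact hmax y (Finset.mem_erase.2 ⟨hne, (hW y).2 hyv⟩)
    refine ⟨u, closed h1, fun j hj => ?_, ⟨i, hi2⟩, fun j hj x hx => ?_⟩
    · have h2 := snd_spec j (congrArg ρ hj)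
      have hc : (E j ∩ W).card = 2 := by rw [h2, Finset.card_pair (ne_of_snd j hj)]
      have h3 : u ∈ E j ∩ W := Finset.mem_inter.2 ⟨(h j hc).2 (hj ▸ O.snd_mem j), huW⟩
      rw [h2, Finset.mem_insert, Finset.mem_singleton] at h3
      exact (h3.resolve_right huv).symm
    · rw [← not_or]
      intro hx'
      have hux : ρ u ≤ ρ x := by
        rcases hx with rfl | rfl
        · exact le_rfl
        · exact (hW u).1 huW
      have hxj : x ∈ E j ∩ W := by
        refine Finset.mem_inter.2 ⟨?_, ?_⟩
        · rcases hx' with rfl | rfl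
          · exact hα j
          · exact O.snd_mem j
        · rcases hx with rfl | rfl
          · exact huW
          · exact hvW
      have hsub : ∀ y ∈ E j ∩ W, y = α j ∨ y = u ∨ y = v := by
        intro y hy
        rw [Finset.mem_inter, hW] at hy
        rcases hx' with rfl | rfl
        · exact Or.inr (hpred y (hux.trans (hmin j y hy.1)) hy.2)
        · exact (O.eq_fst_or_snd_le j y hy.1).imp_right fun h' => hpred y (hux.trans h') hy.2
      have hle : (E j ∩ W).card ≤ 2 := by
        by_cases huj : u ∈ E j
        · refine (Finset.card_le_card (t := {α j, u}) fun y hy => ?_).trans Finset.card_le_two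
          have hyv : y ≠ v := by
            rintro rfl
            exact hj ⟨fun _ => (Finset.mem_inter.1 hy).1, fun _ => huj⟩
          simpa [hyv] using hsub y hy
        · refine (Finset.card_le_card (t := {α j, v}) fun y hy => ?_).trans Finset.card_le_two
          have hyu : y ≠ u := by
            rintro rfl
            exact huj (Finset.mem_inter.1 hy).1
          simpa [hyu] using hsub y hy
      have hne1 : (E j ∩ W).card ≠ 1 := h1 j
      have hne2 : (E j ∩ W).card ≠ 2 := fun hc => hj (h j hc)
      have hpos := Finset.card_pos.2 ⟨x, hxj⟩
      omega

variable [Fintype ι]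

/-! ### Vertex weights and forbidden residues -/

/-- The vertex weight induced by an integer edge weighting. -/
def deg (E : ι → Finset V) (ω : ι → ℤ) (x : V) : ℤ := ∑ j, if x ∈ E j then ω j else 0

lemma deg_add (E : ι → Finset V) (ω η : ι → ℤ) (x : V) :
    deg E (ω + η) x = deg E ω x + deg E η x := by
  simp only [deg, ← Finset.sum_add_distrib]
  refine Finset.sum_congr rfl fun j _ => ?_
  split_ifs <;> simp

lemma deg_single [DecidableEq ι] (E : ι → Finset V) (i : ι) (y : ℤ) (x : V) :
    deg E (Pi.single i y) x = if x ∈ E i then y else 0 := by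
  rw [deg, Finset.sum_eq_single i]
  · simp
  · intro j _ hj
    simp [hj]
  · simp

lemma deg_congr {E : ι → Finset V} {ω η : ι → ℤ} {x : V} (h : ∀ j, x ∈ E j → ω j = η j) :
    deg E ω x = deg E η x :=
  Finset.sum_congr rfl fun j _ => by split_ifs with hj <;> simp [h, hj]

lemma dvd_deg {E : ι → Finset V} {ω : ι → ℤ} {r : ℤ} (h : ∀ j, r ∣ ω j) (x : V) :
    r ∣ deg E ω x :=
  Finset.dvd_sum fun j _ => by split_ifs <;> simp [h]

namespace VertexOrder

variable {E : ι → Finset V} (O : VertexOrder E)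

/-- Pairs whose weight difference depends only on edges in `A` are not congruent modulo `r`. -/
def Separates (r : ℤ) (A : Set ι) (ω : ι → ℤ) : Prop :=
  ∀ u v, O.IsPair u v → (∀ i, ¬(u ∈ E i ↔ v ∈ E i) → i ∈ A) → ¬ r ∣ deg E ω u - deg E ω v

variable {O}

lemma Separates.add {r : ℤ} {A : Set ι} {ω η : ι → ℤ} (h : O.Separates r A ω)
    (hη : ∀ j, r ∣ η j) : O.Separates r A (ω + η) := by
  intro u v huv hA hdvd
  refine h u v huv hA ?_
  rw [deg_add, deg_add] at hdvd
  have e : deg E ω u - deg E ω v =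
      deg E ω u + deg E η u - (deg E ω v + deg E η v) - (deg E η u - deg E η v) := by ring
  rw [e]
  exact dvd_sub hdvd (dvd_sub (dvd_deg hη u) (dvd_deg hη v))

/-- The weight of a new edge only has to avoid few residues to keep all pairs separated. -/
lemma Separates.exists_forbidden [Fintype V] [DecidableEq ι] {r : ℤ} {A : Set ι} {ω : ι → ℤ}
    (h : O.Separates r A ω) (i : ι) :
    ∃ B : Finset ℤ, B.card ≤ (E i).card - 2 ∧
      ∀ y, y % r ∉ B → O.Separates r (insert i A) (ω + Pi.single i y) := by
  classical
  let P : Finset (V × V) :=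
    Finset.univ.filter fun p => O.IsPair p.1 p.2 ∧ ¬(p.1 ∈ E i ↔ p.2 ∈ E i)
  let f : V × V → ℤ := fun p => if p.1 ∈ E i then (deg E ω p.2 - deg E ω p.1) % r
    else (deg E ω p.1 - deg E ω p.2) % r
  refine ⟨P.image f, Finset.card_image_le.trans ?_, ?_⟩
  · have hcard : (((E i).erase (O.fst i)).erase (O.snd i)).card = (E i).card - 2 := by
      rw [Finset.card_erase_of_mem, Finset.card_erase_of_mem (O.fst_mem i), Nat.sub_sub]
      refine Finset.mem_erase.2 ⟨fun h' => ?_, O.snd_mem i⟩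
      exact (O.fst_lt_snd i).ne (congrArg O.rank h'.symm)
    rw [← hcard]
    refine Finset.card_le_card_of_injOn (fun p => if p.1 ∈ E i then p.1 else p.2) ?_ ?_
    · intro p hp
      obtain ⟨hp, hne⟩ := (Finset.mem_filter.1 hp).2
      have h1 := hp.ne_of_separates i hne p.1 (Or.inl rfl)
      have h2 := hp.ne_of_separates i hne p.2 (Or.inr rfl)
      simp only [Finset.coe_erase, Set.mem_sdiff, Finset.mem_coe, Set.mem_singleton_iff]
      split_ifs with h3
      · exact ⟨⟨h3, h1.1⟩, h1.2⟩
      · exact ⟨⟨by tauto, h2.1⟩, h2.2⟩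
    · intro p hp q hq hpq
      obtain ⟨hp, -⟩ := (Finset.mem_filter.1 hp).2
      obtain ⟨hq, -⟩ := (Finset.mem_filter.1 hq).2
      dsimp only at hpq
      split_ifs at hpq
      · exact Prod.ext hpq (hp.right_unique (by rw [hpq]; exact hq))
      · exact absurd hpq (hp.left_ne hq)
      · exact absurd hpq.symm (hq.left_ne hp)
      · exact Prod.ext (hp.left_unique (by rw [hpq]; exact hq)) hpq
  · intro y hy u v huv hA hdvd
    rw [deg_add, deg_add, deg_single, deg_single] at hdvd
    by_cases hi : u ∈ E i ↔ v ∈ E i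
    · refine h u v huv (fun j hj => (hA j hj).resolve_left ?_) ?_
      · rintro rfl
        exact hj hi
      · simpa [hi] using hdvd
    · refine hy (Finset.mem_image.2 ⟨(u, v), by simp [P, huv, hi], ?_⟩)
      by_cases hu : u ∈ E i
      · have hv : v ∉ E i := by tauto
        simp only [f, hu, if_true]
        simp only [hu, hv, if_true, if_false] at hdvd
        refine (Int.emod_eq_emod_iff_emod_sub_eq_zero.2 (Int.emod_eq_zero_of_dvd ?_)).symm
        convert hdvd using 1
        ring
      · have hv : v ∈ E i := by tauto
        simp only [f, hu, if_false]
        simp only [hu, hv, if_true, if_false] at hdvd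
        refine Int.emod_eq_emod_iff_emod_sub_eq_zero.2 (Int.emod_eq_zero_of_dvd ?_)
        convert hdvd using 1
        ring

/-- New edges can be given weights strictly between `r` and `2r` keeping all pairs separated. -/
lemma Separates.exists_extension [Fintype V] [DecidableEq ι] {r : ℕ} (hr : 2 ≤ r)
    (hE : ∀ i, (E i).card ≤ r) {A : Set ι} {ω : ι → ℤ} (h : O.Separates r A ω) (S : Finset ι) :
    ∃ η : ι → ℤ, (∀ i ∉ S, η i = 0) ∧ (∀ i ∈ S, r + 1 ≤ η i ∧ η i ≤ 2 * r - 1) ∧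
      O.Separates r (A ∪ S) (ω + η) := by
  induction S using Finset.induction_on with
  | empty => exact ⟨0, by simp, by simp, by simpa using h⟩
  | insert i S hi ih =>
    obtain ⟨η, h0, hη, hsep⟩ := ih
    obtain ⟨B, hB, hy⟩ := hsep.exists_forbidden i
    have hlt : B.card < (Finset.Ico (1 : ℤ) r).card := by
      have := hE i
      rw [Int.card_Ico]
      omega
    obtain ⟨z, hz, hzB⟩ := Finset.exists_mem_notMem_of_card_lt_card hlt
    rw [Finset.mem_Ico] at hz
    refine ⟨η + Pi.single i (r + z), fun j hj => ?_, fun j hj => ?_, ?_⟩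
    · rw [Finset.mem_insert, not_or] at hj
      simp [h0 j hj.2, hj.1]
    · by_cases hji : j = i
      · subst hji
        simp only [Pi.add_apply, h0 j hi, Pi.single_eq_same]
        omega
      · have := hη j (Finset.mem_of_mem_insert_of_ne hj hji)
        simpa [hji] using this
    · rw [← add_assoc]
      have := hy (r + z) (by rwa [Int.add_emod_left, Int.emod_eq_of_lt (by omega) hz.2])
      rwa [Finset.coe_insert, Set.union_insert]

/-! ### Processing the vertices -/

variable (O)

/-- The weight of `i` may be flipped once, in the direction prescribed by its first vertex. -/
def Flippable (r : ℤ) (ω : ι → ℤ) (i : ι) : Prop :=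
  (r + 1 ≤ ω i ∧ ω i ≤ 2 * r - 1) ∨
    ((∀ j, O.fst j = O.fst i → O.rank (O.snd i) ≤ O.rank (O.snd j)) ∧
      ((ω i = r ∧ deg E ω (O.fst i) = lo r (deg E ω (O.fst i))) ∨
        (ω i = 2 * r ∧ deg E ω (O.fst i) = lo r (deg E ω (O.fst i)) + r)))

/-- The first two vertices of `i` have different weights, and this persists when only vertices of
rank at least `k` are still to be processed. -/
def Distinguished (r : ℤ) (k : ℕ) (ω : ι → ℤ) (i : ι) : Prop :=
  lo r (deg E ω (O.fst i)) ≠ lo r (deg E ω (O.snd i)) ∨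
    (deg E ω (O.fst i) ≠ deg E ω (O.snd i) ∧
      ∀ j, O.fst i ∈ E j ∨ O.snd i ∈ E j → O.rank (O.snd j) < k)

/-- The state of the weighting when the vertices of rank less than `k` have been processed. -/
structure Inv (r : ℤ) (k : ℕ) (ω : ι → ℤ) : Prop where
  eq_zero : ∀ i, k ≤ O.rank (O.fst i) → ω i = 0
  flippable : ∀ i, O.rank (O.fst i) < k → k ≤ O.rank (O.snd i) → O.Flippable r ω i
  bounds : ∀ i, O.rank (O.snd i) < k → 1 ≤ ω i ∧ ω i ≤ 3 * r - 1
  distinguished : ∀ i, O.rank (O.snd i) < k → O.Distinguished r k ω i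
  separates : O.Separates r {i | O.rank (O.fst i) < k} ω

/-- A modification `θ` of the edges with second vertex `v` that flips weights within pairs. -/
structure IsFlip (r : ℤ) (ω : ι → ℤ) (v : V) (θ : ι → ℤ) : Prop where
  eq_zero : ∀ i, O.snd i ≠ v → θ i = 0
  bounds : ∀ i, O.snd i = v → 1 ≤ ω i + θ i ∧ ω i + θ i ≤ 3 * r - 1
  dvd : ∀ i, r ∣ θ i
  lo_eq : ∀ x, O.rank x < O.rank v → lo r (deg E ω x + deg E θ x) = lo r (deg E ω x)
  deg_eq_zero : ∀ x, O.rank x < O.rank v → (∀ i, O.snd i = v → O.fst i ≠ x) → deg E θ x = 0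

variable {O}

lemma Inv.step {r : ℤ} {ω θ ζ : ι → ℤ} {v : V} (h : O.Inv r (O.rank v) ω)
    (hθ : O.IsFlip r ω v θ) (hζ : ∀ i, O.fst i ≠ v → ζ i = 0)
    (hflip : ∀ i, O.fst i = v → O.Flippable r (ω + ζ + θ) i)
    (hdist : ∀ i, O.snd i = v → O.Distinguished r (O.rank v + 1) (ω + ζ + θ) i)
    (hsep : O.Separates r {i | O.rank (O.fst i) < O.rank v + 1} (ω + ζ)) :
    O.Inv r (O.rank v + 1) (ω + ζ + θ) := by
  have hne : ∀ {x}, x ≠ v → O.rank x ≠ O.rank v := fun hx h => hx (O.rank_injective h)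
  have hdeg : ∀ x, O.rank x < O.rank v →
      deg E (ω + ζ + θ) x = deg E ω x + deg E θ x := by
    intro x hx
    rw [deg_add, deg_add, show deg E ζ x = 0 from ?_, add_zero]
    refine (deg_congr (η := 0) fun j hj => hζ j ?_).trans (by simp [deg])
    rintro rfl
    exact absurd (O.rank_fst_le hj) (by omega)
  have hfst : ∀ i, O.snd i = v → O.fst i ≠ v := fun i hi h' =>
    (O.fst_lt_snd i).ne (by rw [hi, h'])
  refine ⟨fun i hi => ?_, fun i hi hi' => ?_, fun i hi => ?_, fun i hi => ?_, hsep.add hθ.dvd⟩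
  · have h1 := h.eq_zero i (by omega)
    have h2 := hζ i (by rintro rfl; omega)
    have h3 := hθ.eq_zero i (by rintro rfl; have := O.fst_lt_snd i; omega)
    simp [h1, h2, h3]
  · by_cases hiv : O.fst i = v
    · exact hflip i hiv
    · have hlt : O.rank (O.fst i) < O.rank v := by have := hne hiv; omega
      have h3 := hθ.eq_zero i (by rintro rfl; omega)
      have hω : (ω + ζ + θ) i = ω i := by simp [hζ i hiv, h3]
      rw [Flippable, hω, hdeg _ hlt]
      refine (h.flippable i hlt (by omega)).imp_right fun ⟨hmin, h4⟩ => ⟨hmin, ?_⟩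
      rwa [hθ.deg_eq_zero _ hlt, add_zero]
      intro j hj hji
      have := hmin j hji
      rw [hj] at this
      omega
  · by_cases hiv : O.snd i = v
    · simpa [hζ i (hfst i hiv)] using hθ.bounds i hiv
    · have hlt : O.rank (O.snd i) < O.rank v := by have := hne hiv; omega
      have h2 := hζ i (by rintro rfl; have := O.fst_lt_snd i; omega)
      simpa [h2, hθ.eq_zero i hiv] using h.bounds i hlt
  · by_cases hiv : O.snd i = v
    · exact hdist i hiv
    · have hlt : O.rank (O.snd i) < O.rank v := by have := hne hiv; omega
      have hlt' := (O.fst_lt_snd i).trans hlt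
      rw [Distinguished, hdeg _ hlt, hdeg _ hlt', hθ.lo_eq _ hlt, hθ.lo_eq _ hlt']
      refine (h.distinguished i hlt).imp_right fun ⟨h1, h2⟩ => ⟨?_, fun j hj => ?_⟩
      · rwa [hθ.deg_eq_zero _ hlt, hθ.deg_eq_zero _ hlt', add_zero, add_zero]
        · rintro j rfl hj
          exact absurd (h2 j (Or.inl (hj ▸ O.fst_mem j))) (lt_irrefl _)
        · rintro j rfl hj
          exact absurd (h2 j (Or.inr (hj ▸ O.fst_mem j))) (lt_irrefl _)
      · exact (h2 j hj).trans (Nat.lt_succ_self _)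

lemma Inv.exists_flip [DecidableEq ι] {r : ℤ} (hr : 2 ≤ r) {ω : ι → ℤ} {v : V}
    (h : O.Inv r (O.rank v) ω) {T : Finset V}
    (hT : T = (Finset.univ.filter fun i => O.snd i = v).image O.fst) :
    ∃ c, ∀ R ⊆ T, ∃ θ, O.IsFlip r ω v θ ∧
      (∀ a ∈ T, deg E ω a + deg E θ a = lo r (deg E ω a) + if a ∈ R then r else 0) ∧
      deg E ω v + deg E θ v = c + r * R.card := by
  obtain ⟨M, hM, hMT, hinj⟩ : ∃ M : Finset ι, (∀ i ∈ M, O.snd i = v) ∧ M.image O.fst = T ∧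
      Set.InjOn O.fst M := by
    obtain ⟨M, hM, hinj, hMT⟩ := Finset.exists_subset_injOn_image_eq_of_surjOn
      (f := O.fst) {i | O.snd i = v} T (by
        intro a ha
        subst hT
        simpa using ha)
    exact ⟨M, fun i hi => hM hi, hMT, hinj⟩
  refine ⟨deg E ω v + ∑ a ∈ T, (lo r (deg E ω a) - deg E ω a), fun R hR => ?_⟩
  let δ : V → ℤ := fun a => lo r (deg E ω a) - deg E ω a + if a ∈ R then r else 0
  let θ : ι → ℤ := fun i => if i ∈ M then δ (O.fst i) else 0
  have hθ0 : ∀ i, O.snd i ≠ v → θ i = 0 := fun i hi => if_neg fun h' => hi (hM i h')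
  have hθv : deg E θ v = ∑ a ∈ T, δ a := by
    rw [← hMT, Finset.sum_image hinj, deg, ← Finset.sum_filter_add_sum_filter_not _ (· ∈ M)]
    rw [Finset.sum_eq_zero (s := Finset.univ.filter (· ∉ M)) (by simp +contextual [θ]), add_zero,
      Finset.filter_mem_eq_inter, Finset.univ_inter]
    refine Finset.sum_congr rfl fun i hi => ?_
    rw [if_pos (by rw [← hM i hi]; exact O.snd_mem i)]
    exact if_pos hi
  have hfst : ∀ i ∈ M, ∀ x ∈ E i, O.rank x < O.rank v → O.fst i = x := by
    intro i hi x hx hlt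
    refine ((O.eq_fst_or_snd_le i x hx).resolve_right ?_).symm
    rw [hM i hi]
    omega
  have hθT : ∀ a ∈ T, deg E θ a = δ a := by
    intro a ha
    rw [← hMT, Finset.mem_image] at ha
    obtain ⟨i, hi, rfl⟩ := ha
    rw [deg, Finset.sum_eq_single i]
    · simp [θ, hi, O.fst_mem i]
    · intro j _ hji
      by_cases hj : j ∈ M
      · rw [if_neg]
        intro hmem
        refine hji (hinj hj hi (hfst j hj _ hmem ?_))
        rw [← hM i hi]
        exact O.fst_lt_snd i
      · simp [θ, hj]
    · simp
  have hθN : ∀ x, O.rank x < O.rank v → x ∉ T → deg E θ x = 0 := by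
    intro x hx hxT
    refine Finset.sum_eq_zero fun j _ => ?_
    by_cases hj : j ∈ M
    · rw [if_neg]
      intro hmem
      exact hxT (hMT ▸ Finset.mem_image.2 ⟨j, hj, hfst j hj x hmem hx⟩)
    · simp [θ, hj]
  have hval : ∀ a ∈ T, deg E ω a + deg E θ a =
      lo r (deg E ω a) + if a ∈ R then r else 0 := by
    intro a ha
    rw [hθT a ha]
    simp only [δ]
    ring
  refine ⟨θ, ⟨hθ0, fun i hi => ?_, fun i => ?_, fun x hx => ?_, fun x hx hne => ?_⟩, hval, ?_⟩
  · have hlt : O.rank (O.fst i) < O.rank v := by rw [← hi]; exact O.fst_lt_snd i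
    have hfl := h.flippable i hlt (by rw [hi])
    simp only [θ, δ]
    rcases eq_lo_or r (deg E ω (O.fst i)) with h1 | h1 <;>
      rcases hfl with h2 | ⟨-, h2 | h2⟩ <;> split_ifs <;> constructor <;> linarith [h2.1, h2.2]
  · simp only [θ, δ]
    split_ifs
    · exact dvd_add (dvd_lo_sub _ _) dvd_rfl
    · rw [add_zero]; exact dvd_lo_sub _ _
    · exact dvd_zero r
  · by_cases hxT : x ∈ T
    · rw [hval x hxT]
      split_ifs
      · exact lo_lo_add (by omega) _
      · rw [add_zero, lo_lo (by omega)]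
    · rw [hθN x hx hxT, add_zero]
  · refine hθN x hx ?_
    subst hT
    simpa using hne
  · rw [hθv, Finset.sum_add_distrib, Finset.sum_ite_mem, Finset.inter_eq_right.2 hR,
      Finset.sum_const, nsmul_eq_mul]
    ring

lemma Inv.succ_of_closed [DecidableEq ι] {r : ℤ} (hr : 2 ≤ r) {ω : ι → ℤ} {v : V}
    (h : O.Inv r (O.rank v) ω) (hv : O.Closed v)
    (hcases : (∀ i, O.snd i ≠ v) ∨ (∃ i j, O.snd i = v ∧ O.snd j = v ∧ O.fst i ≠ O.fst j) ∨
      ∃ u, O.IsPair u v) :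
    ∃ ω', O.Inv r (O.rank v + 1) ω' := by
  obtain ⟨c, hc⟩ := h.exists_flip hr rfl
  set T := (Finset.univ.filter fun i => O.snd i = v).image O.fst
  have hfst : ∀ i, O.fst i ≠ v := by
    rintro i rfl
    exact absurd (hv i le_rfl) (by have := O.fst_lt_snd i; omega)
  have hA : O.Separates r {i | O.rank (O.fst i) < O.rank v + 1} ω := by
    convert h.separates using 3 with i
    have : O.rank (O.fst i) ≠ O.rank v := fun h' => hfst i (O.rank_injective h')
    omega
  have build : ∀ θ, O.IsFlip r ω v θ →
      (∀ i, O.snd i = v → O.Distinguished r (O.rank v + 1) (ω + θ) i) →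
      ∃ ω', O.Inv r (O.rank v + 1) ω' := fun θ hθ hd =>
    ⟨_, h.step (ζ := 0) hθ (by simp) (fun i hi => absurd hi (hfst i)) (by simpa using hd)
      (by simpa using hA)⟩
  rcases hcases with h0 | ⟨i, j, hi, hj, hij⟩ | ⟨u, hu⟩
  · obtain ⟨θ, hθ, -⟩ := hc ∅ (Finset.empty_subset _)
    exact build θ hθ fun i hi => absurd hi (h0 i)
  · have hTc : 1 < T.card := Finset.one_lt_card.2 ⟨_, Finset.mem_image.2 ⟨i, by simp [hi], rfl⟩,
      _, Finset.mem_image.2 ⟨j, by simp [hj], rfl⟩, hij⟩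
    obtain ⟨R, hR, hne⟩ := exists_avoiding (by omega : 0 < r) T hTc (deg E ω) c
    obtain ⟨θ, hθ, hθT, hθv⟩ := hc R hR
    refine build θ hθ fun l hl => Or.inr ⟨?_, fun m hm => Nat.lt_succ_of_le (hv m ?_)⟩
    · have hl' : O.fst l ∈ T := Finset.mem_image.2 ⟨l, by simp [hl], rfl⟩
      rw [hl, deg_add, deg_add, hθT _ hl', hθv]
      exact hne _ hl'
    · rw [← hl]
      exact hm.elim (fun h' => (O.rank_fst_le h').trans (O.fst_lt_snd l).le) O.rank_fst_le
  · obtain ⟨θ, hθ, -⟩ := hc ∅ (Finset.empty_subset _)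
    refine build θ hθ fun l hl => Or.inl ?_
    rw [hu.fst_eq l hl, hl]
    intro hlo
    refine hA.add hθ.dvd u v hu (fun m hm => ?_) ?_
    · have huv : O.rank u < O.rank v := by
        rw [← hu.fst_eq l hl, ← hl]
        exact O.fst_lt_snd l
      have : O.rank (O.fst m) ≤ O.rank v := by
        by_cases hum : u ∈ E m
        · exact (O.rank_fst_le hum).trans huv.le
        · exact O.rank_fst_le (by tauto)
      exact Nat.lt_succ_of_le this
    · have h1 := dvd_lo_sub r (deg E (ω + θ) u)
      have h2 := dvd_lo_sub r (deg E (ω + θ) v)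
      rw [hlo] at h1
      simpa using dvd_sub h2 h1

lemma Inv.succ_of_fst [Fintype V] [DecidableEq ι] {r : ℕ} (hr : 2 ≤ r)
    (hE : ∀ i, (E i).card ≤ r) {ω : ι → ℤ} {v : V} (h : O.Inv r (O.rank v) ω)
    (hv : ∃ i, O.fst i = v) : ∃ ω', O.Inv r (O.rank v + 1) ω' := by
  obtain ⟨c, hc⟩ := h.exists_flip (by omega) rfl
  set T := (Finset.univ.filter fun i => O.snd i = v).image O.fst
  obtain ⟨i₀, hi₀, hmin⟩ := Finset.exists_min_image (Finset.univ.filter fun i => O.fst i = v)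
    (fun i => O.rank (O.snd i)) (by simpa [Finset.Nonempty] using hv)
  simp only [Finset.mem_filter, Finset.mem_univ, true_and] at hi₀ hmin
  set S := (Finset.univ.filter fun i => O.fst i = v).erase i₀
  have hmemS : ∀ i, i ∈ S ↔ i ≠ i₀ ∧ O.fst i = v := by simp [S]
  obtain ⟨η, hη0, hη, hsep⟩ := h.separates.exists_extension hr hE S
  obtain ⟨B, hB, hsepB⟩ := hsep.exists_forbidden i₀
  obtain ⟨t, ht, y, hyB, hyL, hy⟩ := exists_unblocked r hr B (T.image fun a => lo r (deg E ω a))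
    (hB.trans (Nat.sub_le_sub_right (hE i₀) 2)) T.card Finset.card_image_le (c + deg E η v)
  obtain ⟨R, hR, hRt⟩ := Finset.exists_subset_card_eq ht
  obtain ⟨θ, hθ, hθT, hθv⟩ := hc R hR
  rw [hRt] at hθv
  have hζ : ∀ i, O.fst i ≠ v → (η + Pi.single i₀ y : ι → ℤ) i = 0 := fun i hi => by
    have h1 : i ≠ i₀ := by rintro rfl; exact hi hi₀
    simp [h1, hη0 i fun h' => hi ((hmemS i).1 h').2]
  have hdegv : deg E (ω + (η + Pi.single i₀ y) + θ) v = c + deg E η v + y + r * t := by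
    rw [deg_add, deg_add, deg_add, deg_single, if_pos (hi₀ ▸ O.fst_mem i₀)]
    linarith
  refine ⟨_, h.step hθ hζ (fun i hi => ?_) (fun i hi => Or.inl ?_) ?_⟩
  · have hω : ω i = 0 := h.eq_zero i (by rw [hi])
    have hθi : θ i = 0 := hθ.eq_zero i fun h' => (O.fst_lt_snd i).ne (by rw [h', hi])
    by_cases hii : i = i₀
    · subst hii
      have hval : (ω + (η + Pi.single i y) + θ : ι → ℤ) i = y := by simp [hω, hθi, hη0 i, hmemS]
      rw [Flippable, hval, hi, hdegv]
      exact hy.imp_right fun h' => ⟨hmin, h'⟩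
    · left
      simpa [hω, hθi, hii] using hη i ((hmemS i).2 ⟨hii, hi⟩)
  · have hiT : O.fst i ∈ T := Finset.mem_image.2 ⟨i, by simp [hi], rfl⟩
    have hlt : O.rank (O.fst i) < O.rank v := hi ▸ O.fst_lt_snd i
    have hdeg : deg E (η + Pi.single i₀ y) (O.fst i) = 0 := by
      refine (deg_congr (η := 0) fun j hj => hζ j ?_).trans (by simp [deg])
      rintro rfl
      exact absurd (O.rank_fst_le hj) (by omega)
    rw [hi, hdegv, deg_add, deg_add, hdeg, add_zero, hθ.lo_eq _ hlt]
    intro h'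
    exact hyL (h' ▸ Finset.mem_image_of_mem _ hiT)
  · rw [← add_assoc]
    convert hsepB y hyB using 1
    ext i
    simp only [Set.mem_ofPred_eq, Set.mem_insert_iff, Set.mem_union, Finset.mem_coe, hmemS]
    constructor
    · intro hi
      by_cases hiv : O.fst i = v
      · by_cases hii : i = i₀ <;> simp [hii, hiv]
      · have : O.rank (O.fst i) ≠ O.rank v := fun h' => hiv (O.rank_injective h')
        omega
    · rintro (rfl | hi | ⟨-, hi⟩)
      · rw [hi₀]; omega
      · omega
      · rw [hi]; omega

end VertexOrder

/-- The weighting exists when no edge contains twins. -/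
lemma exists_weighting_of_separated [Fintype V] (r : ℕ) (hr : 2 ≤ r) (E : ι → Finset V)
    (hsize : ∀ i, 2 ≤ (E i).card ∧ (E i).card ≤ r)
    (hsep : ∀ i, ∀ u ∈ E i, ∀ v ∈ E i, u ≠ v → ∃ j, ¬(u ∈ E j ↔ v ∈ E j)) :
    ∃ ω : ι → ℕ, (∀ i, 1 ≤ ω i ∧ ω i ≤ 3 * r - 1) ∧
      ∀ i, ∃ u ∈ E i, ∃ v ∈ E i,
        (∑ j, if u ∈ E j then ω j else 0) ≠ (∑ j, if v ∈ E j then ω j else 0) := by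
  classical
  obtain ⟨O, hO⟩ := exists_good_vertexOrder E fun i => (hsize i).1
  have hpair : ∀ u v, O.IsPair u v → ∃ i, ¬(u ∈ E i ↔ v ∈ E i) := by
    intro u v huv
    obtain ⟨i, hi⟩ := huv.exists_snd
    have hu := huv.fst_eq i hi
    refine hsep i u (hu ▸ O.fst_mem i) v (hi ▸ O.snd_mem i) ?_
    rintro rfl
    exact (O.fst_lt_snd i).ne (by rw [hu, hi])
  have hinv : ∀ k, ∃ ω, O.Inv r k ω := by
    intro k
    induction k with
    | zero =>
      refine ⟨0, ⟨fun _ _ => rfl, by simp, by simp, by simp, fun u v huv hA => ?_⟩⟩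
      obtain ⟨i, hi⟩ := hpair u v huv
      exact absurd (hA i hi) (Nat.not_lt_zero _)
    | succ k ih =>
      obtain ⟨ω, hω⟩ := ih
      by_cases hk : ∃ v, O.rank v = k
      · obtain ⟨v, rfl⟩ := hk
        rcases hO v with hv | ⟨hv, hcases⟩
        · exact hω.succ_of_fst hr (fun i => (hsize i).2) hv
        · exact hω.succ_of_closed (by omega) hv hcases
      · push Not at hk
        have hlt : ∀ x, O.rank x < k + 1 ↔ O.rank x < k := fun x => by have := hk x; omega
        have hle : ∀ x, k + 1 ≤ O.rank x ↔ k ≤ O.rank x := fun x => by have := hk x; omega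
        refine ⟨ω, ⟨?_, ?_, ?_, ?_, ?_⟩⟩
        · simpa only [hle] using hω.eq_zero
        · simpa only [hle, hlt] using hω.flippable
        · simpa only [hlt] using hω.bounds
        · simpa only [VertexOrder.Distinguished, hlt] using hω.distinguished
        · simpa only [hlt] using hω.separates
  obtain ⟨ω, hω⟩ := hinv (Finset.univ.sup O.rank + 1)
  have hlt : ∀ x, O.rank x < Finset.univ.sup O.rank + 1 := fun x =>
    Nat.lt_succ_of_le (Finset.le_sup (Finset.mem_univ x))
  have hb := fun i => hω.bounds i (hlt _)
  have hcast : ∀ x, ((∑ j, if x ∈ E j then (ω j).toNat else 0 : ℕ) : ℤ) = deg E ω x := by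
    intro x
    rw [Nat.cast_sum]
    refine Finset.sum_congr rfl fun j _ => ?_
    have := hb j
    split_ifs
    · exact Int.toNat_of_nonneg (by omega)
    · rfl
  refine ⟨fun i => (ω i).toNat, fun i => ?_, fun i => ⟨_, O.fst_mem i, _, O.snd_mem i, ?_⟩⟩
  · have := hb i
    dsimp only
    omega
  · intro h
    have h' : deg E ω (O.fst i) = deg E ω (O.snd i) := by rw [← hcast, ← hcast, h]
    rcases hω.distinguished i (hlt _) with h1 | h1
    · exact h1 (by rw [h'])
    · exact h1.1 h'

end HypergraphWeighting

/-- For every hypergraph `H` (multiple edges allowed, given by an indexed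
family `E : ι → Finset V`) in which every edge has size between `2` and `r` (where
`r ≥ 2`) and no edge consists of twins, there is an edge weighting
`ω : ι → {1, 2, …, 5r − 5}` such that the induced vertex weights
`ω(v) = ∑_{e ∋ v} ω(e)` properly color `V`: every edge contains two vertices with
different induced weights. -/
theorem vertex_coloring_weighting_general {V ι : Type*} [Fintype V] [Fintype ι]
    [DecidableEq V] (r : ℕ) (hr : 2 ≤ r) (E : ι → Finset V)
    (hsize : ∀ i, 2 ≤ (E i).card ∧ (E i).card ≤ r)
    (htwins : ∀ i, ¬ (∀ u ∈ E i, ∀ v ∈ E i, ∀ j, (u ∈ E j ↔ v ∈ E j))) :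
    ∃ ω : ι → ℕ, (∀ i, 1 ≤ ω i ∧ ω i ≤ 5 * r - 5) ∧
      ∀ i, ∃ u ∈ E i, ∃ v ∈ E i,
        (∑ j, if u ∈ E j then ω j else 0) ≠ (∑ j, if v ∈ E j then ω j else 0) := by
  classical
  let s : Setoid V :=
    { r := fun u v => ∀ j, u ∈ E j ↔ v ∈ E j
      iseqv := ⟨fun _ _ => Iff.rfl, fun h j => (h j).symm, fun h h' j => (h j).trans (h' j)⟩ }
  let rep : V → V := fun v => (Quotient.mk s v).out
  have hrep : ∀ v j, rep v ∈ E j ↔ v ∈ E j := fun v => Quotient.mk_out (s := s) v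
  have hrep_rep : ∀ v, rep (rep v) = rep v := fun v => by
    simp only [rep, Quotient.out_eq]
  have hrep_eq : ∀ u v, (∀ j, u ∈ E j ↔ v ∈ E j) → rep u = rep v := fun u v h =>
    congrArg Quotient.out (Quotient.sound (s := s) h)
  let F : ι → Finset V := fun i => (E i).filter fun v => rep v = v
  have hF : ∀ v i, v ∈ F i ↔ v ∈ E i ∧ rep v = v := fun v i => Finset.mem_filter
  have hFcard : ∀ i, 2 ≤ (F i).card := fun i => by
    have h := htwins i
    push Not at h
    obtain ⟨u, hu, v, hv, j, hj⟩ := h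
    refine Finset.one_lt_card.2 ⟨rep u, (hF _ i).2 ⟨(hrep u i).2 hu, hrep_rep u⟩, rep v,
      (hF _ i).2 ⟨(hrep v i).2 hv, hrep_rep v⟩, fun h' => ?_⟩
    have := (hrep u j).symm.trans (h' ▸ hrep v j)
    tauto
  obtain ⟨ω, hω, hcol⟩ := HypergraphWeighting.exists_weighting_of_separated r hr F
    (fun i => ⟨hFcard i, (Finset.card_filter_le _ _).trans (hsize i).2⟩) fun i u hu v hv huv => by
      rw [hF] at hu hv
      by_contra! h
      refine huv (hu.2.symm.trans ((hrep_eq u v fun j => ?_).trans hv.2))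
      simpa only [hF, hu.2, hv.2, and_true] using h j
  refine ⟨ω, fun i => ⟨(hω i).1, (hω i).2.trans (by omega)⟩, fun i => ?_⟩
  obtain ⟨u, hu, v, hv, huv⟩ := hcol i
  rw [hF] at hu hv
  refine ⟨u, hu.1, v, hv.1, ?_⟩
  simpa only [hF, hu.2, hv.2, and_true] using huv
end

section
/- For every finite simple graph G without isolated edges, there exists an edge weighting ω : E(G) → {1, 2, 3, 4, 5} such that the induced vertex weights ω(v) = Σ_{u ∈ N(v)} ω(uv) form a proper vertex coloring of G, i.e., ω(u) ≠ ω(v) for every edge uv of G. -/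
/-- The lower element of the pair `{b, b + 2}`, with `b` congruent to `0` or `1` modulo `4`,
that contains `x`. -/
def pairBase (x : ℤ) : ℤ := 4 * (x / 4) + x % 2

/-- One more than `|t|` values in arithmetic progression with difference `2` give, after suitable
shifts by `0` or `1`, more than `|t|` different pairs. -/
theorem exists_pairBase_notMem (a : ℤ) (d : ℕ) (t : Finset ℤ) (ht : t.card ≤ d) :
    ∃ i : ℕ, i ≤ d ∧ ∃ δ : ℤ, (δ = 0 ∨ δ = 1 ∧ 2 ≤ (a + 2 * i + δ) % 4) ∧
      pairBase (a + 2 * i + δ) ∉ t := by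
  classical
  let shift (x : ℤ) : ℤ := if x % 4 = 1 ∨ x % 4 = 2 then 1 else 0
  let g (i : ℕ) : ℤ := pairBase (a + 2 * i + shift (a + 2 * i))
  have hg : Function.Injective g := by
    intro i j hij
    simp only [g, pairBase, shift] at hij
    split_ifs at hij <;> omega
  obtain ⟨x, hx, hxt⟩ := Finset.exists_mem_notMem_of_card_lt_card
    (s := t) (t := (Finset.range (d + 1)).image g) (by
      rw [Finset.card_image_of_injective _ hg, Finset.card_range]; omega)
  obtain ⟨i, hi, rfl⟩ := Finset.mem_image.1 hx
  refine ⟨i, by simpa [Nat.lt_succ_iff] using hi, shift (a + 2 * i), ?_, hxt⟩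
  simp only [shift]
  split_ifs <;> omega

/-- If every vertex of a finite set `B` with `|B| ≠ 1` may take its weight `b v` or `b v + 2`, then
the choice can be made such that no resulting weight equals `a` plus twice the number of
vertices with the larger weight. -/
theorem exists_raised_subset {V : Type*} [DecidableEq V] (B : Finset V) (hB : B.card ≠ 1)
    (b : V → ℤ) (hb : ∀ v, b v % 4 < 2) (a : ℤ) :
    ∃ H ⊆ B, ∀ v ∈ B, a + 2 * (H.card : ℤ) ≠ b v + (if v ∈ H then 2 else 0) := by
  by_cases h₁ : 2 ≤ a % 4
  · refine ⟨∅, by simp, fun v _ => ?_⟩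
    have := hb v
    simp only [Finset.card_empty, Finset.notMem_empty, if_false]
    omega
  by_cases h₂ : (a + 2 * B.card) % 4 < 2
  · refine ⟨B, by simp, fun v hv => ?_⟩
    have := hb v
    simp only [hv, if_true]
    omega
  have hd : B.card % 2 = 1 := by omega
  obtain ⟨y, hy, hlt⟩ := Finset.exists_card_fiber_lt_of_card_lt_mul (s := B) (n := 2) (f := b)
    (t := (Finset.range ((B.card + 1) / 2)).image fun i : ℕ => a + 4 * (i : ℤ)) (by
      rw [Finset.card_image_of_injective _ (fun i j h => by simpa using h), Finset.card_range]
      omega)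
  obtain ⟨i, hi, rfl⟩ := Finset.mem_image.1 hy
  rw [Finset.mem_range] at hi
  set F := {v ∈ B | b v = a + 4 * (i : ℤ)} with hF
  have hFB : F ⊆ B := Finset.filter_subset _ _
  rcases Nat.eq_zero_or_pos i with rfl | hpos
  · obtain ⟨H, hH, hcard⟩ := Finset.exists_subset_card_eq (s := B \ F) (n := 1) (by
      rw [Finset.card_sdiff_of_subset hFB]; omega)
    refine ⟨H, hH.trans Finset.sdiff_subset, fun v hv => ?_⟩
    have := hb v
    rw [hcard]
    split_ifs with hvH
    · have hvF := (Finset.mem_sdiff.1 (hH hvH)).2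
      rw [hF, Finset.mem_filter] at hvF
      push Not at hvF
      have := hvF hv
      push_cast at *
      omega
    · push_cast
      omega
  · obtain ⟨H, hFH, hHB, hcard⟩ := Finset.exists_subsuperset_card_eq (n := 2 * i) hFB
      (by omega) (by omega)
    refine ⟨H, hHB, fun v hv => ?_⟩
    have := hb v
    rw [hcard]
    split_ifs with hvH
    · push_cast
      omega
    · have hvF : v ∉ F := fun h => hvH (hFH h)
      rw [hF, Finset.mem_filter] at hvF
      push Not at hvF
      have := hvF hv
      push_cast at *
      omega

namespace SimpleGraph

variable {V : Type*} [Fintype V] [DecidableEq V] (G : SimpleGraph V) [DecidableRel G.Adj]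

/-- The vertex `k` comes after all of its neighbors in the order given by `r`. -/
def IsLast (r : V → ℕ) (k : V) : Prop := ∀ u, G.Adj k u → r u < r k

omit [DecidableEq V] in
/-- The vertices of a graph without isolated edges can be ordered such that a vertex that comes
after all of its neighbors does not have degree `1` and comes after all of their neighbors. -/
theorem exists_order (hiso : ∀ u v, G.Adj u v → ¬ (G.degree u = 1 ∧ G.degree v = 1)) :
    ∃ r : V → ℕ, Function.Injective r ∧ (∀ k, G.IsLast r k → G.degree k ≠ 1) ∧
      ∀ k v u, G.IsLast r k → G.Adj k v → G.Adj v u → r u ≤ r k := by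
  have hroot : ∀ C : G.ConnectedComponent, ∃ x, G.connectedComponentMk x = C ∧
      G.degree x ≠ 1 := by
    intro C
    induction C using ConnectedComponent.ind with | _ y =>
    by_cases hy : G.degree y = 1
    · obtain ⟨u, hu⟩ := (G.degree_pos_iff_exists_adj y).1 (by omega)
      exact ⟨u, ConnectedComponent.sound hu.symm.reachable, fun h => hiso y u hu ⟨hy, h⟩⟩
    · exact ⟨y, rfl, hy⟩
  choose root hroot hdeg using hroot
  let ρ (v : V) : V := root (G.connectedComponentMk v)
  have hρ_adj {u v : V} (h : G.Adj u v) : ρ u = ρ v :=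
    congrArg root (ConnectedComponent.sound h.reachable)
  have hreach (v : V) : G.Reachable v (ρ v) := (ConnectedComponent.exact (hroot _)).symm
  let key (v : V) : ℕ := G.dist v (ρ v)
  have hkey_zero (v : V) (h : key v = 0) : v = ρ v := (hreach v).dist_eq_zero_iff.1 h
  have hdesc (v : V) (h : v ≠ ρ v) : ∃ u, G.Adj v u ∧ key u < key v := by
    obtain ⟨p, hp⟩ := (hreach v).exists_walk_length_eq_dist
    generalize hx : ρ v = x at p
    cases p with
    | nil => exact absurd hx.symm h
    | @cons _ u _ hvu q =>
      refine ⟨u, hvu, ?_⟩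
      have hq := G.dist_le q
      simp only [key]
      subst hx
      rw [← hp, ← hρ_adj hvu, Walk.length_cons]
      omega
  let e := Fintype.equivFin V
  let K := Finset.univ.sup key
  have hK (v : V) : key v ≤ K := Finset.le_sup (f := key) (Finset.mem_univ v)
  let r (v : V) : ℕ := (K - key v) * Fintype.card V + e v
  have hr {u v : V} (h : key u < key v) : r v < r u := by
    have h₁ : K - key v + 1 ≤ K - key u := by have := hK v; omega
    have h₂ := Nat.mul_le_mul_right (Fintype.card V) h₁
    have h₃ := (e v).isLt
    simp only [r]
    linarith
  have hlast (k : V) (h : G.IsLast r k) : k = ρ k := by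
    by_contra hne
    obtain ⟨u, hu, hlt⟩ := hdesc k hne
    exact absurd (h u hu) (hr hlt).le.not_gt
  refine ⟨r, fun u v h => ?_, fun k hk => ?_, fun k v u hk hkv hvu => ?_⟩
  · rcases lt_trichotomy (key u) (key v) with hlt | heq | hlt
    · exact absurd h (hr hlt).ne'
    · simp only [r, heq, add_right_inj] at h
      exact e.injective (Fin.ext h)
    · exact absurd h (hr hlt).ne
  · rw [hlast k hk]
    exact hdeg _
  · have hρ : ρ u = k := by rw [← hρ_adj hvu, ← hρ_adj hkv, ← hlast k hk]
    rcases eq_or_ne u k with rfl | hne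
    · exact le_rfl
    · have hk₀ : key k = 0 := by simp only [key]; rw [← hlast k hk]; exact dist_self
      have hu₀ : key u ≠ 0 := fun h => hne ((hkey_zero u h).trans hρ)
      exact (hr (by omega)).le

/-- The sum of the weights of the edges incident to `v`. -/
def inducedWeight (ω : V → V → ℤ) (v : V) : ℤ := ∑ u ∈ G.neighborFinset v, ω v u

/-- Adds `c v` to the weight of the pair `{k, v}`, for every `v`. -/
def addAt (ω : V → V → ℤ) (k : V) (c : V → ℤ) (u v : V) : ℤ :=
  ω u v + (if u = k then c v else 0) + (if v = k then c u else 0)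

theorem inducedWeight_addAt_self (ω : V → V → ℤ) (k : V) (c : V → ℤ) :
    G.inducedWeight (addAt ω k c) k = G.inducedWeight ω k + ∑ v ∈ G.neighborFinset k, c v := by
  rw [inducedWeight, inducedWeight, ← Finset.sum_add_distrib]
  refine Finset.sum_congr rfl fun v hv => ?_
  have hne : v ≠ k := ((G.mem_neighborFinset k v).1 hv).ne'
  simp [addAt, hne]

theorem inducedWeight_addAt_of_adj (ω : V → V → ℤ) {k v : V} (c : V → ℤ) (h : G.Adj k v) :
    G.inducedWeight (addAt ω k c) v = G.inducedWeight ω v + c v := by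
  simp [inducedWeight, addAt, h.ne', Finset.sum_add_distrib, h.symm]

theorem inducedWeight_addAt_of_not_adj (ω : V → V → ℤ) {k v : V} (c : V → ℤ) (hne : v ≠ k)
    (h : ¬ G.Adj k v) : G.inducedWeight (addAt ω k c) v = G.inducedWeight ω v := by
  have h' : ¬ G.Adj v k := fun h' => h h'.symm
  simp [inducedWeight, addAt, hne, Finset.sum_add_distrib, h']

/-- An edge weighting in which the vertices `v` with `r v < m` have been dealt with: their weights
can only change within their pairs from now on. -/
structure IsPartialWeighting (r : V → ℕ) (m : ℕ) (ω : V → V → ℤ) : Prop where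
  symm : ∀ u v, ω u v = ω v u
  inner : ∀ u v, G.Adj u v → r u < m → r v < m → 1 ≤ ω u v ∧ ω u v ≤ 5
  outer : ∀ u v, G.Adj u v → m ≤ r u → m ≤ r v → ω u v = 3
  cross : ∀ v u, G.Adj v u → r v < m → m ≤ r u → ω v u = 3 ∨
    ω v u = 4 ∧ 2 ≤ G.inducedWeight ω v % 4 ∧ ∀ u', G.Adj v u' → m ≤ r u' → r u ≤ r u'
  separated : ∀ u v, G.Adj u v → r u < m → r v < m → ¬ G.IsLast r u → ¬ G.IsLast r v →
    pairBase (G.inducedWeight ω u) ≠ pairBase (G.inducedWeight ω v)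
  proper : ∀ k v, G.Adj k v → r k < m → G.IsLast r k →
    G.inducedWeight ω k ≠ G.inducedWeight ω v

variable {G} {r : V → ℕ}

theorem IsPartialWeighting.step (hr : Function.Injective r)
    (hlast : ∀ k v u, G.IsLast r k → G.Adj k v → G.Adj v u → r u ≤ r k) {k : V} {ω : V → V → ℤ}
    (hω : G.IsPartialWeighting r (r k) ω) {B H : Finset V}
    (hB : B = {v ∈ G.neighborFinset k | r v < r k}) (hH : H ⊆ B) {j : V} {δ x : ℤ}
    (hδ : δ = 0 ∨ δ = 1 ∧ 2 ≤ x % 4)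
    (hj : ¬ G.IsLast r k → G.Adj k j ∧ r k < r j ∧ ∀ u, G.Adj k u → r k < r u → r j ≤ r u)
    (hδ_last : G.IsLast r k → δ = 0)
    (hx : x = G.inducedWeight ω k +
      ∑ v ∈ B, (pairBase (G.inducedWeight ω v) - G.inducedWeight ω v) + 2 * (H.card : ℤ) + δ)
    (hsep : ¬ G.IsLast r k → ∀ v ∈ B, pairBase x ≠ pairBase (G.inducedWeight ω v))
    (hprop : G.IsLast r k → ∀ v ∈ B,
      x ≠ pairBase (G.inducedWeight ω v) + (if v ∈ H then 2 else 0)) :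
    ∃ ω', G.IsPartialWeighting r (r k + 1) ω' := by
  let f := G.inducedWeight ω
  let c (v : V) : ℤ := if r v < r k then pairBase (f v) + (if v ∈ H then 2 else 0) - f v
    else if v = j then δ else 0
  have hmemB (v : V) : v ∈ B ↔ G.Adj k v ∧ r v < r k := by simp [hB]
  have hk : G.inducedWeight (addAt ω k c) k = x := by
    have hsum₁ : ∑ v ∈ B, c v = ∑ v ∈ B, (pairBase (f v) - f v) + 2 * (H.card : ℤ) := by
      have : ∑ v ∈ B, (if v ∈ H then (2 : ℤ) else 0) = 2 * (H.card : ℤ) := by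
        rw [← Finset.sum_filter, Finset.filter_mem_eq_inter, Finset.inter_eq_right.2 hH]
        simp [mul_comm]
      rw [← this, ← Finset.sum_add_distrib]
      refine Finset.sum_congr rfl fun v hv => ?_
      simp only [c, if_pos ((hmemB v).1 hv).2]
      ring
    have hsum₂ : ∑ v ∈ G.neighborFinset k with ¬ r v < r k, c v = δ := by
      by_cases hL : G.IsLast r k
      · rw [hδ_last hL]
        refine Finset.sum_eq_zero fun v hv => ?_
        simp only [Finset.mem_filter, mem_neighborFinset] at hv
        exact absurd (hL v hv.1) hv.2
      · obtain ⟨hkj, hlt, -⟩ := hj hL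
        rw [Finset.sum_eq_single j]
        · simp [c, hlt.not_gt]
        · intro v hv hne
          simp [c, hne, (Finset.mem_filter.1 hv).2]
        · intro h
          simp [hkj, hlt.le] at h
    rw [inducedWeight_addAt_self, ← Finset.sum_filter_add_sum_filter_not _ (fun v => r v < r k),
      ← hB, hsum₁, hsum₂, hx]
    ring
  have hB' (v : V) (hv : v ∈ B) : G.inducedWeight (addAt ω k c) v =
      pairBase (f v) + (if v ∈ H then 2 else 0) := by
    obtain ⟨hadj, hlt⟩ := (hmemB v).1 hv
    rw [inducedWeight_addAt_of_adj _ _ _ hadj]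
    simp only [c, if_pos hlt, f]
    ring
  have hnB (v : V) (hlt : r v < r k) (hv : ¬ G.Adj k v) :
      G.inducedWeight (addAt ω k c) v = f v :=
    G.inducedWeight_addAt_of_not_adj _ _ (fun h => by simp [h] at hlt) hv
  have hbase (v : V) (hlt : r v < r k) :
      pairBase (G.inducedWeight (addAt ω k c) v) = pairBase (f v) := by
    by_cases hv : G.Adj k v
    · rw [hB' v ((hmemB v).2 ⟨hv, hlt⟩)]
      simp only [pairBase]
      split_ifs <;> omega
    · rw [hnB v hlt hv]
  have hedge {u v : V} (hu : u ≠ k) (hv : v ≠ k) : addAt ω k c u v = ω u v := by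
    simp [addAt, hu, hv]
  have hedge_k {v : V} (hv : v ≠ k) : addAt ω k c k v = ω k v + c v := by
    simp [addAt, hv]
  have hsymm (u v : V) : addAt ω k c u v = addAt ω k c v u := by
    simp only [addAt, hω.symm u v]
    ring
  have hcase {v : V} (h : r v < r k + 1) : v = k ∨ r v < r k ∧ v ≠ k := by
    rcases eq_or_ne v k with h' | h'
    · exact .inl h'
    · exact .inr ⟨by have := hr.ne h'; omega, h'⟩
  have hinner {v : V} (h : G.Adj k v) (hlt : r v < r k) :
      1 ≤ addAt ω k c k v ∧ addAt ω k c k v ≤ 5 := by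
    rw [hedge_k h.ne', hω.symm]
    simp only [c, if_pos hlt, f]
    have := hω.cross v k h.symm hlt le_rfl
    simp only [pairBase]
    split_ifs <;> omega
  have hne_of_lt {u : V} (h : r k + 1 ≤ r u) : u ≠ k := by
    rintro rfl
    omega
  refine ⟨addAt ω k c, hsymm, fun u v huv hu hv => ?_, fun u v huv hu hv => ?_,
    fun v u hvu hv hu => ?_, fun u v huv hu hv hLu hLv => ?_, fun k' v hkv hk' hL => ?_⟩
  · rcases hcase hu with rfl | ⟨hu, hu'⟩
    · exact hinner huv ((hcase hv).resolve_left huv.ne').1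
    · rcases hcase hv with rfl | ⟨hv, hv'⟩
      · rw [hsymm]
        exact hinner huv.symm hu
      · rw [hedge hu' hv']
        exact hω.inner u v huv hu hv
  · rw [hedge (hne_of_lt hu) (hne_of_lt hv)]
    exact hω.outer u v huv (by omega) (by omega)
  · rcases hcase hv with rfl | ⟨hv, hv'⟩
    · rw [hk, hedge_k (hne_of_lt hu), hω.outer v u hvu le_rfl (by omega)]
      have hlt : ¬ r u < r v := by omega
      have hL : ¬ G.IsLast r v := fun h => hlt (h u hvu)
      simp only [c, if_neg hlt]
      split_ifs with huj
      · subst huj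
        rcases hδ with h | ⟨h, h'⟩
        · exact .inl (by omega)
        · exact .inr ⟨by omega, h', (hj hL).2.2⟩
      · exact .inl (by omega)
    · rw [hedge hv' (hne_of_lt hu)]
      rcases hω.cross v u hvu hv (by omega) with h | ⟨h, h', hmin⟩
      · exact .inl h
      · have hkv : ¬ G.Adj k v := fun h => by
          have := hmin k h.symm le_rfl
          omega
        rw [hnB v hv hkv]
        exact .inr ⟨h, h', fun u' hu' hle => hmin u' hu' (by omega)⟩
  · rcases hcase hu with rfl | ⟨hu, hu'⟩
    · have hv := ((hcase hv).resolve_left huv.ne').1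
      rw [hk, hbase v hv]
      exact hsep hLu v ((hmemB v).2 ⟨huv, hv⟩)
    · rcases hcase hv with rfl | ⟨hv, hv'⟩
      · rw [hk, hbase u hu]
        exact (hsep hLv u ((hmemB u).2 ⟨huv.symm, hu⟩)).symm
      · rw [hbase u hu, hbase v hv]
        exact hω.separated u v huv hu hv hLu hLv
  · rcases hcase hk' with rfl | ⟨hk', hne⟩
    · have hvB := (hmemB v).2 ⟨hkv, hL v hkv⟩
      rw [hk, hB' v hvB]
      exact hprop hL v hvB
    · have hnk' : ¬ G.Adj k k' := fun h => (hL k h.symm).not_gt hk'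
      have hnv : ¬ G.Adj k v := fun h => by
        have := hlast k' v k hL hkv h.symm
        omega
      have hv : r v < r k := (hL v hkv).trans hk'
      rw [hnB k' hk' hnk', hnB v hv hnv]
      exact hω.proper k' v hkv hk' hL

theorem exists_isPartialWeighting (hr : Function.Injective r)
    (hdeg : ∀ k, G.IsLast r k → G.degree k ≠ 1)
    (hlast : ∀ k v u, G.IsLast r k → G.Adj k v → G.Adj v u → r u ≤ r k) (m : ℕ) :
    ∃ ω, G.IsPartialWeighting r m ω := by
  induction m with
  | zero =>
    refine ⟨fun _ _ => 3, ?_⟩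
    constructor <;> simp
  | succ m ih =>
    obtain ⟨ω, hω⟩ := ih
    by_cases hm : ∃ k, r k = m
    · obtain ⟨k, rfl⟩ := hm
      set B : Finset V := {v ∈ G.neighborFinset k | r v < r k} with hB
      let a := G.inducedWeight ω k +
        ∑ v ∈ B, (pairBase (G.inducedWeight ω v) - G.inducedWeight ω v)
      by_cases hL : G.IsLast r k
      · have hBk : B = G.neighborFinset k := by
          rw [hB, Finset.filter_true_of_mem]
          intro v hv
          exact hL v ((G.mem_neighborFinset k v).1 hv)
        obtain ⟨H, hH, hne⟩ := exists_raised_subset B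
          (by rw [hBk, card_neighborFinset_eq_degree]; exact hdeg k hL)
          (fun v => pairBase (G.inducedWeight ω v)) (fun v => by simp only [pairBase]; omega) a
        exact hω.step hr hlast hB hH (j := k) (.inl rfl) (fun h => absurd hL h) (fun _ => rfl) rfl
          (fun h => absurd hL h) (fun _ v hv => by simpa [a] using hne v hv)
      · obtain ⟨i, hi, δ, hδ, hnot⟩ := exists_pairBase_notMem a B.card
          (B.image fun v => pairBase (G.inducedWeight ω v)) Finset.card_image_le
        obtain ⟨H, hH, rfl⟩ := Finset.exists_subset_card_eq hi
        have hne : ({u ∈ G.neighborFinset k | r k < r u} : Finset V).Nonempty := by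
          simp only [IsLast, not_forall] at hL
          obtain ⟨u, hu, hle⟩ := hL
          have := hr.ne hu.ne
          exact ⟨u, by simp only [Finset.mem_filter, mem_neighborFinset]; exact ⟨hu, by omega⟩⟩
        obtain ⟨j, hj, hmin⟩ := Finset.exists_min_image _ r hne
        simp only [Finset.mem_filter, mem_neighborFinset] at hj hmin
        refine hω.step hr hlast hB hH hδ (fun _ => ⟨hj.1, hj.2, fun u h h' => hmin u ⟨h, h'⟩⟩)
          (fun h => absurd h hL) rfl (fun _ v hv h => hnot ?_) (fun h => absurd h hL)
        exact Finset.mem_image.2 ⟨v, hv, h.symm⟩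
    · push Not at hm
      have hlt (v : V) : r v < m + 1 ↔ r v < m := by have := hm v; omega
      have hle (v : V) : m + 1 ≤ r v ↔ m ≤ r v := by have := hm v; omega
      refine ⟨ω, hω.symm, ?_, ?_, ?_, ?_, ?_⟩ <;> simp only [hlt, hle]
      exacts [hω.inner, hω.outer, hω.cross, hω.separated, hω.proper]

end SimpleGraph

/-- **1-2-3-4-5 theorem.** For every finite simple graph `G` without
isolated edges (edges both of whose endpoints have degree `1`), there is an edge
weighting `ω` with values in `{1,2,3,4,5}` such that the induced vertex weights
`ω(v) = ∑_{u ∈ N(v)} ω(uv)` form a proper vertex coloring of `G`: adjacent vertices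
receive different induced weights. -/
theorem one_two_three_four_five {V : Type*} [Fintype V] [DecidableEq V]
    (G : SimpleGraph V) [DecidableRel G.Adj]
    (hiso : ∀ u v, G.Adj u v → ¬ (G.degree u = 1 ∧ G.degree v = 1)) :
    ∃ ω : Sym2 V → ℕ, (∀ e ∈ G.edgeSet, 1 ≤ ω e ∧ ω e ≤ 5) ∧
      ∀ u v, G.Adj u v →
        (∑ x ∈ G.neighborFinset u, ω s(x, u)) ≠ (∑ x ∈ G.neighborFinset v, ω s(x, v)) := by
  obtain ⟨r, hr, hdeg, hlast⟩ := G.exists_order hiso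
  let m := Finset.univ.sup r + 1
  have hm (v : V) : r v < m := Nat.lt_succ_of_le (Finset.le_sup (Finset.mem_univ v))
  obtain ⟨ω, hω⟩ := SimpleGraph.exists_isPartialWeighting hr hdeg hlast m
  have hrange (u v : V) (h : G.Adj u v) := hω.inner u v h (hm u) (hm v)
  let ω' : Sym2 V → ℕ := Sym2.lift ⟨fun u v => (ω u v).toNat, fun u v => congrArg Int.toNat (hω.symm u v)⟩
  have hsum (v : V) :
      ((∑ x ∈ G.neighborFinset v, ω' s(x, v) : ℕ) : ℤ) = G.inducedWeight ω v := by
    rw [Nat.cast_sum]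
    refine Finset.sum_congr rfl fun x hx => ?_
    have := hrange v x ((G.mem_neighborFinset v x).1 hx)
    simp only [ω', Sym2.lift_mk, hω.symm x v]
    omega
  refine ⟨ω', fun e he => ?_, fun u v huv heq => ?_⟩
  · induction e using Sym2.ind with | _ u v =>
    have := hrange u v he
    simp only [ω', Sym2.lift_mk]
    omega
  · have hw : G.inducedWeight ω u = G.inducedWeight ω v := by rw [← hsum, ← hsum, heq]
    by_cases hu : G.IsLast r u
    · exact hω.proper u v huv (hm u) hu hw
    by_cases hv : G.IsLast r v
    · exact hω.proper v u huv.symm (hm v) hv hw.symm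
    exact hω.separated u v huv (hm u) (hm v) hu hv (by rw [hw])
end

section
/- Let F be a hypergraph and let k ≥ 1. Define the incidence hypergraph H of F as follows: V(H) = {(v, e) : v ∈ V(F), e ∈ E(F), v ∈ e}; for each vertex v of F the set {(v, e) : e ∈ E(F), v ∈ e} is an edge of H (these form E_1(H)), and for each edge e of F the set {(v, e) : v ∈ e} is an edge of H (these form E_2(H)). If F admits no proper vertex coloring with k colors (i.e., every coloring of V(F) with at most k colors leaves some edge of F monochromatic), then there is no edge weighting ω : E(H) → {1, 2, ..., k} such that the induced vertex weights properly color V(H); that is, every such weighting leaves some edge of H monochromatic in induced vertex weights. -/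
/-- The vertices of the incidence hypergraph of a hypergraph `F` (given by the edge
family `Ef : ι → Finset V`): vertex–edge incidences `(v, e)` with `v ∈ e`. -/
abbrev IncVert {V ι : Type*} (Ef : ι → Finset V) : Type _ :=
  {p : V × ι // p.1 ∈ Ef p.2}

/-- The edges of the incidence hypergraph of `F`: for every vertex `v` of `F` the edge
`{(v, e) : v ∈ e}` (type `E₁`), and for every edge `e` of `F` the edge
`{(v, e) : v ∈ e}` (type `E₂`). -/
def IncEdge {V ι : Type*} [Fintype V] [Fintype ι] [DecidableEq V] [DecidableEq ι]
    (Ef : ι → Finset V) : V ⊕ ι → Finset (IncVert Ef)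
  | Sum.inl v => Finset.univ.filter fun p => p.val.1 = v
  | Sum.inr i => Finset.univ.filter fun p => p.val.2 = i

/-- The induced weight of an incidence `(v, e)` is the weight of the edge of `v` plus the
weight of the edge of `e`. -/
theorem sum_incEdge {V ι M : Type*} [Fintype V] [Fintype ι] [DecidableEq V] [DecidableEq ι]
    [AddCommMonoid M] (Ef : ι → Finset V) (ω : V ⊕ ι → M) (p : IncVert Ef) :
    (∑ b, if p ∈ IncEdge Ef b then ω b else 0) =
      ω (Sum.inl p.val.1) + ω (Sum.inr p.val.2) := by
  simp [Fintype.sum_sum_type, IncEdge]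

/-- If a hypergraph `F` admits no proper vertex coloring with `k ≥ 1`
colors (every coloring of `V(F)` with at most `k` colors leaves a monochromatic edge),
then no edge weighting of the incidence hypergraph `H` of `F` with weights in
`{1, …, k}` induces a proper vertex coloring of `H` by weighted degrees: some edge of
`H` is monochromatic in the induced vertex weights. -/
theorem incidence_hypergraph_needs_chromatic_weights {V ι : Type*} [Fintype V]
    [Fintype ι] [DecidableEq V] [DecidableEq ι] (Ef : ι → Finset V) (k : ℕ)
    (hk : 1 ≤ k)
    (hchrom : ∀ c : V → Fin k, ∃ i, ∀ u ∈ Ef i, ∀ v ∈ Ef i, c u = c v)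
    (ω : V ⊕ ι → ℕ) (hω : ∀ a, 1 ≤ ω a ∧ ω a ≤ k) :
    ∃ a, ∀ p ∈ IncEdge Ef a, ∀ q ∈ IncEdge Ef a,
      (∑ b, if p ∈ IncEdge Ef b then ω b else 0) =
        (∑ b, if q ∈ IncEdge Ef b then ω b else 0) := by
  obtain ⟨i, hi⟩ := hchrom fun v =>
    ⟨ω (Sum.inl v) - 1, by have := hω (Sum.inl v); omega⟩
  refine ⟨Sum.inr i, fun p hp q hq => ?_⟩
  have hpi : p.val.2 = i := by simpa [IncEdge] using hp
  have hqi : q.val.2 = i := by simpa [IncEdge] using hq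
  have hcolor := Fin.mk.inj_iff.mp (hi p.val.1 (hpi ▸ p.property) q.val.1 (hqi ▸ q.property))
  have hp_pos := (hω (Sum.inl p.val.1)).1
  have hq_pos := (hω (Sum.inl q.val.1)).1
  rw [sum_incEdge, sum_incEdge, hpi, hqi]
  omega
end

section
/- For every r ≥ 2 there exists a linear bipartite hypergraph H in which every edge has size at least 2 and at most r, no edge of H consists of twins, and yet for every edge weighting ω : E(H) → {1, 2, ..., r} some edge of H is monochromatic in the induced vertex weights; i.e., no weighting from {1, ..., r} is vertex-coloring. (Such an H is obtained as the incidence hypergraph of the complete graph K_{r+1}.) -/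
/-- The hypergraph on the flags of the complete graph on `Fin n`, a flag being an ordered pair of
distinct vertices `(v, w)`, read as the vertex `v` on the edge `vw`. Every vertex and every edge of
the complete graph gives the set of flags containing it. Diagonal pairs lie in no edge. -/
def completeFlagEdge (n : ℕ) :
    Fin n ⊕ {p : Fin n × Fin n // p.1 < p.2} → Finset (Fin n × Fin n)
  | .inl v => Finset.univ.filter fun q => q.1 = v ∧ q.2 ≠ v
  | .inr p => {p.1, p.1.swap}

namespace completeFlagEdge

variable {n : ℕ}

@[simp] lemma mem_inl {v : Fin n} {q : Fin n × Fin n} :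
    q ∈ completeFlagEdge n (.inl v) ↔ q.1 = v ∧ q.2 ≠ v := by
  simp [completeFlagEdge]

@[simp] lemma mem_inr {p : {p : Fin n × Fin n // p.1 < p.2}} {q : Fin n × Fin n} :
    q ∈ completeFlagEdge n (.inr p) ↔ q = p.1 ∨ q = p.1.swap := by
  simp [completeFlagEdge]

lemma card_inl (v : Fin n) : (completeFlagEdge n (.inl v)).card = n - 1 := by
  have h : completeFlagEdge n (.inl v) = {v} ×ˢ Finset.univ.erase v := by
    ext q
    simp only [mem_inl, Finset.mem_product, Finset.mem_singleton, Finset.mem_erase,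
      Finset.mem_univ, and_true]
  rw [h]
  simp

lemma card_inr (p : {p : Fin n × Fin n // p.1 < p.2}) :
    (completeFlagEdge n (.inr p)).card = 2 :=
  Finset.card_pair fun h => p.2.ne (congrArg Prod.fst h)

lemma card_inter_le_one (i j : Fin n ⊕ {p : Fin n × Fin n // p.1 < p.2}) (hij : i ≠ j) :
    (completeFlagEdge n i ∩ completeFlagEdge n j).card ≤ 1 := by
  rw [Finset.card_le_one]
  rintro ⟨a, b⟩ ha ⟨c, d⟩ hc
  rcases i with i | ⟨⟨x, y⟩, h⟩ <;> rcases j with j | ⟨⟨z, w⟩, h'⟩ <;>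
    simp at ha hc hij <;> grind

/-- Orient the complete graph on `Fin (r + 1)` increasingly, except for the edge joining the two
extreme vertices: the resulting tournament has neither a source nor a sink. -/
lemma exists_two_coloring {r : ℕ} (hr : 2 ≤ r) :
    ∃ c : Fin (r + 1) × Fin (r + 1) → Fin 2, ∀ i, ∃ u ∈ completeFlagEdge (r + 1) i,
      ∃ v ∈ completeFlagEdge (r + 1) i, c u ≠ c v := by
  refine ⟨fun q => if (q.1.val < q.2.val ∧ ¬ (q.1.val = 0 ∧ q.2.val = r)) ∨
    (q.1.val = r ∧ q.2.val = 0) then 1 else 0, ?_⟩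
  rintro (v | ⟨⟨x, y⟩, h⟩)
  · rcases Nat.eq_zero_or_pos v.val with hv | hv
    · refine ⟨(v, ⟨1, by omega⟩), ?_, (v, ⟨r, by omega⟩), ?_, ?_⟩ <;>
        simp only [mem_inl, ne_eq, Fin.ext_iff] <;> grind
    · rcases eq_or_ne v.val r with hv' | hv'
      · refine ⟨(v, ⟨0, by omega⟩), ?_, (v, ⟨1, by omega⟩), ?_, ?_⟩ <;>
          simp only [mem_inl, ne_eq, Fin.ext_iff] <;> grind
      · refine ⟨(v, ⟨0, by omega⟩), ?_, (v, ⟨r, by omega⟩), ?_, ?_⟩ <;>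
          simp only [mem_inl, ne_eq, Fin.ext_iff] <;> grind
  · refine ⟨(x, y), by simp, (y, x), by simp, ?_⟩
    have h' : x.val < y.val := h
    grind

lemma not_twins (hn : 3 ≤ n) (i : Fin n ⊕ {p : Fin n × Fin n // p.1 < p.2}) :
    ¬ ∀ u ∈ completeFlagEdge n i, ∀ v ∈ completeFlagEdge n i, ∀ j,
      (u ∈ completeFlagEdge n j ↔ v ∈ completeFlagEdge n j) := by
  intro h
  have htwo : 1 < (completeFlagEdge n i).card := by
    cases i with
    | inl v => rw [card_inl]; omega
    | inr p => rw [card_inr]; omega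
  obtain ⟨⟨a, b⟩, hu, ⟨c, d⟩, hv, huv⟩ := Finset.one_lt_card.1 htwo
  have hab : a ≠ b := by
    rcases i with i | ⟨⟨x, y⟩, hxy⟩ <;> simp at hu <;> grind
  have hac : c = a :=
    (mem_inl.1 ((h _ hu _ hv (.inl a)).1 (by simp [hab.symm]))).1
  have hbd : d ≠ b := by grind
  rcases hab.lt_or_gt with hlt | hlt
  · have := (h _ hu _ hv (.inr ⟨(a, b), hlt⟩)).1 (by simp)
    simp at this
    grind
  · have := (h _ hu _ hv (.inr ⟨(b, a), hlt⟩)).1 (by simp)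
    simp at this
    grind

lemma weight_eq_weight_swap (ω : Fin n ⊕ {p : Fin n × Fin n // p.1 < p.2} → ℕ) {u v : Fin n}
    (huv : u ≠ v) (h : ω (.inl u) = ω (.inl v)) :
    (∑ j, if (u, v) ∈ completeFlagEdge n j then ω j else 0) =
      ∑ j, if (v, u) ∈ completeFlagEdge n j then ω j else 0 := by
  have key : ∀ {a b : Fin n}, a ≠ b →
      (∑ j, if (a, b) ∈ completeFlagEdge n (.inl j) then ω (.inl j) else 0) = ω (.inl a) := by
    intro a b hab
    rw [Finset.sum_eq_single a] <;> simp +contextual [hab.symm, eq_comm]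
  rw [Fintype.sum_sum_type, Fintype.sum_sum_type, key huv, key huv.symm, h]
  congr 1
  refine Finset.sum_congr rfl fun p _ => if_congr ?_ rfl rfl
  obtain ⟨⟨x, y⟩, hxy⟩ := p
  simp
  tauto

lemma exists_monochromatic {r : ℕ}
    (ω : Fin (r + 1) ⊕ {p : Fin (r + 1) × Fin (r + 1) // p.1 < p.2} → ℕ)
    (hω : ∀ i, 1 ≤ ω i ∧ ω i ≤ r) :
    ∃ i, ∀ u ∈ completeFlagEdge (r + 1) i, ∀ v ∈ completeFlagEdge (r + 1) i,
      (∑ j, if u ∈ completeFlagEdge (r + 1) j then ω j else 0) =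
        ∑ j, if v ∈ completeFlagEdge (r + 1) j then ω j else 0 := by
  obtain ⟨x, -, y, -, hxy, h⟩ := Finset.exists_ne_map_eq_of_card_lt_of_maps_to
    (s := Finset.univ) (t := Finset.Icc 1 r) (f := fun x : Fin (r + 1) => ω (.inl x))
    (by simp) (fun x _ => by simpa using hω (.inl x))
  wlog hlt : x < y generalizing x y
  · exact this y x hxy.symm h.symm (lt_of_le_of_ne (not_lt.1 hlt) hxy.symm)
  refine ⟨.inr ⟨(x, y), hlt⟩, fun u hu v hv => ?_⟩
  have hswap := weight_eq_weight_swap ω hxy h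
  rw [mem_inr] at hu hv
  rcases hu with rfl | rfl <;> rcases hv with rfl | rfl
  exacts [rfl, hswap, hswap.symm, rfl]

end completeFlagEdge

/-- For every `r ≥ 2` there is a linear bipartite hypergraph `H`
(edges given by a family `E : Fin M → Finset (Fin N)`) in which every edge has size
between `2` and `r`, no edge consists of twins, and yet for every edge weighting
`ω : E(H) → {1, …, r}` some edge of `H` is monochromatic in the induced vertex weights;
that is, no weighting from `{1, …, r}` is vertex-coloring. (Such an `H` is the incidence
hypergraph of the complete graph `K_{r+1}`.) -/
theorem exists_linear_bipartite_needing_r_plus_one (r : ℕ) (hr : 2 ≤ r) :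
    ∃ (N M : ℕ) (E : Fin M → Finset (Fin N)),
      (∀ i, 2 ≤ (E i).card ∧ (E i).card ≤ r) ∧
      (∀ i j, i ≠ j → (E i ∩ E j).card ≤ 1) ∧
      (∃ c : Fin N → Fin 2, ∀ i, ∃ u ∈ E i, ∃ v ∈ E i, c u ≠ c v) ∧
      (∀ i, ¬ (∀ u ∈ E i, ∀ v ∈ E i, ∀ j, (u ∈ E j ↔ v ∈ E j))) ∧
      ∀ ω : Fin M → ℕ, (∀ i, 1 ≤ ω i ∧ ω i ≤ r) →
        ∃ i, ∀ u ∈ E i, ∀ v ∈ E i,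
          (∑ j, if u ∈ E j then ω j else 0) = (∑ j, if v ∈ E j then ω j else 0) := by
  let eV := Fintype.equivFin (Fin (r + 1) × Fin (r + 1))
  let eI := Fintype.equivFin (Fin (r + 1) ⊕ {p : Fin (r + 1) × Fin (r + 1) // p.1 < p.2})
  let E := completeFlagEdge (r + 1)
  have hE : ∀ i q, eV q ∈ (E (eI.symm i)).map eV.toEmbedding ↔ q ∈ E (eI.symm i) :=
    fun i q => Finset.mem_map' eV.toEmbedding
  refine ⟨_, _, fun i => (E (eI.symm i)).map eV.toEmbedding, fun i => ?_, fun i j hij => ?_, ?_,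
    fun i => ?_, fun ω hω => ?_⟩
  · rw [Finset.card_map]
    rcases eI.symm i with v | p
    · exact (completeFlagEdge.card_inl v).symm ▸ ⟨hr, le_rfl⟩
    · exact (completeFlagEdge.card_inr p).symm ▸ ⟨le_rfl, hr⟩
  · rw [← Finset.map_inter, Finset.card_map]
    exact completeFlagEdge.card_inter_le_one _ _ (eI.symm.injective.ne hij)
  · obtain ⟨c, hc⟩ := completeFlagEdge.exists_two_coloring hr
    refine ⟨c ∘ eV.symm, fun i => ?_⟩
    obtain ⟨u, hu, v, hv, huv⟩ := hc (eI.symm i)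
    exact ⟨eV u, (hE i u).2 hu, eV v, (hE i v).2 hv, by simpa using huv⟩
  · intro h
    refine completeFlagEdge.not_twins (by omega) (eI.symm i) fun u hu v hv j => ?_
    have := h _ ((hE i u).2 hu) _ ((hE i v).2 hv) (eI j)
    rwa [hE, hE, eI.symm_apply_apply] at this
  · obtain ⟨i, hi⟩ := completeFlagEdge.exists_monochromatic (ω ∘ eI) fun i => hω (eI i)
    refine ⟨eI i, fun u hu v hv => ?_⟩
    obtain ⟨u, rfl⟩ := eV.surjective u
    obtain ⟨v, rfl⟩ := eV.surjective v
    rw [hE, eI.symm_apply_apply] at hu hv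
    have := hi u hu v hv
    simp only [hE]
    rw [← eI.sum_comp, ← eI.sum_comp]
    simpa only [eI.symm_apply_apply, Function.comp_apply] using this
end

section
/- For every r-regular finite simple graph G with chromatic number exactly r, the incidence hypergraph H of G (with V(H) = {(v, e) : v ∈ V(G), e ∈ E(G), v ∈ e}, one edge {(v, e) : e ∋ v} for each vertex v of G, and one edge {(v, e) : v ∈ e} for each edge e of G) has maximum edge size r, and for every edge weighting ω : E(H) → {1, 2, ..., r−1} some edge of H is monochromatic in the induced vertex weights. -/
/-- The vertices of the incidence hypergraph of a simple graph `G`: the vertex–edge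
incidences `(v, e)` with `e ∈ E(G)` and `v ∈ e`. -/
abbrev GraphIncVert {V : Type*} [DecidableEq V] (G : SimpleGraph V)
    [DecidableRel G.Adj] : Type _ :=
  {p : V × Sym2 V // p.2 ∈ G.edgeSet ∧ p.1 ∈ p.2}

/-- The edges of the incidence hypergraph of `G`: one edge `{(v, e) : e ∋ v}` for each
vertex `v` of `G`, and one edge `{(v, e) : v ∈ e}` for each edge `e` of `G`. -/
def GraphIncEdge {V : Type*} [Fintype V] [DecidableEq V] (G : SimpleGraph V)
    [DecidableRel G.Adj] : V ⊕ G.edgeSet → Finset (GraphIncVert G)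
  | Sum.inl v => Finset.univ.filter fun p => p.val.1 = v
  | Sum.inr e => Finset.univ.filter fun p => p.val.2 = (e : Sym2 V)

section

variable {V : Type*} [Fintype V] [DecidableEq V] {G : SimpleGraph V} [DecidableRel G.Adj]

@[simp]
theorem mem_graphIncEdge_inl {v : V} {p : GraphIncVert G} :
    p ∈ GraphIncEdge G (Sum.inl v) ↔ p.val.1 = v := by
  simp [GraphIncEdge]

@[simp]
theorem mem_graphIncEdge_inr {e : G.edgeSet} {p : GraphIncVert G} :
    p ∈ GraphIncEdge G (Sum.inr e) ↔ p.val.2 = (e : Sym2 V) := by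
  simp [GraphIncEdge]

theorem card_graphIncEdge_inl (v : V) : (GraphIncEdge G (Sum.inl v)).card = G.degree v := by
  rw [← G.card_incidenceFinset_eq_degree v]
  refine Finset.card_bij (fun p _ => p.val.2) ?_ ?_ ?_
  · rintro ⟨⟨w, e⟩, he, hw⟩ hp
    obtain rfl : w = v := mem_graphIncEdge_inl.1 hp
    exact (G.mem_incidenceFinset _ _).2 ⟨he, hw⟩
  · intro p hp q hq h
    rw [mem_graphIncEdge_inl] at hp hq
    exact Subtype.ext (Prod.ext (hp.trans hq.symm) h)
  · intro e he
    have h := (G.mem_incidenceFinset _ _).1 he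
    exact ⟨⟨(v, e), h.1, h.2⟩, by simp, rfl⟩

theorem card_graphIncEdge_inr_le_two (e : G.edgeSet) :
    (GraphIncEdge G (Sum.inr e)).card ≤ 2 := by
  obtain ⟨⟨u, v⟩, he⟩ := e
  refine (Finset.card_le_card_of_injOn (t := {u, v}) (fun p => p.val.1) ?_ ?_).trans
    Finset.card_le_two
  · intro p hp
    have h := mem_graphIncEdge_inr.1 (Finset.mem_coe.1 hp)
    have hm := p.property.2
    rw [h] at hm
    simpa using Sym2.mem_iff.1 hm
  · intro p hp q hq h
    have h₁ := mem_graphIncEdge_inr.1 (Finset.mem_coe.1 hp)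
    have h₂ := mem_graphIncEdge_inr.1 (Finset.mem_coe.1 hq)
    exact Subtype.ext (Prod.ext h (h₁.trans h₂.symm))

/-- The induced weight of an incidence is the weight of its vertex plus that of its edge. -/
theorem sum_graphIncEdge_weight (ω : V ⊕ G.edgeSet → ℕ) (p : GraphIncVert G) :
    (∑ b, if p ∈ GraphIncEdge G b then ω b else 0) =
      ω (Sum.inl p.val.1) + ω (Sum.inr ⟨p.val.2, p.property.1⟩) := by
  rw [Fintype.sum_sum_type]
  congr 1
  · simp
  · rw [Finset.sum_eq_single ⟨p.val.2, p.property.1⟩]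
    · simp
    · intro b _ hb
      exact if_neg fun h => hb (Subtype.ext (mem_graphIncEdge_inr.1 h).symm)
    · simp

/-- If no edge `{(v, e) : v ∈ e}` is monochromatic, then the vertex weights properly color `G`. -/
theorem weight_ne_of_adj {ω : V ⊕ G.edgeSet → ℕ}
    (h : ∀ e : G.edgeSet, ¬ ∀ p ∈ GraphIncEdge G (Sum.inr e), ∀ q ∈ GraphIncEdge G (Sum.inr e),
      (∑ b, if p ∈ GraphIncEdge G b then ω b else 0) =
        (∑ b, if q ∈ GraphIncEdge G b then ω b else 0))
    {u v : V} (huv : G.Adj u v) : ω (Sum.inl u) ≠ ω (Sum.inl v) := by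
  intro hω
  refine h ⟨s(u, v), huv⟩ ?_
  have key : ∀ p ∈ GraphIncEdge G (Sum.inr ⟨s(u, v), huv⟩),
      (∑ b, if p ∈ GraphIncEdge G b then ω b else 0) =
        ω (Sum.inl u) + ω (Sum.inr ⟨s(u, v), huv⟩) := by
    rintro ⟨⟨w, e⟩, he, hw⟩ hp
    obtain rfl : e = s(u, v) := mem_graphIncEdge_inr.1 hp
    rw [sum_graphIncEdge_weight]
    obtain rfl | rfl : w = u ∨ w = v := Sym2.mem_iff.1 hw
    · rfl
    · rw [hω]
  intro p hp q hq
  rw [key p hp, key q hq]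

end

/-- For every `r`-regular finite simple graph `G` with chromatic number
exactly `r` (with `r ≥ 1`), the incidence hypergraph `H` of `G` has maximum edge size
`r`, and every edge weighting of `H` with weights in `{1, …, r − 1}` leaves some edge of
`H` monochromatic in the induced vertex weights. -/
theorem graph_incidence_hypergraph_lower_bound {V : Type*} [Fintype V] [DecidableEq V]
    (G : SimpleGraph V) [DecidableRel G.Adj] (r : ℕ) (hr : 1 ≤ r)
    (hreg : G.IsRegularOfDegree r) (hchrom : G.chromaticNumber = (r : ℕ∞)) :
    (Finset.univ.sup fun a : V ⊕ G.edgeSet => (GraphIncEdge G a).card) = r ∧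
    ∀ ω : V ⊕ G.edgeSet → ℕ, (∀ a, 1 ≤ ω a ∧ ω a ≤ r - 1) →
      ∃ a, ∀ p ∈ GraphIncEdge G a, ∀ q ∈ GraphIncEdge G a,
        (∑ b, if p ∈ GraphIncEdge G b then ω b else 0) =
          (∑ b, if q ∈ GraphIncEdge G b then ω b else 0) := by
  have hncol : ¬ G.Colorable (r - 1) := fun h => by
    have hle := h.chromaticNumber_le
    rw [hchrom, Nat.cast_le] at hle
    omega
  constructor
  · apply le_antisymm
    · refine Finset.sup_le ?_
      rintro (v | e) -
      · exact (card_graphIncEdge_inl v).trans_le (hreg v).le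
      · refine (card_graphIncEdge_inr_le_two e).trans ?_
        obtain ⟨⟨u, v⟩, he⟩ := e
        have h := SimpleGraph.two_le_chromaticNumber_of_adj (G.mem_edgeSet.1 he)
        rw [hchrom] at h
        exact_mod_cast h
    · obtain ⟨v⟩ : Nonempty V := by
        by_contra hV
        rw [not_nonempty_iff] at hV
        exact hncol (.of_isEmpty _)
      rw [← hreg v, ← card_graphIncEdge_inl v]
      exact Finset.le_sup (f := fun a => (GraphIncEdge G a).card) (Finset.mem_univ (Sum.inl v))
  · intro ω hω
    by_contra! hmono
    refine hncol ⟨SimpleGraph.Coloring.mk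
      (fun v => (⟨ω (Sum.inl v) - 1, by have := hω (Sum.inl v); omega⟩ : Fin (r - 1))) ?_⟩
    intro u v huv heq
    refine weight_ne_of_adj (ω := ω) (fun e he => ?_) huv ?_
    · obtain ⟨p, hp, q, hq, hne⟩ := hmono (Sum.inr e)
      exact hne (he p hp q hq)
    · have h := Fin.mk.inj heq
      have hu := hω (Sum.inl u)
      have hv := hω (Sum.inl v)
      omega
end

section
/- There exists a 2-regular, 3-uniform, linear hypergraph H (the incidence hypergraph of the Fano plane) such that for every edge weighting ω : E(H) → {1, 2} some edge of H is monochromatic in the induced vertex weights; i.e., no weighting from {1, 2} is vertex-coloring on H. -/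
/-- The incidences of the Fano plane are numbered by `Fin 21`: the line `l` consists of the
points `l`, `l + 1`, `l + 3` modulo `7`, giving the incidences `3 * l`, `3 * l + 1`, `3 * l + 2`.
This is the line of an incidence. -/
def fanoLine (v : Fin 21) : Fin 7 := ⟨v / 3, by omega⟩

/-- The point of an incidence of the Fano plane. -/
def fanoPoint (v : Fin 21) : Fin 7 := fanoLine v + ![0, 1, 3] ⟨v % 3, by omega⟩

/-- The hypergraph on the incidences of the Fano plane whose edges are the seven lines
(indices `0` to `6`) and the seven points (indices `7` to `13`). -/
def fanoIncidence (i : Fin 14) : Finset (Fin 21) :=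
  Finset.univ.filter fun v => (fanoLine v).castAdd 7 = i ∨ (fanoPoint v).natAdd 7 = i

/-- Every 2-coloring of the points of the Fano plane has a monochromatic line. -/
theorem exists_monochromatic_fanoLine (c : Fin 7 → Bool) :
    ∃ l : Fin 7, c l = c (l + 1) ∧ c l = c (l + 3) := by
  revert c
  decide +kernel

/-- The weight induced on an incidence is the weight of its line plus that of its point. -/
theorem sum_fanoIncidence (ω : Fin 14 → ℕ) (u : Fin 21) :
    (∑ j, if u ∈ fanoIncidence j then ω j else 0) =
      ω ((fanoLine u).castAdd 7) + ω ((fanoPoint u).natAdd 7) := by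
  have hne : (fanoLine u).castAdd 7 ≠ (fanoPoint u).natAdd 7 := by
    simp only [ne_eq, Fin.ext_iff, Fin.val_castAdd, Fin.val_natAdd]
    omega
  rw [← Finset.sum_filter, ← Finset.sum_pair hne]
  refine Finset.sum_congr ?_ fun _ _ => rfl
  ext j
  simp [fanoIncidence, eq_comm]

theorem fanoPoint_eq (v : Fin 21) :
    fanoPoint v = fanoLine v ∨ fanoPoint v = fanoLine v + 1 ∨ fanoPoint v = fanoLine v + 3 := by
  revert v
  decide

theorem fanoLine_eq_of_mem {v : Fin 21} {l : Fin 7} (hv : v ∈ fanoIncidence (l.castAdd 7)) :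
    fanoLine v = l := by
  simp only [fanoIncidence, Finset.mem_filter, Finset.mem_univ, true_and, Fin.ext_iff,
    Fin.val_castAdd, Fin.val_natAdd] at hv
  omega

/-- There exists a `2`-regular, `3`-uniform, linear hypergraph `H`
(the incidence hypergraph of the Fano plane, with edges given by a family
`E : Fin M → Finset (Fin N)`) such that every edge weighting `ω : E(H) → {1, 2}` leaves
some edge of `H` monochromatic in the induced vertex weights; i.e., no weighting from
`{1, 2}` is vertex-coloring on `H`. -/
theorem exists_twoRegular_threeUniform_linear_needing_three :
    ∃ (N M : ℕ) (E : Fin M → Finset (Fin N)),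
      (∀ p : Fin N, (Finset.univ.filter fun i => p ∈ E i).card = 2) ∧
      (∀ i, (E i).card = 3) ∧
      (∀ i j, i ≠ j → (E i ∩ E j).card ≤ 1) ∧
      ∀ ω : Fin M → ℕ, (∀ i, 1 ≤ ω i ∧ ω i ≤ 2) →
        ∃ i, ∀ u ∈ E i, ∀ v ∈ E i,
          (∑ j, if u ∈ E j then ω j else 0) = (∑ j, if v ∈ E j then ω j else 0) := by
  refine ⟨21, 14, fanoIncidence, by decide +kernel, by decide +kernel, by decide +kernel, ?_⟩
  intro ω hω
  obtain ⟨l, h1, h3⟩ := exists_monochromatic_fanoLine fun p => decide (ω (p.natAdd 7) = 1)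
  have eq_of_decide {p q : Fin 7}
      (h : decide (ω (p.natAdd 7) = 1) = decide (ω (q.natAdd 7) = 1)) :
      ω (q.natAdd 7) = ω (p.natAdd 7) := by
    have hp := hω (p.natAdd 7)
    have hq := hω (q.natAdd 7)
    rw [decide_eq_decide] at h
    omega
  have weight_eq (v : Fin 21) (hv : v ∈ fanoIncidence (l.castAdd 7)) :
      (∑ j, if v ∈ fanoIncidence j then ω j else 0) = ω (l.castAdd 7) + ω (l.natAdd 7) := by
    rw [sum_fanoIncidence]
    rcases fanoPoint_eq v with h | h | h <;> rw [h, fanoLine_eq_of_mem hv]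
    · rw [eq_of_decide h1]
    · rw [eq_of_decide h3]
  exact ⟨l.castAdd 7, fun u hu v hv => (weight_eq u hu).trans (weight_eq v hv).symm⟩
end

section
/- Let H be a hypergraph in which every edge has size at least 2. Then H admits an edge weighting with positive integer weights whose induced vertex weights properly color V(H) if and only if no edge of H consists of twins. In particular, if some edge of H consists of twins, then for every edge weighting ω : E(H) → ℤ that edge is monochromatic in the induced vertex weights. -/
/-- With distinct powers of two as weights, the family of indices selected by a predicate is
determined by its total weight. -/
theorem sum_ite_two_pow_eq_iff {ι : Type*} [Fintype ι] (f : ι ↪ ℕ) (p q : ι → Prop)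
    [DecidablePred p] [DecidablePred q] :
    (∑ j, if p j then 2 ^ f j else 0) = (∑ j, if q j then 2 ^ f j else 0) ↔
      ∀ j, p j ↔ q j := by
  refine ⟨fun h j => ?_, fun h => by simp only [h]⟩
  rw [← Finset.sum_filter, ← Finset.sum_filter,
    ← Finset.sum_map _ f (fun n => 2 ^ n), ← Finset.sum_map _ f (fun n => 2 ^ n)] at h
  have hfilter := Finset.map_injective f (Finset.geomSum_injective le_rfl h)
  simpa using Finset.ext_iff.mp hfilter j


/-- Let `H` be a hypergraph (multiple edges allowed, edges given by an
indexed family `E : ι → Finset V`) in which every edge has at least two vertices. Then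
`H` has an edge weighting with positive integer weights whose induced vertex weights
properly color `V(H)` (every edge contains two vertices with different induced weights)
if and only if no edge of `H` consists of twins (vertices contained in exactly the same
edges). In particular, if some edge of `H` consists of twins, then for every integer
edge weighting `ω : ι → ℤ` that edge is monochromatic in the induced vertex weights. -/
theorem vertex_coloring_weighting_iff_no_twin_edge {V ι : Type*} [Fintype V] [Fintype ι]
    [DecidableEq V] (E : ι → Finset V) (hsize : ∀ i, 2 ≤ (E i).card) :
    ((∃ ω : ι → ℕ, (∀ i, 1 ≤ ω i) ∧
        ∀ i, ∃ u ∈ E i, ∃ v ∈ E i,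
          (∑ j, if u ∈ E j then ω j else 0) ≠ (∑ j, if v ∈ E j then ω j else 0)) ↔
      ∀ i, ¬ (∀ u ∈ E i, ∀ v ∈ E i, ∀ j, (u ∈ E j ↔ v ∈ E j))) ∧
    (∀ i, (∀ u ∈ E i, ∀ v ∈ E i, ∀ j, (u ∈ E j ↔ v ∈ E j)) →
      ∀ ω : ι → ℤ, ∀ u ∈ E i, ∀ v ∈ E i,
        (∑ j, if u ∈ E j then ω j else 0) = (∑ j, if v ∈ E j then ω j else 0)) := by
  refine ⟨⟨?_, fun htwin => ?_⟩, fun i hi ω u hu v hv => by simp only [hi u hu v hv]⟩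
  · rintro ⟨ω, -, hω⟩ i hi
    obtain ⟨u, hu, v, hv, hne⟩ := hω i
    exact hne (by simp only [hi u hu v hv])
  · let f : ι ↪ ℕ := (Fintype.equivFin ι).toEmbedding.trans Fin.valEmbedding
    refine ⟨fun j => 2 ^ f j, fun j => Nat.one_le_two_pow, fun i => ?_⟩
    obtain ⟨u, hu, v, hv, j, hj⟩ : ∃ u ∈ E i, ∃ v ∈ E i, ∃ j, ¬(u ∈ E j ↔ v ∈ E j) := by
      simpa only [not_forall, exists_prop] using htwin i
    exact ⟨u, hu, v, hv, fun h =>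
      hj ((sum_ite_two_pow_eq_iff f (u ∈ E ·) (v ∈ E ·)).mp h j)⟩
end

section
/- For every linear hypergraph H in which every edge has size at least 2 and at most r, where r ≥ 4, and in which no edge consists of twins, there exists an edge weighting ω : E(H) → {1, 2, ..., r+1} such that the induced vertex weights properly color V(H); moreover the bound r+1 cannot be replaced by r: there is a linear hypergraph with maximum edge size r, no edge consisting of twins, admitting no vertex-coloring weighting from {1, ..., r}. -/
namespace LinearHypergraph

open Finset

variable {V ι : Type*} [DecidableEq V] [Fintype ι] [DecidableEq ι]

/-- The edges outside `F` whose only vertex in `X` is `v`. -/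
def pending (E : ι → Finset V) (F : Finset ι) (X : Finset V) (v : V) : Finset ι :=
  univ.filter fun e => e ∉ F ∧ E e ∩ X = {v}

/-- The weight that `v` receives from the edges that are not pending at `v`. -/
def settled (E : ι → Finset V) (F : Finset ι) (X : Finset V) (ω : ι → ℕ) (v : V) :
    ℕ :=
  ∑ j ∈ univ.filter (fun j => v ∈ E j ∧ j ∉ pending E F X v), ω j

/-- The final weights which are still possible for `v`. -/
def Possible (E : ι → Finset V) (F : Finset ι) (X : Finset V) (ω : ι → ℕ) (w : V → ℕ) (v : V)
    (n : ℕ) : Prop :=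
  if (pending E F X v).card = 0 then n = settled E F X ω v else n = w v ∨ n = w v + 2

/-- The weight of `v` can be completed to one of `w v`, `w v + 2` whatever choice between two
weights of difference two is made at each of the pending edges. -/
structure Controlled (E : ι → Finset V) (F : Finset ι) (X : Finset V) (ω : ι → ℕ) (w : V → ℕ)
    (v : V) : Prop where
  le : w v ≤ settled E F X ω v + 3 * (pending E F X v).card
  ge : settled E F X ω v + 3 * (pending E F X v).card ≤ w v + 2
  mod : (pending E F X v).card ≠ 0 → w v % 4 ≤ 1
  ne : (pending E F X v).card = 0 → settled E F X ω v ≠ w v + 1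

/-- A weighting of the edges meeting the set `X` of processed vertices, in which the edges outside
`F` with two vertices in `X` are guaranteed not to become monochromatic. -/
structure IsPartial (r : ℕ) (E : ι → Finset V) (F : Finset ι) (X : Finset V) (ω : ι → ℕ)
    (w : V → ℕ) : Prop where
  range : ∀ e, 1 ≤ ω e ∧ ω e ≤ r + 1
  controlled : ∀ v ∈ X, Controlled E F X ω w v
  separated : ∀ e ∉ F, 2 ≤ (E e ∩ X).card → ∃ u ∈ E e ∩ X, ∃ v ∈ E e ∩ X,
    ∀ n, Possible E F X ω w u n → ¬ Possible E F X ω w v n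

variable {E : ι → Finset V} {F : Finset ι} {X : Finset V} {ω : ι → ℕ} {w : V → ℕ} {r : ℕ}

lemma mem_pending {v : V} {e : ι} : e ∈ pending E F X v ↔ e ∉ F ∧ E e ∩ X = {v} := by
  simp [pending]

lemma mem_of_mem_pending {v : V} {e : ι} (h : e ∈ pending E F X v) : v ∈ E e ∧ v ∈ X := by
  have := (mem_pending.1 h).2
  have h2 : v ∈ E e ∩ X := by rw [this]; simp
  simpa using h2

omit [Fintype ι] [DecidableEq ι] in
lemma eq_of_mem_inter (hlin : ∀ i j, i ≠ j → (E i ∩ E j).card ≤ 1) {i j : ι} {u v : V}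
    (hui : u ∈ E i) (huj : u ∈ E j) (hvi : v ∈ E i) (hvj : v ∈ E j) (huv : u ≠ v) : i = j := by
  by_contra hij
  have := Finset.card_le_one.1 (hlin i j hij) u (by simp [*]) v (by simp [*])
  exact huv this

/-- The edges outside `F` through `v` with exactly one vertex in `X`. -/
def back (E : ι → Finset V) (F : Finset ι) (X : Finset V) (v : V) : Finset ι :=
  univ.filter fun e => e ∉ F ∧ v ∈ E e ∧ (E e ∩ X).card = 1

lemma mem_back {v : V} {e : ι} : e ∈ back E F X v ↔ e ∉ F ∧ v ∈ E e ∧ (E e ∩ X).card = 1 := by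
  simp [back]

lemma pending_insert (v : V) {u : V} (hu : u ∈ X) (hv : v ∉ X) :
    pending E F (insert v X) u = pending E F X u \ back E F X v := by
  ext e
  simp only [mem_pending, mem_sdiff, mem_back]
  by_cases hve : v ∈ E e
  · rw [Finset.inter_insert_of_mem hve]
    constructor
    · rintro ⟨h1, h2⟩
      have : v ∈ ({u} : Finset V) := by rw [← h2]; simp
      rw [mem_singleton] at this
      exact absurd (this ▸ hu) hv
    · rintro ⟨⟨h1, h2⟩, h3⟩
      exact absurd ⟨h1, hve, by rw [h2]; simp⟩ h3
  · rw [Finset.inter_insert_of_notMem hve]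
    tauto

lemma possible_of_settled_or {v : V} (h : Controlled E F X ω w v) {n : ℕ}
    (hn : Possible E F X ω w v n) : n = w v ∨ n = w v + 2 := by
  unfold Possible at hn
  split_ifs at hn with h0
  · have := h.le; have := h.ge; have := h.ne h0
    omega
  · exact hn

/-- Processing a new vertex `v`: in each back edge of `v` one chooses between two weights of
difference two, so that the weights of the processed vertices remain controlled. -/
lemma exists_settle (hr : 4 ≤ r) (hlin : ∀ i j, i ≠ j → (E i ∩ E j).card ≤ 1)
    (h : IsPartial r E F X ω w) {v : V} (hv : v ∉ X) :
    ∃ A : ℕ, ∀ S ⊆ back E F X v, ∃ ω' : ι → ℕ, (∀ e, 1 ≤ ω' e ∧ ω' e ≤ r + 1) ∧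
      settled E F (insert v X) ω' v = A + 2 * S.card ∧
      (∀ u ∈ X, Controlled E F (insert v X) ω' w u) ∧
      (∀ u ∈ X, ∀ n, Possible E F (insert v X) ω' w u n → Possible E F X ω w u n) ∧
      (∀ e ∈ back E F X v, ∀ u ∈ E e ∩ X, w u % 4 ≤ 1 ∧
        (pending E F (insert v X) u = ∅ → (e ∈ S → settled E F (insert v X) ω' u = w u + 2) ∧
          (e ∉ S → settled E F (insert v X) ω' u = w u))) := by
  set T := back E F X v with hT
  set t : ι → ℕ := fun e => ∑ u ∈ E e ∩ X,
    (w u + 3 - (settled E F X ω u + 3 * (pending E F X u).card)) with ht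
  refine ⟨∑ j ∈ univ.filter (fun j => v ∈ E j ∧ j ∉ pending E F (insert v X) v),
    (if j ∈ T then t j else ω j), fun S hS => ?_⟩
  set ω' : ι → ℕ := fun e => if e ∈ T then t e + (if e ∈ S then 2 else 0) else ω e with hω'
  -- each back edge has a unique processed vertex, at which it was pending
  have hback : ∀ e ∈ T, ∀ u ∈ E e ∩ X, e ∈ pending E F X u ∧ E e ∩ X = {u} ∧
      t e = w u + 3 - (settled E F X ω u + 3 * (pending E F X u).card) := by
    intro e he u hu
    obtain ⟨h1, h2, h3⟩ := mem_back.1 he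
    obtain ⟨a, ha⟩ := Finset.card_eq_one.1 h3
    have hua : u = a := by simpa [ha] using hu
    subst hua
    refine ⟨mem_pending.2 ⟨h1, ha⟩, ha, ?_⟩
    simp only [ht, ha, sum_singleton]
  have hrange : ∀ e ∈ T, 1 ≤ t e ∧ t e ≤ 3 := by
    intro e he
    obtain ⟨u, hu⟩ := Finset.card_pos.1 (by rw [(mem_back.1 he).2.2]; exact one_pos)
    have h1 := (hback e he u hu).2.2
    have hc := h.controlled u (mem_inter.1 hu).2
    have := hc.le; have := hc.ge
    omega
  have hsame : ∀ u ∈ X, (∀ e ∈ T, u ∉ E e) →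
      pending E F (insert v X) u = pending E F X u ∧
      settled E F (insert v X) ω' u = settled E F X ω u := by
    intro u hu hno
    have hp : pending E F (insert v X) u = pending E F X u := by
      rw [pending_insert v hu hv, Finset.sdiff_eq_self_iff_disjoint, Finset.disjoint_left]
      intro e he he'
      exact hno e he' (mem_of_mem_pending he).1
    refine ⟨hp, ?_⟩
    unfold settled
    rw [hp]
    refine sum_congr rfl fun j hj => ?_
    have : j ∉ T := fun hjT => hno j hjT (mem_filter.1 hj).2.1
    simp [hω', this]
  have hchange : ∀ e ∈ T, ∀ u ∈ E e ∩ X,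
      (pending E F (insert v X) u).card + 1 = (pending E F X u).card ∧
      settled E F (insert v X) ω' u =
        settled E F X ω u + (t e + if e ∈ S then 2 else 0) := by
    intro e he u hu
    obtain ⟨huE, huX⟩ := mem_inter.1 hu
    obtain ⟨h1, h2, h3⟩ := hback e he u hu
    have huv : u ≠ v := fun h => hv (h ▸ huX)
    have huniq : ∀ e' ∈ T, u ∈ E e' → e' = e := fun e' he' hue' =>
      eq_of_mem_inter hlin hue' huE (mem_back.1 he').2.1 (mem_back.1 he).2.1 huv
    have hp : pending E F (insert v X) u = (pending E F X u).erase e := by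
      rw [pending_insert v huX hv]
      ext j
      simp only [mem_sdiff, mem_erase]
      constructor
      · rintro ⟨hj, hjT⟩
        exact ⟨fun h => hjT (h ▸ he), hj⟩
      · rintro ⟨hj, hj'⟩
        exact ⟨hj', fun hjT => hj (huniq j hjT (mem_of_mem_pending hj').1)⟩
    refine ⟨by rw [hp]; exact card_erase_add_one h1, ?_⟩
    unfold settled
    have hset : univ.filter (fun j => u ∈ E j ∧ j ∉ pending E F (insert v X) u) =
        insert e (univ.filter (fun j => u ∈ E j ∧ j ∉ pending E F X u)) := by
      ext j
      simp only [hp, mem_filter, mem_univ, true_and, mem_insert, mem_erase]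
      constructor
      · rintro ⟨hj, hj'⟩
        by_cases hje : j = e
        · exact Or.inl hje
        · exact Or.inr ⟨hj, fun hj2 => hj' ⟨hje, hj2⟩⟩
      · rintro (rfl | ⟨hj, hj'⟩)
        · exact ⟨huE, fun h => h.1 rfl⟩
        · exact ⟨hj, fun h => hj' h.2⟩
    rw [hset, sum_insert (by simp [h1]), add_comm]
    congr 1
    · refine sum_congr rfl fun j hj => ?_
      have hj := (mem_filter.1 hj).2
      have : j ∉ T := fun hjT => hj.2 (huniq j hjT hj.1 ▸ h1)
      simp [hω', this]
    · simp [hω', he]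
  refine ⟨ω', ?_, ?_, ?_, ?_, ?_⟩
  · intro e
    by_cases he : e ∈ T
    · have := hrange e he
      simp only [hω', he, if_true]
      split_ifs <;> omega
    · simpa [hω', he] using h.range e
  · unfold settled
    have hST : ∑ j ∈ univ.filter (fun j => v ∈ E j ∧ j ∉ pending E F (insert v X) v),
        (if j ∈ S then 2 else 0) = 2 * S.card := by
      rw [← sum_filter, sum_const, smul_eq_mul, mul_comm]
      congr 2
      ext j
      simp only [mem_filter, mem_univ, true_and]
      refine ⟨fun h => h.2, fun hj => ?_⟩
      obtain ⟨h1, h2, h3⟩ := mem_back.1 (hS hj)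
      refine ⟨⟨h2, fun hp => ?_⟩, hj⟩
      have h4 := (mem_pending.1 hp).2
      obtain ⟨u, hu⟩ := Finset.card_pos.1 (by rw [h3]; exact one_pos)
      have : u ∈ E j ∩ insert v X := by
        simp only [mem_inter, mem_insert] at hu ⊢; tauto
      rw [h4, mem_singleton] at this
      exact hv (this ▸ (mem_inter.1 hu).2)
    rw [← hST, ← sum_add_distrib]
    refine sum_congr rfl fun j _ => ?_
    by_cases hj : j ∈ T
    · simp [hω', hj]
    · have : j ∉ S := fun h => hj (hS h)
      simp [hω', hj, this]
  · intro u hu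
    have hc := h.controlled u hu
    by_cases hex : ∃ e ∈ T, u ∈ E e
    · obtain ⟨e, he, hue⟩ := hex
      have hu' : u ∈ E e ∩ X := mem_inter.2 ⟨hue, hu⟩
      obtain ⟨h1, h2⟩ := hchange e he u hu'
      have h3 := (hback e he u hu').2.2
      have := hc.le; have := hc.ge; have h4 := hc.mod (by omega)
      refine ⟨?_, ?_, fun _ => h4, fun h0 => ?_⟩ <;> rw [h2] <;> split_ifs <;> omega
    · push Not at hex
      obtain ⟨h1, h2⟩ := hsame u hu hex
      exact ⟨by rw [h1, h2]; exact hc.le, by rw [h1, h2]; exact hc.ge,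
        by rw [h1]; exact hc.mod, by rw [h1, h2]; exact hc.ne⟩
  · intro u hu n hn
    have hc := h.controlled u hu
    by_cases hex : ∃ e ∈ T, u ∈ E e
    · obtain ⟨e, he, hue⟩ := hex
      have hu' : u ∈ E e ∩ X := mem_inter.2 ⟨hue, hu⟩
      obtain ⟨h1, h2⟩ := hchange e he u hu'
      have h3 := (hback e he u hu').2.2
      have := hc.le; have := hc.ge
      unfold Possible at hn ⊢
      rw [if_neg (by omega)]
      split_ifs at hn with h0
      · rw [h2] at hn
        split_ifs at hn <;> omega
      · exact hn
    · push Not at hex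
      obtain ⟨h1, h2⟩ := hsame u hu hex
      unfold Possible at hn ⊢
      rwa [h1, h2] at hn
  · intro e he u hu
    obtain ⟨h1, h2⟩ := hchange e he u hu
    have h3 := (hback e he u hu).2.2
    have hc := h.controlled u (mem_inter.1 hu).2
    have := hc.le; have := hc.ge
    refine ⟨hc.mod (by omega), fun h0 => ?_⟩
    rw [h0, card_empty] at h1
    constructor <;> intro hS' <;> rw [h2] <;> simp only [hS', if_true, if_false] <;> omega

lemma isPartial_insert (h : IsPartial r E F X ω w) {v : V} (hv : v ∉ X) {ω' : ι → ℕ} {c : ℕ}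
    (hrange : ∀ e, 1 ≤ ω' e ∧ ω' e ≤ r + 1)
    (hcontrolled : ∀ u ∈ X, Controlled E F (insert v X) ω' w u)
    (hpossible : ∀ u ∈ X, ∀ n, Possible E F (insert v X) ω' w u n → Possible E F X ω w u n)
    (hcv : Controlled E F (insert v X) ω' (Function.update w v c) v)
    (hsep : ∀ e ∈ back E F X v, ∀ u ∈ E e ∩ X, ∀ n,
      Possible E F (insert v X) ω' w u n →
        ¬ Possible E F (insert v X) ω' (Function.update w v c) v n) :
    IsPartial r E F (insert v X) ω' (Function.update w v c) := by
  have hne : ∀ u ∈ X, Function.update w v c u = w u := fun u hu =>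
    Function.update_of_ne (ne_of_mem_of_not_mem hu hv) _ _
  have hposs : ∀ u ∈ X, ∀ n, Possible E F (insert v X) ω' (Function.update w v c) u n ↔
      Possible E F (insert v X) ω' w u n := by
    intro u hu n
    unfold Possible
    rw [hne u hu]
  refine ⟨hrange, ?_, ?_⟩
  · intro u hu
    rcases mem_insert.1 hu with rfl | hu
    · exact hcv
    · have hc := hcontrolled u hu
      constructor <;> rw [hne u hu]
      exacts [hc.le, hc.ge, hc.mod, hc.ne]
  · intro e heF he
    have hsub : E e ∩ X ⊆ E e ∩ insert v X :=
      inter_subset_inter_left (subset_insert v X)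
    by_cases h2 : 2 ≤ (E e ∩ X).card
    · obtain ⟨x, hx, y, hy, hxy⟩ := h.separated e heF h2
      have hx' := (mem_inter.1 hx).2
      have hy' := (mem_inter.1 hy).2
      refine ⟨x, hsub hx, y, hsub hy, fun n hn hn' => hxy n ?_ ?_⟩
      · exact hpossible x hx' n ((hposs x hx' n).1 hn)
      · exact hpossible y hy' n ((hposs y hy' n).1 hn')
    · have hve : v ∈ E e := by
        by_contra hve
        rw [inter_insert_of_notMem hve] at he
        exact h2 he
      have hcard : (E e ∩ X).card = 1 := by
        rw [inter_insert_of_mem hve] at he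
        have := card_insert_le v (E e ∩ X)
        omega
      obtain ⟨u, hu⟩ := card_pos.1 (by rw [hcard]; exact one_pos)
      refine ⟨u, hsub hu, v, by simp [hve], fun n hn => ?_⟩
      exact hsep e (mem_back.2 ⟨heF, hve, hcard⟩) u hu n
        ((hposs u (mem_inter.1 hu).2 n).1 hn)

lemma exists_residue_avoiding {b d : ℕ} (hb : 3 ≤ b) {B : Finset ℕ} (hB : B.card ≤ d) :
    ∃ i ≤ d, ∃ c, c ≤ b + 2 * i ∧ b + 2 * i ≤ c + 2 ∧ c % 4 ≤ 1 ∧ c ∉ B := by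
  set c : ℕ → ℕ := fun i => if (b + 2 * i) % 4 = 0 then b + 2 * i else
    if (b + 2 * i) % 4 = 3 then b + 2 * i - 2 else b + 2 * i - 1 with hc
  have hinj : Function.Injective c := by
    intro i j hij
    simp only [hc] at hij
    split_ifs at hij <;> omega
  obtain ⟨x, hx, hxB⟩ : ∃ x ∈ (range (d + 1)).image c, x ∉ B := by
    apply exists_mem_notMem_of_card_lt_card
    rw [card_image_of_injective _ hinj, card_range]
    omega
  obtain ⟨i, hi, rfl⟩ := mem_image.1 hx
  refine ⟨i, by simpa [Nat.lt_succ_iff] using hi, c i, ?_, ?_, ?_, hxB⟩ <;>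
    simp only [hc] <;> split_ifs <;> omega

lemma exists_isPartial_insert_of_pending (hr : 4 ≤ r)
    (hlin : ∀ i j, i ≠ j → (E i ∩ E j).card ≤ 1) (h : IsPartial r E F X ω w) {v : V}
    (hv : v ∉ X) (hp : (pending E F (insert v X) v).Nonempty) :
    ∃ ω' w', IsPartial r E F (insert v X) ω' w' := by
  obtain ⟨A, hA⟩ := exists_settle hr hlin h hv
  have hp' : 1 ≤ (pending E F (insert v X) v).card := card_pos.2 hp
  set B : Finset ℕ := (back E F X v).biUnion fun e => (E e ∩ X).image w with hB
  have hBcard : B.card ≤ (back E F X v).card := by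
    refine card_biUnion_le.trans ?_
    rw [card_eq_sum_ones]
    exact sum_le_sum fun e he => card_image_le.trans (mem_back.1 he).2.2.le
  obtain ⟨i, hi, c, h1, h2, h3, h4⟩ := exists_residue_avoiding
    (b := A + 3 * (pending E F (insert v X) v).card) (by omega) hBcard
  obtain ⟨S, hS, hSi⟩ := exists_subset_card_eq hi
  obtain ⟨ω', hrange, hset, hcon, hpos, hbk⟩ := hA S hS
  rw [hSi] at hset
  refine ⟨ω', Function.update w v c, isPartial_insert h hv hrange hcon hpos ?_ ?_⟩
  · constructor <;> simp only [Function.update_self, hset]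
    · omega
    · omega
    · exact fun _ => h3
    · omega
  · intro e he u hu n hn hn'
    have hw := (hbk e he u hu).1
    have hwB : w u ∈ B := mem_biUnion.2 ⟨e, he, mem_image_of_mem w hu⟩
    have hne : c ≠ w u := fun h => h4 (h ▸ hwB)
    have := possible_of_settled_or (hcon u (mem_inter.1 hu).2) hn
    rw [Possible, if_neg (by omega), Function.update_self] at hn'
    omega

lemma exists_isPartial_insert_of_settled (h : IsPartial r E F X ω w) {v : V} (hv : v ∉ X)
    (hp : pending E F (insert v X) v = ∅) {ω' : ι → ℕ}
    (hrange : ∀ e, 1 ≤ ω' e ∧ ω' e ≤ r + 1)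
    (hcontrolled : ∀ u ∈ X, Controlled E F (insert v X) ω' w u)
    (hpossible : ∀ u ∈ X, ∀ n, Possible E F (insert v X) ω' w u n → Possible E F X ω w u n)
    (hsep : ∀ e ∈ back E F X v, ∀ u ∈ E e ∩ X, pending E F (insert v X) u = ∅ ∧
      settled E F (insert v X) ω' u ≠ settled E F (insert v X) ω' v) :
    ∃ ω' w', IsPartial r E F (insert v X) ω' w' := by
  refine ⟨ω', Function.update w v (settled E F (insert v X) ω' v),
    isPartial_insert h hv hrange hcontrolled hpossible ?_ ?_⟩
  · constructor <;> simp [hp]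
  · intro e he u hu n hn hn'
    obtain ⟨h1, h2⟩ := hsep e he u hu
    simp only [Possible, h1, hp, card_empty, if_true] at hn hn'
    exact h2 (hn.symm.trans hn')

lemma exists_isPartial_insert_of_back_eq_empty (hr : 4 ≤ r)
    (hlin : ∀ i j, i ≠ j → (E i ∩ E j).card ≤ 1) (h : IsPartial r E F X ω w) {v : V}
    (hv : v ∉ X) (hp : pending E F (insert v X) v = ∅) (hb : back E F X v = ∅) :
    ∃ ω' w', IsPartial r E F (insert v X) ω' w' := by
  obtain ⟨A, hA⟩ := exists_settle hr hlin h hv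
  obtain ⟨ω', hrange, hset, hcon, hpos, hbk⟩ := hA ∅ (empty_subset _)
  refine exists_isPartial_insert_of_settled h hv hp hrange hcon hpos ?_
  simp [hb]

lemma exists_isPartial_insert_of_two_le_card_back (hr : 4 ≤ r)
    (hlin : ∀ i j, i ≠ j → (E i ∩ E j).card ≤ 1) (h : IsPartial r E F X ω w) {v : V}
    (hv : v ∉ X) (hp : ∀ u ∈ insert v X, pending E F (insert v X) u = ∅)
    (hb : 2 ≤ (back E F X v).card) :
    ∃ ω' w', IsPartial r E F (insert v X) ω' w' := by
  obtain ⟨A, hA⟩ := exists_settle hr hlin h hv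
  suffices ∃ S ⊆ back E F X v, ∀ e ∈ back E F X v, ∀ u ∈ E e ∩ X, w u % 4 ≤ 1 →
      (e ∈ S → w u + 2 ≠ A + 2 * S.card) ∧ (e ∉ S → w u ≠ A + 2 * S.card) by
    obtain ⟨S, hS, hSne⟩ := this
    obtain ⟨ω', hrange, hset, hcon, hpos, hbk⟩ := hA S hS
    refine exists_isPartial_insert_of_settled h hv (hp v (mem_insert_self v X)) hrange hcon hpos
      fun e he u hu => ?_
    have hpu := hp u (mem_insert_of_mem (mem_inter.1 hu).2)
    obtain ⟨h1, h2⟩ := hbk e he u hu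
    refine ⟨hpu, ?_⟩
    rw [hset]
    by_cases heS : e ∈ S
    · rw [(h2 hpu).1 heS]
      exact (hSne e he u hu h1).1 heS
    · rw [(h2 hpu).2 heS]
      exact (hSne e he u hu h1).2 heS
  by_cases hA4 : 2 ≤ A % 4
  · refine ⟨∅, empty_subset _, fun e he u hu hw => ⟨by simp, fun _ => ?_⟩⟩
    rw [card_empty]
    omega
  · by_cases hex : ∃ e ∈ back E F X v, ∃ u ∈ E e ∩ X, w u ≠ A
    · obtain ⟨e, he, u, hu, hne⟩ := hex
      refine ⟨{e}, singleton_subset_iff.2 he, fun e' he' u' hu' hw => ?_⟩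
      rw [mem_singleton, card_singleton]
      refine ⟨?_, fun _ => by omega⟩
      rintro rfl
      obtain ⟨a, ha⟩ := card_eq_one.1 (mem_back.1 he).2.2
      rw [ha, mem_singleton] at hu hu'
      subst hu hu'
      omega
    · push Not at hex
      obtain ⟨S, hS, hS2⟩ := exists_subset_card_eq hb
      refine ⟨S, hS, fun e he u hu hw => ?_⟩
      have := hex e he u hu
      rw [hS2]
      constructor <;> intro <;> omega

/-- The weight of a vertex induced by a weighting of the edges. -/
def inducedWeight (E : ι → Finset V) (ω : ι → ℕ) (v : V) : ℕ :=
  ∑ j ∈ univ.filter (fun j => v ∈ E j), ω j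

/-- The edges outside `F` with two vertices in `X` have two vertices of distinct weights in `X`. -/
structure IsColoring (r : ℕ) (E : ι → Finset V) (F : Finset ι) (X : Finset V) (ω : ι → ℕ) :
    Prop where
  range : ∀ e, 1 ≤ ω e ∧ ω e ≤ r + 1
  ne : ∀ e ∉ F, 2 ≤ (E e ∩ X).card → ∃ u ∈ E e ∩ X, ∃ v ∈ E e ∩ X,
    inducedWeight E ω u ≠ inducedWeight E ω v

lemma settled_eq_inducedWeight {v : V} (h : pending E F X v = ∅) :
    settled E F X ω v = inducedWeight E ω v := by
  simp [settled, inducedWeight, h]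

lemma IsPartial.isColoring (h : IsPartial r E F X ω w) (hp : ∀ v ∈ X, pending E F X v = ∅) :
    IsColoring r E F X ω := by
  refine ⟨h.range, fun e heF he => ?_⟩
  obtain ⟨u, hu, v, hv, huv⟩ := h.separated e heF he
  refine ⟨u, hu, v, hv, fun heq => ?_⟩
  have hpu := hp u (mem_inter.1 hu).2
  have hpv := hp v (mem_inter.1 hv).2
  refine huv (inducedWeight E ω u) ?_ ?_
  · simp [Possible, hpu, settled_eq_inducedWeight hpu]
  · simp [Possible, hpv, settled_eq_inducedWeight hpv, heq]

lemma IsColoring.isPartial (h : IsColoring r E F X ω) (hp : ∀ v ∈ X, pending E F X v = ∅) :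
    IsPartial r E F X ω (inducedWeight E ω) := by
  refine ⟨h.range, fun v hv => ?_, fun e heF he => ?_⟩
  · constructor <;> simp [hp v hv, settled_eq_inducedWeight (hp v hv)]
  · obtain ⟨u, hu, v, hv, huv⟩ := h.ne e heF he
    have hpu := hp u (mem_inter.1 hu).2
    have hpv := hp v (mem_inter.1 hv).2
    refine ⟨u, hu, v, hv, fun n hn hn' => huv ?_⟩
    simp only [Possible, hpu, hpv, card_empty, if_true, settled_eq_inducedWeight hpu,
      settled_eq_inducedWeight hpv] at hn hn'
    exact hn.symm.trans hn'

omit [DecidableEq ι] in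
lemma inducedWeight_congr {ω' : ι → ℕ} {v : V} (h : ∀ e, v ∈ E e → ω' e = ω e) :
    inducedWeight E ω' v = inducedWeight E ω v :=
  sum_congr rfl fun e he => h e (mem_filter.1 he).2

lemma inducedWeight_add_eq {ω' : ι → ℕ} {v : V} {e : ι} (hv : v ∈ E e)
    (h : ∀ e', v ∈ E e' → e' ≠ e → ω' e' = ω e') :
    inducedWeight E ω' v + ω e = inducedWeight E ω v + ω' e := by
  have he : e ∈ univ.filter fun j => v ∈ E j := by simpa using hv
  unfold inducedWeight
  rw [← sum_erase_add _ _ he, ← sum_erase_add _ ω he, add_right_comm _ (ω' e), add_left_inj,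
    add_left_inj]
  refine sum_congr rfl fun j hj => ?_
  rw [mem_erase, mem_filter] at hj
  exact h j hj.2.2 hj.1

/-- No edge outside `F` has a single vertex in `X`, and the edges outside `F` with two vertices
in `X` form a perfect matching of `X`: the vertex `v` is matched to `p v` by the edge `q v`. -/
structure IsPairing (E : ι → Finset V) (F : Finset ι) (X : Finset V) (q : V → ι) (p : V → V) :
    Prop where
  pending_eq : ∀ v ∈ X, pending E F X v = ∅
  notMem : ∀ v ∈ X, q v ∉ F
  inter_eq : ∀ v ∈ X, E (q v) ∩ X = {v, p v}
  ne : ∀ v ∈ X, p v ≠ v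
  unique : ∀ v ∈ X, ∀ e ∉ F, v ∈ E e → (E e ∩ X).card = 2 → e = q v

namespace IsPairing

variable {q : V → ι} {p : V → V} (hq : IsPairing E F X q p) {u v : V} {e : ι}
include hq

lemma mem_edge (hv : v ∈ X) : v ∈ E (q v) := by
  have : v ∈ E (q v) ∩ X := by simp [hq.inter_eq v hv]
  exact (mem_inter.1 this).1

lemma partner_mem_inter (hv : v ∈ X) : p v ∈ E (q v) ∩ X := by
  simp [hq.inter_eq v hv]

lemma partner_mem (hv : v ∈ X) : p v ∈ X := (mem_inter.1 (hq.partner_mem_inter hv)).2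

lemma partner_mem_edge (hv : v ∈ X) : p v ∈ E (q v) := (mem_inter.1 (hq.partner_mem_inter hv)).1

lemma card_eq (hv : v ∈ X) : (E (q v) ∩ X).card = 2 := by
  rw [hq.inter_eq v hv, card_pair (hq.ne v hv).symm]

lemma edge_partner (hv : v ∈ X) : q (p v) = q v :=
  (hq.unique _ (hq.partner_mem hv) _ (hq.notMem v hv) (hq.partner_mem_edge hv)
    (hq.card_eq hv)).symm

lemma eq_or_eq_of_mem (hu : u ∈ X) (hv : v ∈ X) (h : u ∈ E (q v)) : u = v ∨ u = p v := by
  have : u ∈ E (q v) ∩ X := mem_inter.2 ⟨h, hu⟩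
  simpa [hq.inter_eq v hv] using this

lemma partner_partner (hv : v ∈ X) : p (p v) = v := by
  have h := hq.partner_mem (hq.partner_mem hv)
  have h2 := hq.partner_mem_edge (hq.partner_mem hv)
  rw [hq.edge_partner hv] at h2
  exact (hq.eq_or_eq_of_mem h hv h2).resolve_right (hq.ne _ (hq.partner_mem hv))

lemma edge_eq_of_mem (hu : u ∈ X) (hv : v ∈ X) (h : u ∈ E (q v)) : q u = q v := by
  rcases hq.eq_or_eq_of_mem hu hv h with rfl | rfl
  · rfl
  · exact hq.edge_partner hv

lemma card_ne_one (he : e ∉ F) : (E e ∩ X).card ≠ 1 := by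
  intro h
  obtain ⟨v, hv⟩ := card_eq_one.1 h
  have hvX : v ∈ E e ∩ X := by simp [hv]
  have : e ∈ pending E F X v := mem_pending.2 ⟨he, hv⟩
  rw [hq.pending_eq v (mem_inter.1 hvX).2] at this
  simp at this

lemma eq_edge_of_mem_of_partner_mem (hlin : ∀ i j, i ≠ j → (E i ∩ E j).card ≤ 1) (hv : v ∈ X)
    (h1 : v ∈ E e) (h2 : p v ∈ E e) : e = q v :=
  eq_of_mem_inter hlin h1 (hq.mem_edge hv) h2 (hq.partner_mem_edge hv) (hq.ne v hv).symm

lemma partner_notMem_of_ne (hlin : ∀ i j, i ≠ j → (E i ∩ E j).card ≤ 1) (hv : v ∈ X)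
    (h1 : v ∈ E e) (h : e ≠ q v) : p v ∉ E e :=
  fun h2 => h (hq.eq_edge_of_mem_of_partner_mem hlin hv h1 h2)

/-- Removing a matched pair leaves at least two vertices in every other edge outside `F` which had
two vertices in `X`. -/
lemma two_le_card_inter_sdiff (hlin : ∀ i j, i ≠ j → (E i ∩ E j).card ≤ 1) (hv : v ∈ X)
    (he : e ∉ F) (hne : e ≠ q v) (h : 2 ≤ (E e ∩ X).card) :
    2 ≤ (E e ∩ (X \ {v, p v})).card := by
  rw [← inter_sdiff_assoc]
  have key : (E e ∩ X).card ≤ ((E e ∩ X) \ {v, p v}).card + (E e ∩ {v, p v}).card := by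
    refine (card_le_card fun u hu => ?_).trans (card_union_le _ _)
    simp only [mem_union, mem_sdiff, mem_inter] at hu ⊢
    tauto
  have h1 : (E e ∩ {v, p v}).card ≤ 1 := by
    refine (card_le_card ?_).trans (hlin e (q v) hne)
    refine inter_subset_inter_left fun u hu => ?_
    rcases mem_insert.1 hu with rfl | hu
    · exact hq.mem_edge hv
    · rw [mem_singleton.1 hu]
      exact hq.partner_mem_edge hv
  by_cases h2 : (E e ∩ X).card = 2
  · rw [sdiff_eq_self_of_disjoint]
    · exact h
    · rw [disjoint_right]
      intro u hu hu'
      rw [mem_inter] at hu'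
      have := hq.unique u hu'.2 e he hu'.1 h2
      rcases mem_insert.1 hu with rfl | hu
      · exact hne this
      · rw [mem_singleton.1 hu, hq.edge_partner hv] at this
        exact hne this
  · omega

lemma exists_isColoring_of_mem (hlin : ∀ i j, i ≠ j → (E i ∩ E j).card ≤ 1) (hr : 4 ≤ r)
    (ih : ∀ X' ⊂ X, ∀ F', (∀ e ∈ F', (E e ∩ X').card ≤ 1) → ∃ ω w, IsPartial r E F' X' ω w)
    (hF : ∀ e ∈ F, (E e ∩ X).card ≤ 1) {g : ι} (hv : v ∈ X) (hg : g ∈ F) (hvg : v ∈ E g) :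
    ∃ ω, IsColoring r E F X ω := by
  set X' := X \ {v, p v} with hX'
  have hX'X : X' ⊆ X := sdiff_subset
  have hss : X' ⊂ X := ⟨hX'X, fun h => by simpa [hX'] using h hv⟩
  obtain ⟨ω, w, hω⟩ := ih X' hss F fun e he =>
    (card_le_card (inter_subset_inter_left hX'X)).trans (hF e he)
  have hcol : IsColoring r E F X' ω := by
    refine hω.isColoring fun u hu => eq_empty_of_forall_notMem fun e he => ?_
    obtain ⟨heF, heX'⟩ := mem_pending.1 he
    have huX' : u ∈ E e ∩ X' := by simp [heX']
    have huX := hX'X hu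
    have hpos : 0 < (E e ∩ X).card :=
      card_pos.2 ⟨u, inter_subset_inter_left hX'X huX'⟩
    have h1 := hq.card_ne_one heF
    have hne : e ≠ q v := by
      rintro rfl
      have := hq.eq_or_eq_of_mem huX hv (mem_inter.1 huX').1
      simp only [hX', mem_sdiff, mem_insert, mem_singleton] at hu
      exact hu.2 this
    have := hq.two_le_card_inter_sdiff hlin hv heF hne (by omega)
    rw [← hX', heX', card_singleton] at this
    omega
  have hone : ∀ u ∈ X, u ∈ E g → u = v := fun u hu hug =>
    card_le_one.1 (hF g hg) u (mem_inter.2 ⟨hug, hu⟩) v (mem_inter.2 ⟨hvg, hv⟩)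
  have hpg : p v ∉ E g := fun h => hq.ne v hv (hone _ (hq.partner_mem hv) h)
  obtain ⟨t, ht1, ht2, htne⟩ : ∃ t, 1 ≤ t ∧ t ≤ r + 1 ∧
      inducedWeight E ω v + t ≠ inducedWeight E ω (p v) + ω g := by
    by_cases h : inducedWeight E ω v + 1 = inducedWeight E ω (p v) + ω g
    · exact ⟨2, by omega, by omega, by omega⟩
    · exact ⟨1, by omega, by omega, h⟩
  have hsame : ∀ u, u ∉ E g →
      inducedWeight E (Function.update ω g t) u = inducedWeight E ω u := fun u hu =>
    inducedWeight_congr fun e he => Function.update_of_ne (fun h : e = g => hu (h ▸ he)) _ _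
  refine ⟨Function.update ω g t, fun e => ?_, fun e heF he => ?_⟩
  · by_cases h : e = g
    · subst h
      simp [ht1, ht2]
    · rw [Function.update_of_ne h]
      exact hcol.range e
  · by_cases hne : e = q v
    · subst hne
      refine ⟨v, mem_inter.2 ⟨hq.mem_edge hv, hv⟩, p v, hq.partner_mem_inter hv, ?_⟩
      have := inducedWeight_add_eq (ω := ω) (ω' := Function.update ω g t) hvg
        fun e' _ h => Function.update_of_ne h _ _
      rw [Function.update_self] at this
      rw [hsame _ hpg]
      omega
    · obtain ⟨x, hx, y, hy, hxy⟩ := hcol.ne e heF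
        (hq.two_le_card_inter_sdiff hlin hv heF hne he)
      have hnot : ∀ u ∈ E e ∩ X', u ∉ E g := by
        intro u hu hug
        have hu' := (mem_inter.1 hu).2
        have := hone u (hX'X hu') hug
        simp [hX', this] at hu'
      refine ⟨x, inter_subset_inter_left hX'X hx, y, inter_subset_inter_left hX'X hy, ?_⟩
      rwa [hsame x (hnot x hx), hsame y (hnot y hy)]

end IsPairing

namespace IsPairing

variable {q : V → ι} {p : V → V} (hq : IsPairing E F X q p) {s : Fin 3 → V}
include hq

lemma inducedWeight_extend_of_ne (hs : ∀ i, s i ∈ X) (m : Fin 3 → ℕ) {v : V} (hv : v ∈ X)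
    (h : ∀ i, q v ≠ q (s i)) :
    inducedWeight E (Function.extend (fun i => q (s i)) m ω) v = inducedWeight E ω v := by
  refine inducedWeight_congr fun e he => Function.extend_apply' _ _ _ ?_
  rintro ⟨i, rfl⟩
  exact h i (hq.edge_eq_of_mem hv (hs i) he)

lemma inducedWeight_extend_add_eq (hs : ∀ i, s i ∈ X)
    (hinj : Function.Injective fun i => q (s i)) (m : Fin 3 → ℕ) {v : V} (hv : v ∈ X) {i : Fin 3}
    (h : v ∈ E (q (s i))) :
    inducedWeight E (Function.extend (fun i => q (s i)) m ω) v + ω (q (s i)) =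
      inducedWeight E ω v + m i := by
  rw [inducedWeight_add_eq h, hinj.extend_apply]
  intro e he hne
  refine Function.extend_apply' _ _ _ ?_
  rintro ⟨j, rfl⟩
  exact hne ((hq.edge_eq_of_mem hv (hs j) he).symm.trans (hq.edge_eq_of_mem hv (hs i) h))

/-- The weights of three matching edges can be chosen so that all edges of `G` get two vertices of
distinct weights, where each edge of `G` meets two of the three matching edges, and meets either
the third one or a vertex matched by another edge. -/
lemma exists_extend_ne (hlin : ∀ i j, i ≠ j → (E i ∩ E j).card ≤ 1) (hs : ∀ i, s i ∈ X)
    (hinj : Function.Injective fun i => q (s i)) {G : Finset ι}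
    (hhit : ∀ g ∈ G, ∀ i j, i ≠ j →
      (∃ v ∈ E g ∩ X, v ∈ E (q (s i))) ∨ (∃ v ∈ E g ∩ X, v ∈ E (q (s j))))
    (hother : ∀ g ∈ G, (∀ i, ∃ v ∈ E g ∩ X, v ∈ E (q (s i))) ∨
      ∃ c ∈ E g ∩ X, ∀ i, q c ≠ q (s i)) :
    ∃ m : Fin 3 → ℕ, (∀ i, 1 ≤ m i ∧ m i ≤ 5) ∧ ∀ g ∈ G, ∃ u ∈ E g ∩ X, ∃ v ∈ E g ∩ X,
      inducedWeight E (Function.extend (fun i => q (s i)) m ω) u ≠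
        inducedWeight E (Function.extend (fun i => q (s i)) m ω) v := by
  set Ω : (Fin 3 → ℕ) → ι → ℕ := fun m => Function.extend (fun i => q (s i)) m ω with hΩ
  set M : Finset (Fin 3 → ℕ) := Fintype.piFinset fun _ => Icc 1 5 with hM
  have hMcard : M.card = 125 := by simp [hM]
  set bad : ι → Finset (Fin 3 → ℕ) := fun g => M.filter fun m =>
    ∀ u ∈ E g ∩ X, ∀ v ∈ E g ∩ X, inducedWeight E (Ω m) u = inducedWeight E (Ω m) v with hbad
  have hG : G.card ≤ 15 := by
    set S : Finset V := univ.biUnion fun i => E (q (s i)) ∩ X with hS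
    have hScard : S.card ≤ 6 :=
      card_biUnion_le_card_mul univ _ 2 fun i _ => (hq.card_eq (hs i)).le
    have hT : ∀ g ∈ G, ∃ T ⊆ E g ∩ S, T.card = 2 := by
      intro g hg
      apply exists_subset_card_eq
      obtain ⟨i, j, hij, ⟨u, hu, hui⟩, v, hv, hvj⟩ : ∃ i j, i ≠ j ∧
          (∃ v ∈ E g ∩ X, v ∈ E (q (s i))) ∧ (∃ v ∈ E g ∩ X, v ∈ E (q (s j))) := by
        have h01 := hhit g hg 0 1 (by decide)
        have h02 := hhit g hg 0 2 (by decide)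
        have h12 := hhit g hg 1 2 (by decide)
        rcases h01 with h | h
        · rcases h12 with h' | h'
          · exact ⟨0, 1, by decide, h, h'⟩
          · exact ⟨0, 2, by decide, h, h'⟩
        · rcases h02 with h' | h'
          · exact ⟨1, 0, by decide, h, h'⟩
          · exact ⟨1, 2, by decide, h, h'⟩
      rw [mem_inter] at hu hv
      refine one_lt_card.2 ⟨u, ?_, v, ?_, ?_⟩
      · exact mem_inter.2 ⟨hu.1, mem_biUnion.2 ⟨i, mem_univ _, mem_inter.2 ⟨hui, hu.2⟩⟩⟩
      · exact mem_inter.2 ⟨hv.1, mem_biUnion.2 ⟨j, mem_univ _, mem_inter.2 ⟨hvj, hv.2⟩⟩⟩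
      · rintro rfl
        exact hij (hinj ((hq.edge_eq_of_mem hu.2 (hs i) hui).symm.trans
          (hq.edge_eq_of_mem hu.2 (hs j) hvj)))
    choose! T hTsub hTcard using hT
    calc G.card ≤ (powersetCard 2 S).card := by
          refine card_le_card_of_injOn T (fun g hg => ?_) fun g hg g' hg' hgg' => ?_
          · exact mem_powersetCard.2 ⟨(hTsub g hg).trans inter_subset_right, hTcard g hg⟩
          · obtain ⟨u, hu, v, hv, huv⟩ := one_lt_card.1 (by rw [hTcard g hg]; norm_num)
            have h1 := mem_inter.1 (hTsub g hg hu)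
            have h2 := mem_inter.1 (hTsub g hg hv)
            have h3 := mem_inter.1 (hTsub g' hg' (hgg' ▸ hu))
            have h4 := mem_inter.1 (hTsub g' hg' (hgg' ▸ hv))
            exact eq_of_mem_inter hlin h1.1 h3.1 h2.1 h4.1 huv
      _ = S.card.choose 2 := card_powersetCard _ _
      _ ≤ Nat.choose 6 2 := Nat.choose_le_choose 2 hScard
      _ = 15 := rfl
  have hbadcard : ∀ g ∈ G, (bad g).card ≤ 5 := by
    intro g hg
    suffices ∃ l, ∀ m ∈ bad g, ∀ m' ∈ bad g, m l = m' l → m = m' by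
      obtain ⟨l, hl⟩ := this
      calc (bad g).card ≤ (Icc 1 5).card := by
            refine card_le_card_of_injOn (fun m => m l) (fun m hm => ?_)
              fun m hm m' hm' h => hl m hm m' hm' h
            exact Fintype.mem_piFinset.1 (mem_filter.1 hm).1 l
        _ = 5 := rfl
    by_cases hall : ∀ i, ∃ v ∈ E g ∩ X, v ∈ E (q (s i))
    · choose v hvg hvs using hall
      refine ⟨0, fun m hm m' hm' h0 => funext fun i => ?_⟩
      have h1 := (mem_filter.1 hm).2 (v i) (hvg i) (v 0) (hvg 0)
      have h2 := (mem_filter.1 hm').2 (v i) (hvg i) (v 0) (hvg 0)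
      have key : ∀ m i, inducedWeight E (Ω m) (v i) + ω (q (s i)) =
          inducedWeight E ω (v i) + m i := fun m i =>
        hq.inducedWeight_extend_add_eq hs hinj m (mem_inter.1 (hvg i)).2 (hvs i)
      have := key m i
      have := key m' i
      have := key m 0
      have := key m' 0
      omega
    · obtain ⟨c, hc, hcne⟩ := (hother g hg).resolve_left hall
      push Not at hall
      obtain ⟨l, hl⟩ := hall
      refine ⟨l, fun m hm m' hm' h0 => funext fun i => ?_⟩
      by_cases hil : i = l
      · rw [hil, h0]
      obtain ⟨v, hvg, hvs⟩ := (hhit g hg i l hil).resolve_right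
        fun ⟨v, hv, hv'⟩ => hl v hv hv'
      have h1 := (mem_filter.1 hm).2 v hvg c hc
      have h2 := (mem_filter.1 hm').2 v hvg c hc
      have key : ∀ m, inducedWeight E (Ω m) v + ω (q (s i)) = inducedWeight E ω v + m i :=
        fun m => hq.inducedWeight_extend_add_eq hs hinj m (mem_inter.1 hvg).2 hvs
      have keyc : ∀ m, inducedWeight E (Ω m) c = inducedWeight E ω c :=
        fun m => hq.inducedWeight_extend_of_ne hs m (mem_inter.1 hc).2 hcne
      have := key m
      have := key m'
      have := keyc m
      have := keyc m'
      omega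
  obtain ⟨m, hmM, hm⟩ : ∃ m ∈ M, m ∉ G.biUnion bad := by
    apply exists_mem_notMem_of_card_lt_card
    have := card_biUnion_le_card_mul G bad 5 hbadcard
    omega
  refine ⟨m, fun i => mem_Icc.1 (Fintype.mem_piFinset.1 hmM i), fun g hg => ?_⟩
  by_contra! hcon
  exact hm (mem_biUnion.2 ⟨g, hg, mem_filter.2 ⟨hmM, hcon⟩⟩)

end IsPairing

namespace IsPairing

variable {q : V → ι} {p : V → V} (hq : IsPairing E F X q p)
include hq

lemma exists_isColoring_of_card_min (hlin : ∀ i j, i ≠ j → (E i ∩ E j).card ≤ 1) (hr : 4 ≤ r)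
    (ih : ∀ X' ⊂ X, ∀ F', (∀ e ∈ F', (E e ∩ X').card ≤ 1) → ∃ ω w, IsPartial r E F' X' ω w)
    (hF : ∀ e ∈ F, (E e ∩ X).card ≤ 1) {h : ι} (hh3 : 3 ≤ (E h ∩ X).card)
    (hhr : (E h).card ≤ r)
    (hmin : ∀ g ∉ F, 3 ≤ (E g ∩ X).card → (E h ∩ X).card ≤ (E g ∩ X).card) :
    ∃ ω, IsColoring r E F X ω := by
  set P := E h ∩ X with hP
  have hPX : P ⊆ X := inter_subset_right
  set X' := X.filter fun v => ∀ x ∈ P, q v ≠ q x with hX'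
  have hX'X : X' ⊆ X := filter_subset _ _
  have hsub : ∀ e, E e ∩ X' ⊆ E e ∩ X := fun e => inter_subset_inter_left hX'X
  have hX'P : ∀ v ∈ X', v ∉ P := fun v hv hvP => (mem_filter.1 hv).2 v hvP rfl
  have hX'h : ∀ v ∈ X', v ∉ E h := fun v hv hvh =>
    hX'P v hv (mem_inter.2 ⟨hvh, hX'X hv⟩)
  have hne_edge : ∀ g, 3 ≤ (E g ∩ X).card → ∀ x ∈ X, g ≠ q x := by
    rintro g hg x hx rfl
    have := hq.card_eq hx
    omega
  have hX'q : ∀ v ∈ X', E (q v) ∩ X' = E (q v) ∩ X := by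
    intro v hv
    refine (hsub _).antisymm fun u hu => ?_
    rw [mem_inter] at hu ⊢
    refine ⟨hu.1, mem_filter.2 ⟨hu.2, ?_⟩⟩
    rw [hq.edge_eq_of_mem hu.2 (hX'X hv) hu.1]
    exact (mem_filter.1 hv).2
  have hpartner : ∀ x ∈ P, p x ∉ E h := fun x hx =>
    hq.partner_notMem_of_ne hlin (hPX hx) (mem_inter.1 hx).1 (hne_edge h hh3 x (hPX hx))
  have hPinj : ∀ x ∈ P, ∀ y ∈ P, q x = q y → x = y := by
    intro x hx y hy hxy
    have h1 := hq.mem_edge (hPX hx)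
    rw [hxy] at h1
    rcases hq.eq_or_eq_of_mem (hPX hx) (hPX hy) h1 with h2 | h2
    · exact h2
    · exact absurd (h2 ▸ (mem_inter.1 hx).1) (hpartner y hy)
  set G := univ.filter fun g => g ∉ F ∧ 3 ≤ (E g ∩ X).card ∧ (E g ∩ X').card ≤ 1 with hG
  have hss : X' ⊂ X := by
    refine ⟨hX'X, fun hXX' => ?_⟩
    obtain ⟨x, hx⟩ := card_pos.1 (show 0 < P.card by omega)
    exact hX'P x (hXX' (hPX hx)) hx
  obtain ⟨ω₀, w, hω₀⟩ := ih X' hss (F ∪ G) fun e he => by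
    rcases mem_union.1 he with he | he
    · exact (card_le_card (hsub e)).trans (hF e he)
    · exact (mem_filter.1 he).2.2.2
  have hcol : IsColoring r E (F ∪ G) X' ω₀ := by
    refine hω₀.isColoring fun u hu => eq_empty_of_forall_notMem fun e he => ?_
    obtain ⟨heF, heX'⟩ := mem_pending.1 he
    rw [mem_union, not_or] at heF
    have hue : u ∈ E e := (mem_of_mem_pending he).1
    have h0 : 0 < (E e ∩ X).card := card_pos.2 ⟨u, mem_inter.2 ⟨hue, hX'X hu⟩⟩
    have h1 := hq.card_ne_one heF.1
    by_cases h2 : (E e ∩ X).card = 2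
    · have := hq.unique u (hX'X hu) e heF.1 hue h2
      rw [this, hX'q u hu, ← this] at heX'
      rw [heX', card_singleton] at h2
      omega
    · exact heF.2 (mem_filter.2 ⟨mem_univ _, heF.1, by omega, by rw [heX', card_singleton]⟩)
  -- the weight of `h` makes all matched pairs meeting `h` properly colored
  obtain ⟨t, ht, htbad⟩ : ∃ t ∈ Icc 1 (r + 1),
      t ∉ P.image fun x => inducedWeight E ω₀ (p x) + ω₀ h - inducedWeight E ω₀ x := by
    apply exists_mem_notMem_of_card_lt_card
    have h1 : P.card ≤ r := (card_le_card inter_subset_left).trans hhr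
    have h2 := card_image_le (s := P)
      (f := fun x => inducedWeight E ω₀ (p x) + ω₀ h - inducedWeight E ω₀ x)
    rw [Nat.card_Icc]
    omega
  set ω₁ := Function.update ω₀ h t with hω₁
  have hpairs : ∀ x ∈ P, inducedWeight E ω₁ x ≠ inducedWeight E ω₁ (p x) := by
    intro x hx heq
    have h1 := inducedWeight_add_eq (ω := ω₀) (ω' := ω₁) (mem_inter.1 hx).1
      fun e' _ h => Function.update_of_ne h _ _
    have h2 : inducedWeight E ω₁ (p x) = inducedWeight E ω₀ (p x) :=
      inducedWeight_congr fun e he =>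
        Function.update_of_ne (fun h' : e = h => hpartner x hx (h' ▸ he)) _ _
    have h3 : ω₁ h = t := Function.update_self _ _ _
    exact htbad (mem_image.2 ⟨x, hx, by omega⟩)
  -- the three matching edges
  set s : Fin 3 → V := fun i => P.equivFin.symm (Fin.castLE hh3 i) with hs
  have hsP : ∀ i, s i ∈ P := fun i => (P.equivFin.symm (Fin.castLE hh3 i)).2
  have hsX : ∀ i, s i ∈ X := fun i => hPX (hsP i)
  have hsinj : Function.Injective s := Subtype.val_injective.comp
    (P.equivFin.symm.injective.comp (Fin.castLE_injective hh3))
  have hinj : Function.Injective fun i => q (s i) := fun i j hij =>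
    hsinj (hPinj _ (hsP i) _ (hsP j) hij)
  have hcount : ∀ g ∈ G, (P.filter fun x => ¬ ∃ v ∈ E g ∩ X, v ∈ E (q x)).card ≤
      (E g ∩ X').card := by
    intro g hg
    obtain ⟨-, hgF, hg3, -⟩ := mem_filter.1 hg
    have h1 : (E g ∩ X).card ≤ (E g ∩ X').card +
        ((P.filter fun x => ∃ v ∈ E g ∩ X, v ∈ E (q x)).biUnion
          fun x => E g ∩ E (q x)).card := by
      refine (card_le_card fun u hu => ?_).trans (card_union_le _ _)
      have hu' := mem_inter.1 hu
      by_cases huX' : u ∈ X'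
      · exact mem_union_left _ (mem_inter.2 ⟨hu'.1, huX'⟩)
      · have : ∃ x ∈ P, q u = q x := by
          by_contra! hcon
          exact huX' (mem_filter.2 ⟨hu'.2, hcon⟩)
        obtain ⟨x, hx, hux⟩ := this
        have hmem := hq.mem_edge hu'.2
        rw [hux] at hmem
        exact mem_union_right _ (mem_biUnion.2
          ⟨x, mem_filter.2 ⟨hx, u, hu, hmem⟩, mem_inter.2 ⟨hu'.1, hmem⟩⟩)
    have h2 := card_biUnion_le_card_mul (P.filter fun x => ∃ v ∈ E g ∩ X, v ∈ E (q x))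
      (fun x => E g ∩ E (q x)) 1 fun x hx =>
        hlin g (q x) (hne_edge g hg3 x (hPX (mem_filter.1 hx).1))
    have h3 := card_filter_add_card_filter_not (s := P) fun x => ∃ v ∈ E g ∩ X, v ∈ E (q x)
    have h4 := hmin g hgF hg3
    omega
  obtain ⟨m, hm, hmG⟩ := hq.exists_extend_ne (ω := ω₁) hlin hsX hinj (G := G)
    (by
      intro g hg i j hij
      by_contra! hcon
      have h1 := (hcount g hg).trans (mem_filter.1 hg).2.2.2
      refine hij (hsinj (card_le_one.1 h1 _ ?_ _ ?_))
      · exact mem_filter.2 ⟨hsP i, fun ⟨v, hv, hv'⟩ => hcon.1 v hv hv'⟩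
      · exact mem_filter.2 ⟨hsP j, fun ⟨v, hv, hv'⟩ => hcon.2 v hv hv'⟩)
    (by
      intro g hg
      refine or_iff_not_imp_left.2 fun hall => ?_
      rw [not_forall] at hall
      obtain ⟨i, hi⟩ := hall
      obtain ⟨c, hc⟩ := card_pos.1
        ((card_pos.2 ⟨s i, mem_filter.2 ⟨hsP i, hi⟩⟩).trans_le (hcount g hg))
      exact ⟨c, hsub g hc, fun j => (mem_filter.1 (mem_inter.1 hc).2).2 _ (hsP j)⟩)
  set ω₂ := Function.extend (fun i => q (s i)) m ω₁ with hω₂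
  have hX'same : ∀ v ∈ X', inducedWeight E ω₂ v = inducedWeight E ω₀ v := by
    intro v hv
    rw [hq.inducedWeight_extend_of_ne hsX m (hX'X hv)
      fun i => (mem_filter.1 hv).2 _ (hsP i)]
    exact inducedWeight_congr fun e he =>
      Function.update_of_ne (fun h' : e = h => hX'h v hv (h' ▸ he)) _ _
  have hlift : ∀ e ∉ F ∪ G, 2 ≤ (E e ∩ X').card → ∃ u ∈ E e ∩ X, ∃ v ∈ E e ∩ X,
      inducedWeight E ω₂ u ≠ inducedWeight E ω₂ v := by
    intro e he he2
    obtain ⟨u, hu, v, hv, huv⟩ := hcol.ne e he he2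
    refine ⟨u, hsub e hu, v, hsub e hv, ?_⟩
    rwa [hX'same u (mem_inter.1 hu).2, hX'same v (mem_inter.1 hv).2]
  refine ⟨ω₂, fun e => ?_, fun e heF he => ?_⟩
  · by_cases hex : ∃ i, q (s i) = e
    · obtain ⟨i, rfl⟩ := hex
      rw [hω₂, hinj.extend_apply m ω₁ i]
      have := hm i
      omega
    · rw [hω₂, Function.extend_apply' _ _ _ hex]
      by_cases heh : e = h
      · rw [heh, hω₁, Function.update_self]
        exact mem_Icc.1 ht
      · rw [hω₁, Function.update_of_ne heh]
        exact hcol.range e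
  · by_cases he2 : (E e ∩ X).card = 2
    · obtain ⟨v, hv⟩ := card_pos.1 (show 0 < (E e ∩ X).card by omega)
      have hvX := (mem_inter.1 hv).2
      have hev := hq.unique v hvX e heF (mem_inter.1 hv).1 he2
      by_cases hvX' : v ∈ X'
      · refine hlift e ?_ ?_
        · rw [mem_union, not_or]
          refine ⟨heF, fun heG => ?_⟩
          have := (mem_filter.1 heG).2.2.1
          omega
        · rw [hev, hX'q v hvX', ← hev, he2]
      · obtain ⟨x, hx, hvx⟩ : ∃ x ∈ P, q v = q x := by
          by_contra! hcon
          exact hvX' (mem_filter.2 ⟨hvX, hcon⟩)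
        rw [hev, hvx]
        have hxX := hPX hx
        refine ⟨x, mem_inter.2 ⟨hq.mem_edge hxX, hxX⟩, p x, hq.partner_mem_inter hxX, ?_⟩
        have hxp := hpairs x hx
        by_cases hxs : ∃ i, q x = q (s i)
        · obtain ⟨i, hi⟩ := hxs
          have h1 := hq.inducedWeight_extend_add_eq (ω := ω₁) hsX hinj m hxX
            (hi ▸ hq.mem_edge hxX)
          have h2 := hq.inducedWeight_extend_add_eq (ω := ω₁) hsX hinj m (hq.partner_mem hxX)
            (hi ▸ hq.partner_mem_edge hxX)
          rw [← hω₂] at h1 h2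
          omega
        · push Not at hxs
          rw [hω₂, hq.inducedWeight_extend_of_ne hsX m hxX hxs,
            hq.inducedWeight_extend_of_ne hsX m (hq.partner_mem hxX)
              fun i => by rw [hq.edge_partner hxX]; exact hxs i]
          exact hxp
    · by_cases heG : e ∈ G
      · exact hmG e heG
      · refine hlift e (by simp [heF, heG]) ?_
        by_contra hcon
        exact heG (mem_filter.2 ⟨mem_univ _, heF, by omega, by omega⟩)

end IsPairing

lemma exists_isPartial (hr : 4 ≤ r) (hlin : ∀ i j, i ≠ j → (E i ∩ E j).card ≤ 1)
    (hcard : ∀ e, (E e).card ≤ r) (X : Finset V) (F : Finset ι)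
    (hF : ∀ e ∈ F, (E e ∩ X).card ≤ 1)
    (hdeg : ∀ e, ∀ x ∈ E e ∩ X, ∀ y ∈ E e ∩ X, x ≠ y →
      (∃ e' ≠ e, x ∈ E e') ∨ ∃ e' ≠ e, y ∈ E e') :
    ∃ ω w, IsPartial r E F X ω w := by
  induction X using Finset.strongInduction generalizing F with
  | H X ih =>
    have ih' : ∀ X' ⊂ X, ∀ F', (∀ e ∈ F', (E e ∩ X').card ≤ 1) →
        ∃ ω w, IsPartial r E F' X' ω w := by
      intro X' hX' F' hF'
      have hsub : ∀ e, E e ∩ X' ⊆ E e ∩ X := fun e => inter_subset_inter_left hX'.1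
      exact ih X' hX' F' hF' fun e x hx y hy => hdeg e x (hsub e hx) y (hsub e hy)
    have ih_erase : ∀ v ∈ X, ∃ ω w, IsPartial r E F (X.erase v) ω w := fun v hv =>
      ih' _ (erase_ssubset hv) F fun e he =>
        (card_le_card (inter_subset_inter_left (erase_subset _ _))).trans (hF e he)
    rcases X.eq_empty_or_nonempty with rfl | ⟨v₀, hv₀⟩
    · exact ⟨fun _ => 1, 0, by simp, by simp, by simp⟩
    by_cases hpend : ∃ v ∈ X, (pending E F X v).Nonempty
    · obtain ⟨v, hv, hp⟩ := hpend
      obtain ⟨ω, w, h⟩ := ih_erase v hv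
      rw [← insert_erase hv] at hp ⊢
      exact exists_isPartial_insert_of_pending hr hlin h (notMem_erase v X) hp
    simp only [not_exists, not_and, not_nonempty_iff_eq_empty] at hpend
    by_cases hback : ∃ v ∈ X, (back E F (X.erase v) v).card ≠ 1
    · obtain ⟨v, hv, hb⟩ := hback
      obtain ⟨ω, w, h⟩ := ih_erase v hv
      rw [← insert_erase hv] at hpend ⊢
      rcases Nat.eq_zero_or_pos (back E F (X.erase v) v).card with h0 | h0
      · exact exists_isPartial_insert_of_back_eq_empty hr hlin h (notMem_erase v X)
          (hpend v (mem_insert_self _ _)) (card_eq_zero.1 h0)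
      · exact exists_isPartial_insert_of_two_le_card_back hr hlin h (notMem_erase v X) hpend
          (by omega)
    push Not at hback
    have hmatch : ∀ v, ∃ e u, v ∈ X → back E F (X.erase v) v = {e} ∧ E e ∩ X.erase v = {u} := by
      intro v
      by_cases hv : v ∈ X
      · obtain ⟨e, he⟩ := card_eq_one.1 (hback v hv)
        have hmem : e ∈ back E F (X.erase v) v := by simp [he]
        obtain ⟨u, hu⟩ := card_eq_one.1 (mem_back.1 hmem).2.2
        exact ⟨e, u, fun _ => ⟨he, hu⟩⟩
      · obtain ⟨e, -⟩ := card_eq_one.1 (hback v₀ hv₀)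
        exact ⟨e, v, fun h => absurd h hv⟩
    choose q p hqp using hmatch
    have hqback : ∀ v ∈ X, q v ∈ back E F (X.erase v) v := fun v hv => by simp [(hqp v hv).1]
    have hinter : ∀ v ∈ X, ∀ e, v ∈ E e → E e ∩ X = insert v (E e ∩ X.erase v) := by
      intro v hv e he
      rw [← inter_insert_of_mem he, insert_erase hv]
    have hq : IsPairing E F X q p := by
      refine ⟨hpend, fun v hv => (mem_back.1 (hqback v hv)).1, fun v hv => ?_, fun v hv => ?_,
        fun v hv e he hve h2 => ?_⟩
      · rw [hinter v hv _ (mem_back.1 (hqback v hv)).2.1, (hqp v hv).2]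
      · have : p v ∈ E (q v) ∩ X.erase v := by simp [(hqp v hv).2]
        exact ne_of_mem_erase (mem_inter.1 this).2
      · have : e ∈ back E F (X.erase v) v := by
          refine mem_back.2 ⟨he, hve, ?_⟩
          rw [hinter v hv e hve, card_insert_of_notMem (by simp)] at h2
          omega
        rwa [(hqp v hv).1, mem_singleton] at this
    suffices ∃ ω, IsColoring r E F X ω by
      obtain ⟨ω, hω⟩ := this
      exact ⟨ω, _, hω.isPartial hpend⟩
    obtain ⟨x, hx, g, hg, hxg⟩ : ∃ x ∈ X, ∃ g ≠ q x, x ∈ E g := by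
      have hv := hq.partner_mem hv₀
      rcases hdeg (q v₀) v₀ (mem_inter.2 ⟨hq.mem_edge hv₀, hv₀⟩) (p v₀)
        (hq.partner_mem_inter hv₀) (hq.ne v₀ hv₀).symm with ⟨g, hg, h⟩ | ⟨g, hg, h⟩
      · exact ⟨v₀, hv₀, g, hg, h⟩
      · exact ⟨p v₀, hv, g, by rwa [hq.edge_partner hv₀], h⟩
    by_cases hgF : g ∈ F
    · exact hq.exists_isColoring_of_mem hlin hr ih' hF hx hgF hxg
    have hg3 : 3 ≤ (E g ∩ X).card := by
      have h0 : 0 < (E g ∩ X).card := card_pos.2 ⟨x, mem_inter.2 ⟨hxg, hx⟩⟩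
      have h1 := hq.card_ne_one hgF
      have h2 : (E g ∩ X).card ≠ 2 := fun h2 => hg (hq.unique x hx g hgF hxg h2)
      omega
    obtain ⟨h, hh, hmin⟩ := exists_min_image
      (univ.filter fun g => g ∉ F ∧ 3 ≤ (E g ∩ X).card) (fun g => (E g ∩ X).card)
      ⟨g, mem_filter.2 ⟨mem_univ _, hgF, hg3⟩⟩
    obtain ⟨-, -, hh3⟩ := mem_filter.1 hh
    exact hq.exists_isColoring_of_card_min hlin hr ih' hF hh3 (hcard h)
      fun e he he3 => hmin e (mem_filter.2 ⟨mem_univ _, he, he3⟩)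

lemma exists_coloring [Fintype V] (hr : 4 ≤ r) (hcard : ∀ e, 2 ≤ (E e).card ∧ (E e).card ≤ r)
    (hlin : ∀ i j, i ≠ j → (E i ∩ E j).card ≤ 1)
    (htwin : ∀ i, ¬ ∀ u ∈ E i, ∀ v ∈ E i, ∀ j, (u ∈ E j ↔ v ∈ E j)) :
    ∃ ω : ι → ℕ, (∀ i, 1 ≤ ω i ∧ ω i ≤ r + 1) ∧
      ∀ i, ∃ u ∈ E i, ∃ v ∈ E i, inducedWeight E ω u ≠ inducedWeight E ω v := by
  have hbig : ∀ e, ∃ x ∈ E e, ∃ e' ≠ e, x ∈ E e' := by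
    intro e
    by_contra! hcon
    refine htwin e fun u hu v hv j => ?_
    by_cases hj : j = e
    · simp [hj, hu, hv]
    · simp [hcon u hu j hj, hcon v hv j hj]
  -- a representative of the vertices of degree one in each edge
  have hrep : ∀ e, ∃ x ∈ E e, (∃ y ∈ E e, ∀ e' ≠ e, y ∉ E e') → ∀ e' ≠ e, x ∉ E e' := by
    intro e
    by_cases h : ∃ y ∈ E e, ∀ e' ≠ e, y ∉ E e'
    · obtain ⟨y, hy, hy'⟩ := h
      exact ⟨y, hy, fun _ => hy'⟩
    · obtain ⟨x, hx, -⟩ := hbig e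
      exact ⟨x, hx, fun h' => absurd h' h⟩
  choose ρ hρ hρ' using hrep
  set X : Finset V := univ.filter fun v => ∀ e, v ∈ E e → (∃ e' ≠ e, v ∈ E e') ∨ v = ρ e with hX
  have hdeg : ∀ e, ∀ x ∈ E e ∩ X, ∀ y ∈ E e ∩ X, x ≠ y →
      (∃ e' ≠ e, x ∈ E e') ∨ ∃ e' ≠ e, y ∈ E e' := by
    intro e x hx y hy hxy
    rw [mem_inter, mem_filter] at hx hy
    rcases hx.2.2 e hx.1 with h | h
    · exact Or.inl h
    · rcases hy.2.2 e hy.1 with h' | h'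
      · exact Or.inr h'
      · exact absurd (h.trans h'.symm) hxy
  have htwo : ∀ e, 2 ≤ (E e ∩ X).card := by
    intro e
    have hmem : ∀ x ∈ E e, (∃ e' ≠ e, x ∈ E e') → x ∈ E e ∩ X := by
      rintro x hx ⟨e', he', hxe'⟩
      refine mem_inter.2 ⟨hx, mem_filter.2 ⟨mem_univ _, fun j _ => Or.inl ?_⟩⟩
      by_cases hj : j = e
      · exact ⟨e', hj ▸ he', hxe'⟩
      · exact ⟨e, Ne.symm hj, hx⟩
    by_cases hone : ∃ y ∈ E e, ∀ e' ≠ e, y ∉ E e'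
    · obtain ⟨x, hx, hx'⟩ := hbig e
      refine one_lt_card.2 ⟨x, hmem x hx hx', ρ e, mem_inter.2 ⟨hρ e, ?_⟩, ?_⟩
      · refine mem_filter.2 ⟨mem_univ _, fun j hj => Or.inr ?_⟩
        by_contra hne
        exact hρ' e hone j (fun h => hne (by rw [h])) hj
      · rintro rfl
        obtain ⟨e', he', hxe'⟩ := hx'
        exact hρ' e hone e' he' hxe'
    · push Not at hone
      have : E e ∩ X = E e := inter_subset_left.antisymm fun x hx => hmem x hx (hone x hx)
      rw [this]
      exact (hcard e).1
  obtain ⟨ω, w, h⟩ := exists_isPartial hr hlin (fun e => (hcard e).2) X ∅ (by simp) hdeg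
  have hcol : IsColoring r E ∅ X ω := by
    refine h.isColoring fun v _ => eq_empty_of_forall_notMem fun e he => ?_
    have := htwo e
    rw [(mem_pending.1 he).2, card_singleton] at this
    omega
  refine ⟨ω, hcol.range, fun e => ?_⟩
  obtain ⟨u, hu, v, hv, huv⟩ := hcol.ne e (notMem_empty e) (htwo e)
  exact ⟨u, (mem_inter.1 hu).1, v, (mem_inter.1 hv).1, huv⟩

/-- The edges of a complete graph with both orientations of each edge as vertices: the star of `i`
consists of the pairs starting at `i`, and each pair is joined to its reverse. -/
def starEdge (n : ℕ) :
    Fin n ⊕ {p : Fin n × Fin n // p.1 < p.2} → Finset (Fin n × Fin n)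
  | .inl i => univ.filter fun x => x.1 = i ∧ x.2 ≠ i
  | .inr p => {p.1, p.1.swap}

lemma mem_starEdge_inl {n : ℕ} {i : Fin n} {x : Fin n × Fin n} :
    x ∈ starEdge n (.inl i) ↔ x.1 = i ∧ x.2 ≠ i := by
  simp [starEdge]

lemma mem_starEdge_inr {n : ℕ} {p : {p : Fin n × Fin n // p.1 < p.2}} {x : Fin n × Fin n} :
    x ∈ starEdge n (.inr p) ↔ x = p.1 ∨ x = p.1.swap := by
  simp [starEdge]

lemma eq_of_mem_starEdge_inr {n : ℕ} {p : {p : Fin n × Fin n // p.1 < p.2}} {x : Fin n × Fin n}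
    (hx : x ∈ starEdge n (.inr p)) :
    p.1 = (min x.1 x.2, max x.1 x.2) := by
  have hp := p.2
  rcases mem_starEdge_inr.1 hx with rfl | rfl
  · simp [hp.le]
  · simp [hp.le]

lemma card_starEdge_inl {n : ℕ} (i : Fin n) : (starEdge n (.inl i)).card = n - 1 := by
  have : starEdge n (.inl i) = (univ.erase i).image fun j => (i, j) := by
    ext x
    simp only [mem_starEdge_inl, mem_image, mem_erase, mem_univ, and_true]
    constructor
    · rintro ⟨h1, h2⟩
      exact ⟨x.2, h2, by rw [← h1]⟩
    · rintro ⟨j, hj, rfl⟩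
      exact ⟨rfl, hj⟩
  rw [this, card_image_of_injective _ (Prod.mk_right_injective i), card_erase_of_mem (mem_univ i),
    card_fin]

lemma card_starEdge_inter_le {n : ℕ} (i j : Fin n ⊕ {p : Fin n × Fin n // p.1 < p.2})
    (hij : i ≠ j) : (starEdge n i ∩ starEdge n j).card ≤ 1 := by
  refine card_le_one.2 fun x hx y hy => ?_
  rw [mem_inter] at hx hy
  rcases i with i | p <;> rcases j with j | p'
  · simp only [mem_starEdge_inl] at hx
    exact absurd (congrArg _ (hx.1.1.symm.trans hx.2.1)) hij
  · simp only [mem_starEdge_inl, mem_starEdge_inr] at hx hy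
    have hp := p'.2
    grind [Prod.swap]
  · simp only [mem_starEdge_inl, mem_starEdge_inr] at hx hy
    have hp := p.2
    grind [Prod.swap]
  · exact absurd (congrArg _ (Subtype.ext ((eq_of_mem_starEdge_inr hx.1).trans
      (eq_of_mem_starEdge_inr hx.2).symm))) hij

lemma sum_starEdge {n : ℕ} (ω : Fin n ⊕ {p : Fin n × Fin n // p.1 < p.2} → ℕ)
    (p : {p : Fin n × Fin n // p.1 < p.2}) {x : Fin n × Fin n} (hx : x ∈ starEdge n (.inr p)) :
    (∑ j, if x ∈ starEdge n j then ω j else 0) = ω (.inl x.1) + ω (.inr p) := by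
  have hp := p.2
  have hne : x.2 ≠ x.1 := by
    rcases mem_starEdge_inr.1 hx with rfl | rfl
    · exact hp.ne'
    · exact hp.ne
  rw [Fintype.sum_sum_type]
  congr 1
  · rw [Fintype.sum_eq_single x.1, if_pos (mem_starEdge_inl.2 ⟨rfl, hne⟩)]
    intro i hi
    exact if_neg fun h => hi (mem_starEdge_inl.1 h).1.symm
  · rw [Fintype.sum_eq_single p, if_pos hx]
    intro p' hp'
    exact if_neg fun h => hp' (Subtype.ext ((eq_of_mem_starEdge_inr h).trans
      (eq_of_mem_starEdge_inr hx).symm))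

lemma starEdge_not_twins {n : ℕ} (hn : 3 ≤ n)
    (i : Fin n ⊕ {p : Fin n × Fin n // p.1 < p.2}) :
    ¬ ∀ u ∈ starEdge n i, ∀ v ∈ starEdge n i, ∀ j, (u ∈ starEdge n j ↔ v ∈ starEdge n j) := by
  intro h
  rcases i with i | p
  · obtain ⟨x, hx, y, hy, hxy⟩ := one_lt_card.1
      (show 1 < (starEdge n (.inl i)).card by rw [card_starEdge_inl]; omega)
    have hxi := mem_starEdge_inl.1 hx
    obtain ⟨p, hp⟩ : ∃ p, x ∈ starEdge n (.inr p) := by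
      rcases lt_or_gt_of_ne (show x.1 ≠ x.2 from hxi.1 ▸ hxi.2.symm) with hlt | hlt
      · exact ⟨⟨x, hlt⟩, mem_starEdge_inr.2 (Or.inl rfl)⟩
      · exact ⟨⟨x.swap, hlt⟩, mem_starEdge_inr.2 (Or.inr (by simp))⟩
    have hp' := (h x hx y hy (.inr p)).1 hp
    exact hxy (card_le_one.1 (card_starEdge_inter_le (.inl i) (.inr p) (by simp))
      x (mem_inter.2 ⟨hx, hp⟩) y (mem_inter.2 ⟨hy, hp'⟩))
  · have hp := p.2
    have h1 := (h p.1 (mem_starEdge_inr.2 (Or.inl rfl)) p.1.swap (mem_starEdge_inr.2 (Or.inr rfl))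
      (.inl p.1.1)).1 (mem_starEdge_inl.2 ⟨rfl, hp.ne'⟩)
    exact hp.ne' (mem_starEdge_inl.1 h1).1

lemma exists_starEdge_monochromatic {r : ℕ}
    (ω : Fin (r + 1) ⊕ {p : Fin (r + 1) × Fin (r + 1) // p.1 < p.2} → ℕ)
    (hω : ∀ i, 1 ≤ ω i ∧ ω i ≤ r) :
    ∃ i, ∀ u ∈ starEdge (r + 1) i, ∀ v ∈ starEdge (r + 1) i,
      (∑ j, if u ∈ starEdge (r + 1) j then ω j else 0) =
        ∑ j, if v ∈ starEdge (r + 1) j then ω j else 0 := by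
  obtain ⟨a, -, b, -, hab, heq⟩ := exists_ne_map_eq_of_card_lt_of_maps_to
    (s := univ) (t := Icc 1 r) (f := fun i => ω (.inl i)) (by simp) fun i _ =>
      mem_Icc.2 (hω (.inl i))
  wlog hlt : a < b generalizing a b
  · exact this b a hab.symm heq.symm (lt_of_le_of_ne (not_lt.1 hlt) hab.symm)
  refine ⟨.inr ⟨(a, b), hlt⟩, fun u hu v hv => ?_⟩
  have key : ∀ x ∈ starEdge (r + 1) (.inr ⟨(a, b), hlt⟩), ω (.inl x.1) = ω (.inl a) := by
    intro x hx
    rcases mem_starEdge_inr.1 hx with rfl | rfl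
    · rfl
    · exact heq.symm
  rw [sum_starEdge ω _ hu, sum_starEdge ω _ hv, key u hu, key v hv]

lemma exists_hypergraph_not_colorable (r : ℕ) (hr : 2 ≤ r) :
    ∃ (N M : ℕ) (E : Fin M → Finset (Fin N)),
      (∀ i j, i ≠ j → (E i ∩ E j).card ≤ 1) ∧
      (∀ i, (E i).card ≤ r) ∧ (∃ i, (E i).card = r) ∧
      (∀ i, ¬ (∀ u ∈ E i, ∀ v ∈ E i, ∀ j, (u ∈ E j ↔ v ∈ E j))) ∧
      ∀ ω : Fin M → ℕ, (∀ i, 1 ≤ ω i ∧ ω i ≤ r) →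
        ∃ i, ∀ u ∈ E i, ∀ v ∈ E i,
          (∑ j, if u ∈ E j then ω j else 0) = (∑ j, if v ∈ E j then ω j else 0) := by
  set a := Fintype.equivFin (Fin (r + 1) × Fin (r + 1))
  set b := Fintype.equivFin (Fin (r + 1) ⊕ {p : Fin (r + 1) × Fin (r + 1) // p.1 < p.2})
  refine ⟨_, _, fun m => (starEdge (r + 1) (b.symm m)).map a.toEmbedding, ?_, ?_, ?_, ?_, ?_⟩
  · intro i j hij
    rw [← map_inter, card_map]
    exact card_starEdge_inter_le _ _ (b.symm.injective.ne hij)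
  · intro i
    rw [card_map]
    rcases b.symm i with i | p
    · rw [card_starEdge_inl, Nat.add_sub_cancel]
    · exact card_le_two.trans hr
  · exact ⟨b (.inl 0), by rw [card_map, b.symm_apply_apply, card_starEdge_inl,
      Nat.add_sub_cancel]⟩
  · intro i h
    refine starEdge_not_twins (by omega) (b.symm i) fun u hu v hv j => ?_
    simpa using h (a u) (by simpa using hu) (a v) (by simpa using hv) (b j)
  · intro ω hω
    obtain ⟨i, hi⟩ := exists_starEdge_monochromatic (fun i => ω (b i)) fun i => hω (b i)
    refine ⟨b i, fun u hu v hv => ?_⟩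
    have hsum : ∀ u, (∑ j, if u ∈ (starEdge (r + 1) (b.symm j)).map a.toEmbedding then ω j else 0) =
        ∑ j, if a.symm u ∈ starEdge (r + 1) j then ω (b j) else 0 := by
      intro u
      rw [← Equiv.sum_comp b]
      simp [mem_map_equiv]
    rw [hsum, hsum]
    refine hi _ ?_ _ ?_
    · simpa [mem_map_equiv] using hu
    · simpa [mem_map_equiv] using hv

end LinearHypergraph

/-- For every `r ≥ 4`: (a) every linear hypergraph in which each edge
has size between `2` and `r` and no edge consists of twins admits an edge weighting with
weights in `{1, …, r+1}` whose induced vertex weights properly color the vertices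
(every edge contains two vertices with different induced weights); and (b) the bound
`r + 1` cannot be replaced by `r`: there is a linear hypergraph with maximum edge size
`r` and no edge consisting of twins, admitting no vertex-coloring weighting from
`{1, …, r}`. -/
theorem linear_hypergraph_r_plus_one_tight (r : ℕ) (hr : 4 ≤ r) :
    (∀ (V ι : Type) [Fintype V] [Fintype ι] [DecidableEq V] (E : ι → Finset V),
      (∀ i, 2 ≤ (E i).card ∧ (E i).card ≤ r) →
      (∀ i j, i ≠ j → (E i ∩ E j).card ≤ 1) →
      (∀ i, ¬ (∀ u ∈ E i, ∀ v ∈ E i, ∀ j, (u ∈ E j ↔ v ∈ E j))) →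
      ∃ ω : ι → ℕ, (∀ i, 1 ≤ ω i ∧ ω i ≤ r + 1) ∧
        ∀ i, ∃ u ∈ E i, ∃ v ∈ E i,
          (∑ j, if u ∈ E j then ω j else 0) ≠ (∑ j, if v ∈ E j then ω j else 0)) ∧
    (∃ (N M : ℕ) (E : Fin M → Finset (Fin N)),
      (∀ i j, i ≠ j → (E i ∩ E j).card ≤ 1) ∧
      (∀ i, (E i).card ≤ r) ∧ (∃ i, (E i).card = r) ∧
      (∀ i, ¬ (∀ u ∈ E i, ∀ v ∈ E i, ∀ j, (u ∈ E j ↔ v ∈ E j))) ∧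
      ∀ ω : Fin M → ℕ, (∀ i, 1 ≤ ω i ∧ ω i ≤ r) →
        ∃ i, ∀ u ∈ E i, ∀ v ∈ E i,
          (∑ j, if u ∈ E j then ω j else 0) = (∑ j, if v ∈ E j then ω j else 0)) := by
  refine ⟨fun V ι _ _ _ E hcard hlin htwin => ?_,
    LinearHypergraph.exists_hypergraph_not_colorable r (by omega)⟩
  classical
  obtain ⟨ω, hω, h⟩ := LinearHypergraph.exists_coloring hr hcard hlin htwin
  refine ⟨ω, hω, fun i => ?_⟩
  simpa only [LinearHypergraph.inducedWeight, Finset.sum_filter] using h i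
end
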